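/- Let k be an algebraically closed field of characteristic p ≥ 5 and let G be the alternating group A_p or the projective special linear group PSL_2(F_p). Let G_0 be a subgroup of G having a normal p-subgroup G_1 with G_0/G_1 cyclic of order prime to p. Then G_0 occurs as the inertia group at a point over ∞ of some G-Galois cover of the projective line branched only at ∞ if and only if the conjugates of G_1 in G generate G. (Abhyankar's Inertia Conjecture holds for A_p and PSL_2(p), Bouw–Pries.) -/

import Mathlib

open scoped Polynomial

/-- The projective special linear group `PSL₂(R)`. -/
abbrev PSL₂ (R : Type) [CommRing R] : Type :=
  Matrix.SpecialLinearGroup (Fin 2) R ⧸ Subgroup.center (Matrix.SpecialLinearGroup (Fin 2) R)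

/-- The place at infinity of the rational function field `k(X)`: the valuation
subring `𝒪_∞ = {f/g : deg f ≤ deg g}`. -/
noncomputable def inftyPlace (k : Type) [Field k] : ValuationSubring (RatFunc k) :=
  letI := Classical.decEq (RatFunc k)
  (FunctionField.inftyValuation k).valuationSubring

/-- The inertia group at a point (valuation subring) `O` of `L`, viewed as a
subgroup of the Galois group of `L/k(X)`: the subgroup of the stabilizer
(decomposition group) of `O` consisting of the elements acting trivially on the
residue field of `O`. -/
noncomputable def inertiaIn (k : Type) [Field k] {L : Type} [Field L]
    [Algebra (RatFunc k) L] (O : ValuationSubring L) : Subgroup (L ≃ₐ[RatFunc k] L) :=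
  (O.inertiaSubgroup (RatFunc k)).map (O.decompositionSubgroup (RatFunc k)).subtype

/-- The subgroup `G₀` of `G` occurs as the inertia group at a point over `∞` of
some `G`-Galois cover of the projective line over `k` branched only at `∞`. -/
def OccursAsInertiaAtInfty (k : Type) [Field k] (G : Type) [Group G]
    (G₀ : Subgroup G) : Prop :=
  ∃ (L : Type) (_ : Field L) (_ : Algebra (RatFunc k) L) (_ : Algebra (Polynomial k) L)
    (_ : IsScalarTower (Polynomial k) (RatFunc k) L),
    FiniteDimensional (RatFunc k) L ∧ IsGalois (RatFunc k) L ∧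
    Algebra.Etale (Polynomial k) (integralClosure (Polynomial k) L) ∧
    ∃ (e : G ≃* (L ≃ₐ[RatFunc k] L)) (O : ValuationSubring L),
      O.comap (algebraMap (RatFunc k) L) = inftyPlace k ∧
      Subgroup.map e.toMonoidHom G₀ = inertiaIn k O

section SylowOfPrimeOrder

/-- The `p`-local properties shared by `A_p` and `PSL₂(p)`: Sylow `p`-subgroups have order `p` and
are self-centralizing, and their normalizers act on them through squares of `(ZMod p)ˣ`. -/
structure SquareNormalizing (p : ℕ) (G : Type*) [Group G] : Prop where
  not_sq_dvd : ¬ p ^ 2 ∣ Nat.card G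
  pow_modEq_one : ∀ g h : G, orderOf g = p → ∀ a : ℕ, h * g * h⁻¹ = g ^ a →
    a ^ ((p - 1) / 2) ≡ 1 [MOD p]
  mem_zpowers : ∀ g h : G, orderOf g = p → h * g * h⁻¹ = g → h ∈ Subgroup.zpowers g

lemma SquareNormalizing.of_mulEquiv {p : ℕ} {G H : Type*} [Group G] [Group H] (e : G ≃* H)
    (hH : SquareNormalizing p H) : SquareNormalizing p G where
  not_sq_dvd := by rw [Nat.card_congr e.toEquiv]; exact hH.not_sq_dvd
  pow_modEq_one g h hg a ha := by
    refine hH.pow_modEq_one (e g) (e h) (by rw [MulEquiv.orderOf_eq, hg]) a ?_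
    rw [← map_inv, ← map_mul, ← map_mul, ha, map_pow]
  mem_zpowers g h hg ha := by
    obtain ⟨i, hi⟩ := hH.mem_zpowers (e g) (e h) (by rw [MulEquiv.orderOf_eq, hg])
      (by rw [← map_inv, ← map_mul, ← map_mul, ha])
    exact ⟨i, e.injective (by simpa using hi)⟩

lemma IsCyclic.subgroup_eq_of_card_eq {C : Type*} [Group C] [Finite C] [IsCyclic C]
    {H K : Subgroup C} (h : Nat.card H = Nat.card K) : H = K := by
  classical
  have := Fintype.ofFinite C
  set S : Finset C := {a | a ^ Nat.card H = 1} with hS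
  have hle : S.card ≤ Nat.card H := IsCyclic.card_pow_eq_one_le Nat.card_pos
  have key : ∀ L : Subgroup C, Nat.card L = Nat.card H → (L : Set C) = S := by
    intro L hL
    have hsub : (L : Set C).toFinset ⊆ S := by
      intro x hx
      have hx' : x ∈ L := by simpa using hx
      have := pow_card_eq_one' (x := (⟨x, hx'⟩ : L))
      rw [hL] at this
      simpa [hS, Subtype.ext_iff] using this
    have hc : (L : Set C).toFinset.card = Nat.card H := by
      rw [← hL, Set.toFinset_card, Nat.card_eq_fintype_card]; rfl
    rw [← Finset.eq_of_subset_of_card_le hsub (by omega)]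
    simp
  exact SetLike.coe_injective ((key H rfl).trans (key K h.symm).symm)

variable {p : ℕ} {G : Type*} [Group G]

lemma SquareNormalizing.normalizerMonoidHom_ker (hG : SquareNormalizing p G) (hp : p.Prime)
    {N : Subgroup G} (hN : Nat.card N = p) :
    N.normalizerMonoidHom.ker = N.subgroupOf (Subgroup.normalizer (N : Set G)) := by
  have : Fact p.Prime := ⟨hp⟩
  have hc : IsCyclic N := isCyclic_of_prime_card hN
  have hcomm : ∀ a b : N, a * b = b * a := fun a b => (IsCyclic.commGroup (α := N)).mul_comm a b
  rw [Subgroup.normalizerMonoidHom_ker]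
  ext ⟨x, hx⟩
  rw [Subgroup.mem_subgroupOf, Subgroup.mem_subgroupOf, Subgroup.mem_centralizer_iff]
  constructor
  · intro h
    obtain ⟨g, hg⟩ := hc.exists_generator
    have hgo : orderOf (g : G) = p := by
      rw [Subgroup.orderOf_coe, orderOf_eq_card_of_forall_mem_zpowers hg, hN]
    have := hG.mem_zpowers g x hgo (by rw [← h g g.2]; group)
    exact (Subgroup.zpowers_le.mpr g.2) this
  · intro h y hy
    exact congrArg Subtype.val (hcomm ⟨y, hy⟩ ⟨x, h⟩)

lemma Subgroup.card_map_eq_of_card_eq_mul {A B : Type*} [Group A] [Group B] (f : A →* B)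
    {H : Subgroup A} [Finite H] (hker : f.ker ≤ H) {n m : ℕ} (hn : Nat.card f.ker = n) (hn0 : 0 < n)
    (hH : Nat.card H = n * m) : Nat.card (H.map f) = m := by
  have h1 := (f.domRestrict H).ker.card_mul_index
  rw [Subgroup.index_ker, MonoidHom.domRestrict_range, MonoidHom.ker_domRestrict, hH] at h1
  have h2 : Nat.card (f.ker.subgroupOf H) = n := by
    rw [Nat.card_congr (Subgroup.subgroupOfEquivOfLe hker).toEquiv, hn]
  rw [h2] at h1
  exact Nat.eq_of_mul_eq_mul_left hn0 h1

/-- A subgroup of order `p * m` with a normal subgroup of order `p` has image of order `m`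
in the automorphism group of that normal subgroup. -/
lemma SquareNormalizing.card_map_normalizerMonoidHom [Finite G] (hG : SquareNormalizing p G)
    (hp : p.Prime) {N H : Subgroup G} (hN : Nat.card N = p) (hNH : N ≤ H)
    (hH : H ≤ Subgroup.normalizer (N : Set G)) {m : ℕ} (hm : Nat.card H = p * m) :
    Nat.card ((H.subgroupOf (Subgroup.normalizer (N : Set G))).map N.normalizerMonoidHom) = m := by
  refine Subgroup.card_map_eq_of_card_eq_mul _ ?_ (n := p) ?_ hp.pos ?_
  · rw [hG.normalizerMonoidHom_ker hp hN]
    exact Subgroup.comap_mono hNH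
  · rw [hG.normalizerMonoidHom_ker hp hN,
      Nat.card_congr (Subgroup.subgroupOfEquivOfLe (hNH.trans hH)).toEquiv, hN]
  · rw [Nat.card_congr (Subgroup.subgroupOfEquivOfLe hH).toEquiv, hm]

lemma Subgroup.isCyclic_mulAut_of_card_prime (hp : p.Prime) {N : Subgroup G}
    (hN : Nat.card N = p) : IsCyclic (MulAut N) := by
  have : Fact p.Prime := ⟨hp⟩
  have hc : IsCyclic N := isCyclic_of_prime_card hN
  have e := IsCyclic.mulAutMulEquiv N
  rw [hN] at e
  exact isCyclic_of_injective e.toMonoidHom e.injective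

lemma SquareNormalizing.eq_of_card_eq [Finite G] (hG : SquareNormalizing p G)
    (hp : p.Prime) {N H₁ H₂ : Subgroup G} (hN : Nat.card N = p) (hN₁ : N ≤ H₁) (hN₂ : N ≤ H₂)
    (h₁ : H₁ ≤ Subgroup.normalizer (N : Set G)) (h₂ : H₂ ≤ Subgroup.normalizer (N : Set G))
    {m : ℕ} (hm₁ : Nat.card H₁ = p * m) (hm₂ : Nat.card H₂ = p * m) : H₁ = H₂ := by
  have := Subgroup.isCyclic_mulAut_of_card_prime hp hN
  have : Finite (MulAut N) := Finite.of_injective (fun f : MulAut N => (f : N → N))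
    DFunLike.coe_injective
  have hmap := IsCyclic.subgroup_eq_of_card_eq
    ((hG.card_map_normalizerMonoidHom hp hN hN₁ h₁ hm₁).trans
      (hG.card_map_normalizerMonoidHom hp hN hN₂ h₂ hm₂).symm)
  have hk := hG.normalizerMonoidHom_ker hp hN
  have := congrArg (Subgroup.comap N.normalizerMonoidHom) hmap
  rw [Subgroup.comap_map_eq_self (by rw [hk]; exact Subgroup.comap_mono hN₁),
    Subgroup.comap_map_eq_self (by rw [hk]; exact Subgroup.comap_mono hN₂),
    Subgroup.subgroupOf_inj, inf_eq_left.mpr h₁, inf_eq_left.mpr h₂] at this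
  exact this

lemma Subgroup.exists_conj_eq_of_card [Finite G] (hp : p.Prime)
    (h2 : ¬ p ^ 2 ∣ Nat.card G) {N₁ N₂ : Subgroup G} (hN₁ : Nat.card N₁ = p)
    (hN₂ : Nat.card N₂ = p) :
    ∃ g : G, N₁.map (MulAut.conj g).toMonoidHom = N₂ := by
  have : Fact p.Prime := ⟨hp⟩
  have hf : (Nat.card G).factorization p = 1 := by
    have h1 : p ∣ Nat.card G := hN₁ ▸ Subgroup.card_subgroup_dvd_card N₁
    have := (hp.dvd_iff_one_le_factorization Nat.card_pos.ne').mp h1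
    rw [hp.pow_dvd_iff_le_factorization Nat.card_pos.ne'] at h2
    omega
  obtain ⟨g, hg⟩ := MulAction.exists_smul_eq G (Sylow.ofCard N₁ (by rw [hN₁, hf, pow_one]))
    (Sylow.ofCard N₂ (by rw [hN₂, hf, pow_one]))
  refine ⟨g, ?_⟩
  have := congrArg (fun P : Sylow p G => (P : Subgroup G)) hg
  exact this

/-- Subgroups of the same order `p * m` having a normal subgroup of order `p` are conjugate. -/
theorem SquareNormalizing.exists_conj_eq [Finite G] (hG : SquareNormalizing p G)
    (hp : p.Prime) {N₁ N₂ H₁ H₂ : Subgroup G} (hN₁ : Nat.card N₁ = p) (hN₂ : Nat.card N₂ = p)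
    (hNH₁ : N₁ ≤ H₁) (hNH₂ : N₂ ≤ H₂)
    (h₁ : H₁ ≤ Subgroup.normalizer (N₁ : Set G)) (h₂ : H₂ ≤ Subgroup.normalizer (N₂ : Set G))
    {m : ℕ} (hm₁ : Nat.card H₁ = p * m) (hm₂ : Nat.card H₂ = p * m) :
    ∃ g : G, H₁.map (MulAut.conj g).toMonoidHom = H₂ := by
  obtain ⟨g, hg⟩ := Subgroup.exists_conj_eq_of_card hp hG.not_sq_dvd hN₁ hN₂
  refine ⟨g, hG.eq_of_card_eq hp hN₂ ?_ hNH₂ ?_ h₂ ?_ hm₂⟩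
  · rw [← hg]; exact Subgroup.map_mono hNH₁
  · rw [← hg]
    have := Subgroup.map_mono (f := (MulAut.conj g).toMonoidHom) h₁
    exact this.trans (Subgroup.le_normalizer_map _)
  · rw [Subgroup.card_map_of_injective (MulAut.conj g).injective, hm₁]

/-- The prime-to-`p` part of the order of a subgroup with a normal subgroup of order `p`
divides `(p - 1) / 2`. -/
theorem SquareNormalizing.dvd_half [Finite G] (hG : SquareNormalizing p G)
    (hp : p.Prime) {N H : Subgroup G} (hN : Nat.card N = p) (hNH : N ≤ H)
    (hH : H ≤ Subgroup.normalizer (N : Set G)) {m : ℕ} (hm : Nat.card H = p * m) :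
    m ∣ (p - 1) / 2 := by
  have : Fact p.Prime := ⟨hp⟩
  have := Subgroup.isCyclic_mulAut_of_card_prime hp hN
  have : IsCyclic N := isCyclic_of_prime_card hN
  obtain ⟨g, hg⟩ := IsCyclic.exists_generator (α := N)
  have hgo : orderOf g = p := by rw [orderOf_eq_card_of_forall_mem_zpowers hg, hN]
  rw [← hG.card_map_normalizerMonoidHom hp hN hNH hH hm]
  set M := (H.subgroupOf (Subgroup.normalizer (N : Set G))).map N.normalizerMonoidHom
  have : Finite (MulAut N) := Finite.of_injective (fun f : MulAut N => (f : N → N))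
    DFunLike.coe_injective
  rw [← IsCyclic.exponent_eq_card, Monoid.exponent_dvd]
  rintro ⟨_, h, -, rfl⟩
  rw [orderOf_dvd_iff_pow_eq_one, Subtype.ext_iff]
  obtain ⟨a, ha⟩ : ∃ a : ℕ, g ^ a = N.normalizerMonoidHom h g := by
    obtain ⟨a, ha⟩ := Submonoid.mem_powers_iff _ _ |>.mp
      (mem_powers_iff_mem_zpowers.mpr (hg (N.normalizerMonoidHom h g)))
    exact ⟨a, ha⟩
  have hit : ∀ n : ℕ, ((N.normalizerMonoidHom h) ^ n) g = g ^ (a ^ n) := by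
    intro n
    induction n with
    | zero => simp
    | succ n ih => rw [pow_succ, MulAut.mul_apply, ← ha, map_pow, ih, ← pow_mul, pow_succ]
  have hmod := hG.pow_modEq_one g h (by rw [Subgroup.orderOf_coe, hgo]) a (by
    have := congrArg Subtype.val ha
    rw [Subgroup.coe_pow] at this
    rw [this]; rfl)
  ext x
  obtain ⟨i, rfl⟩ := Subgroup.mem_zpowers_iff.mp (hg x)
  simp only [SubgroupClass.coe_pow, OneMemClass.coe_one, MulAut.one_apply]
  rw [map_zpow, hit]
  congr 2
  conv_rhs => rw [← pow_one g]
  rw [pow_eq_pow_iff_modEq, hgo]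
  exact hmod

end SylowOfPrimeOrder

section Alternating

open Equiv

/-- Multiplication by a unit with even permutation sign is a square. -/
lemma ZMod.pow_half_eq_one_of_sign_mulLeft {p : ℕ} [Fact p.Prime] (hp2 : p ≠ 2) (a : (ZMod p)ˣ)
    (ha : Perm.sign (a.mulLeft : Perm (ZMod p)) = 1) : a ^ ((p - 1) / 2) = 1 := by
  have hp : p.Prime := Fact.out
  have hodd : Odd p := hp.odd_of_ne_two hp2
  obtain ⟨g, hg⟩ := IsCyclic.exists_generator (α := (ZMod p)ˣ)
  have hcard : Fintype.card (ZMod p)ˣ = p - 1 := ZMod.card_units p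
  have hgsign : Perm.sign (g.mulLeft : Perm (ZMod p)) = -1 := by
    have hpow : ∀ (i : ℕ) x, ((g.mulLeft : Perm (ZMod p)) ^ i) x = (g : ZMod p) ^ i * x := by
      intro i x
      induction i with
      | zero => simp
      | succ i ih => rw [pow_succ', Perm.mul_apply, ih, pow_succ']; simp [mul_assoc]
    have hg1 : (g : ZMod p) ≠ 1 := by
      intro h
      have hg1 : g = 1 := Units.ext h
      have : ∀ x : (ZMod p)ˣ, x = 1 := fun x => by
        obtain ⟨i, rfl⟩ := Subgroup.mem_zpowers_iff.mp (hg x); simp [hg1]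
      have hs : Subsingleton (ZMod p)ˣ := ⟨fun a b => (this a).trans (this b).symm⟩
      have := Fintype.card_le_one_iff_subsingleton.mpr hs
      have := hp.two_le
      omega
    have hsupp : ∀ x : ZMod p, x ∈ (g.mulLeft : Perm (ZMod p)).support ↔ x ≠ 0 := by
      intro x
      rw [Perm.mem_support, Units.mulLeft_apply, not_iff_not]
      constructor
      · intro h
        by_contra hx
        exact hg1 (mul_right_cancel₀ hx (by simpa using h))
      · rintro rfl; simp
    have hcyc : (g.mulLeft : Perm (ZMod p)).IsCycle := by
      refine ⟨1, by simpa using hg1, fun y hy => ?_⟩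
      have hy0 : y ≠ 0 := (hsupp y).mp (Perm.mem_support.mpr hy)
      obtain ⟨i, hi⟩ := Submonoid.mem_powers_iff _ _ |>.mp
        (mem_powers_iff_mem_zpowers.mpr (hg (Units.mk0 y hy0)))
      refine ⟨i, ?_⟩
      rw [zpow_natCast, hpow, mul_one, ← Units.val_pow_eq_pow_val, hi]
      rfl
    rw [hcyc.sign]
    have : (g.mulLeft : Perm (ZMod p)).support = Finset.univ.erase 0 := by
      ext x; simp [hsupp]
    rw [this, Finset.card_erase_of_mem (Finset.mem_univ _), Finset.card_univ, ZMod.card,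
      (Nat.Odd.sub_odd hodd odd_one).neg_one_pow]
  obtain ⟨i, rfl⟩ := Submonoid.mem_powers_iff _ _ |>.mp (mem_powers_iff_mem_zpowers.mpr (hg a))
  have hmul : ∀ i : ℕ, ((g ^ i).mulLeft : Perm (ZMod p)) = g.mulLeft ^ i := by
    intro i
    induction i with
    | zero => ext; simp
    | succ i ih => ext x; rw [pow_succ', pow_succ', Perm.mul_apply, ← ih]; simp [mul_assoc]
  rw [hmul, map_pow, hgsign] at ha
  have hi : Even i := by
    by_contra h
    rw [(Nat.not_even_iff_odd.mp h).neg_one_pow] at ha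
    exact absurd ha (by decide)
  obtain ⟨j, rfl⟩ := hi
  rw [← two_mul, ← pow_mul]
  have : 2 * j * ((p - 1) / 2) = (p - 1) * j := by
    have := Nat.mul_div_cancel' (Nat.Odd.sub_odd hodd odd_one).two_dvd
    rw [mul_right_comm, this]
  rw [this, pow_mul, ← hcard, pow_card_eq_one, one_pow]

/-- A permutation of prime order `p` of a set with `p` elements identifies it with `ZMod p`. -/
lemma Equiv.Perm.exists_zmodEquiv {p : ℕ} [Fact p.Prime] {α : Type*} [Fintype α] [DecidableEq α]
    (hα : Fintype.card α = p) {g : Perm α} (hg : orderOf g = p) (x : α) :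
    ∃ e : ZMod p ≃ α, ∀ i : ℕ, e i = (g ^ i) x := by
  have hp : p.Prime := Fact.out
  have hcyc : g.IsCycle := Perm.isCycle_of_prime_order' (by rwa [hg]) (by
    rw [hg, hα]; have := hp.pos; omega)
  have hsupp : g.support = Finset.univ := by
    apply Finset.eq_univ_of_card
    rw [← hcyc.orderOf, hg, hα]
  have hmod : ∀ i : ℕ, (g ^ (i % p)) x = (g ^ i) x := fun i => by
    rw [← hg, pow_mod_orderOf]
  let f : ZMod p → α := fun i => (g ^ i.val) x
  have hf : ∀ i : ℕ, f i = (g ^ i) x := fun i => by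
    simp only [f, ZMod.val_natCast, hmod]
  have hsurj : Function.Surjective f := by
    intro y
    obtain ⟨i, hi⟩ := hcyc.exists_pow_eq (x := x) (y := y)
      (Perm.mem_support.mp (by simp [hsupp])) (Perm.mem_support.mp (by simp [hsupp]))
    exact ⟨i, by rw [hf, hi]⟩
  have hbij : Function.Bijective f :=
    (Fintype.bijective_iff_surjective_and_card f).mpr ⟨hsurj, by rw [ZMod.card, hα]⟩
  exact ⟨Equiv.ofBijective f hbij, hf⟩

lemma squareNormalizing_alternatingGroup {p : ℕ} (hp : p.Prime) (hp2 : p ≠ 2) :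
    SquareNormalizing p (alternatingGroup (Fin p)) := by
  have : Fact p.Prime := ⟨hp⟩
  have hodd : Odd p := hp.odd_of_ne_two hp2
  have hα : Fintype.card (Fin p) = p := Fintype.card_fin p
  have : NeZero p := ⟨hp.ne_zero⟩
  have act : ∀ (g h : Perm (Fin p)) (a : ℕ), h * g * h⁻¹ = g ^ a → ∀ (i : ℕ) (x : Fin p),
      h ((g ^ i) x) = (g ^ (a * i)) (h x) := by
    intro g h a ha i x
    have h1 : h * g ^ i = g ^ (a * i) * h := by
      rw [pow_mul, ← ha, conj_pow]; group
    exact congrArg (fun f : Perm (Fin p) => f x) h1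
  refine ⟨?_, ?_, ?_⟩
  · intro h
    have h2 : p ^ 2 ∣ p.factorial := by
      refine h.trans ?_
      have := Subgroup.card_subgroup_dvd_card (alternatingGroup (Fin p))
      rwa [Nat.card_perm, Nat.card_fin] at this
    rw [← Nat.mul_factorial_pred hp.ne_zero, pow_two] at h2
    have := Nat.dvd_of_mul_dvd_mul_left hp.pos h2
    rw [hp.dvd_factorial] at this
    have := hp.pos
    omega
  · rintro ⟨g, hgA⟩ ⟨h, hhA⟩ hg a ha
    have hg' : orderOf g = p := (Subgroup.orderOf_mk g hgA).symm.trans hg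
    have ha' : h * g * h⁻¹ = g ^ a := congrArg Subtype.val ha
    obtain ⟨e, he⟩ := Perm.exists_zmodEquiv hα hg' 0
    obtain ⟨i, hi⟩ := e.surjective (h 0)
    have hi' : (g ^ i.val) 0 = h 0 := by rw [← he, ← hi, ZMod.natCast_zmod_val]
    have hcop : IsUnit (a : ZMod p) := by
      rw [isUnit_iff_ne_zero]
      intro h0
      have hpa : p ∣ a := (ZMod.natCast_eq_zero_iff a p).mp h0
      have : g ^ a = 1 := orderOf_dvd_iff_pow_eq_one.mp (hg'.dvd.trans hpa)
      rw [this] at ha'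
      have hg1 : g = 1 := by
        have := congrArg (fun x => h⁻¹ * x * h) ha'
        simpa [mul_assoc] using this
      rw [hg1, orderOf_one] at hg'
      exact hp.one_lt.ne hg'
    obtain ⟨u, hu⟩ := hcop
    have hconj : (e.permCongr u.mulLeft : Perm (Fin p)) = (g ^ i.val)⁻¹ * h := by
      ext x
      obtain ⟨j, rfl⟩ := e.surjective x
      congr 1
      have h1 : e j = (g ^ j.val) 0 := by rw [← he, ZMod.natCast_zmod_val]
      have h2 : (u : ZMod p) * j = ((a * j.val : ℕ) : ZMod p) := by
        rw [hu]; push_cast; rw [ZMod.natCast_zmod_val]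
      rw [Equiv.permCongr_apply, Equiv.symm_apply_apply]
      change e (u * j) = _
      rw [h2, he, Perm.mul_apply,
        h1, act g h a ha', ← hi', ← Perm.mul_apply, ← Perm.mul_apply, mul_assoc, ← pow_add, add_comm, pow_add]
      simp
    have hs : Perm.sign (u.mulLeft : Perm (ZMod p)) = 1 := by
      rw [← Perm.sign_permCongr e, hconj, map_mul, map_inv, map_pow,
        Perm.mem_alternatingGroup.mp hgA, Perm.mem_alternatingGroup.mp hhA]
      simp
    have := ZMod.pow_half_eq_one_of_sign_mulLeft hp2 u hs
    rw [← ZMod.natCast_eq_natCast_iff]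
    push_cast
    rw [← hu, ← Units.val_pow_eq_pow_val, this]
    simp
  · rintro ⟨g, hgA⟩ ⟨h, hhA⟩ hg ha
    have hg' : orderOf g = p := (Subgroup.orderOf_mk g hgA).symm.trans hg
    have ha' : h * g * h⁻¹ = g ^ 1 := by rw [pow_one]; exact congrArg Subtype.val ha
    obtain ⟨e, he⟩ := Perm.exists_zmodEquiv hα hg' 0
    obtain ⟨i, hi⟩ := e.surjective (h 0)
    have hi' : (g ^ i.val) 0 = h 0 := by rw [← he, ← hi, ZMod.natCast_zmod_val]
    refine ⟨i.val, Subtype.ext ?_⟩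
    simp only [zpow_natCast, SubmonoidClass.mk_pow]
    refine Equiv.ext fun x => ?_
    obtain ⟨j, rfl⟩ := e.surjective x
    have h1 : e j = (g ^ j.val) 0 := by rw [← he, ZMod.natCast_zmod_val]
    rw [h1, act g h 1 ha', ← hi', one_mul, ← Perm.mul_apply, ← Perm.mul_apply, ← pow_add,
      ← pow_add, add_comm]

end Alternating

section ProjectiveSpecialLinear

open Matrix

/-- The upper unipotent matrix. -/
def SL2.upper {R : Type*} [CommRing R] (b : R) : SpecialLinearGroup (Fin 2) R :=
  ⟨!![1, b; 0, 1], by simp [det_fin_two]⟩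

/-- The lower unipotent matrix. -/
def SL2.lower {R : Type*} [CommRing R] (c : R) : SpecialLinearGroup (Fin 2) R :=
  ⟨!![1, 0; c, 1], by simp [det_fin_two]⟩

@[simp]
lemma SL2.coe_upper {R : Type*} [CommRing R] (b : R) :
    (SL2.upper b : Matrix (Fin 2) (Fin 2) R) = !![1, b; 0, 1] := rfl

@[simp]
lemma SL2.coe_lower {R : Type*} [CommRing R] (c : R) :
    (SL2.lower c : Matrix (Fin 2) (Fin 2) R) = !![1, 0; c, 1] := rfl

lemma SL2.upper_add {R : Type*} [CommRing R] (b c : R) :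
    SL2.upper (b + c) = SL2.upper b * SL2.upper c := by
  refine Subtype.ext ?_
  change !![_, _; _, _] = (!![_, _; _, _] * !![_, _; _, _] : Matrix (Fin 2) (Fin 2) R)
  ext i j
  fin_cases i <;> fin_cases j <;> simp [add_comm]

lemma SL2.lower_add {R : Type*} [CommRing R] (b c : R) :
    SL2.lower (b + c) = SL2.lower b * SL2.lower c := by
  refine Subtype.ext ?_
  change !![_, _; _, _] = (!![_, _; _, _] * !![_, _; _, _] : Matrix (Fin 2) (Fin 2) R)
  ext i j
  fin_cases i <;> fin_cases j <;> simp

lemma SL2.upper_zero {R : Type*} [CommRing R] : SL2.upper (0 : R) = 1 := by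
  refine Subtype.ext ?_
  change !![_, _; _, _] = (1 : Matrix (Fin 2) (Fin 2) R)
  ext i j
  fin_cases i <;> fin_cases j <;> simp

lemma SL2.lower_zero {R : Type*} [CommRing R] : SL2.lower (0 : R) = 1 := by
  refine Subtype.ext ?_
  change !![_, _; _, _] = (1 : Matrix (Fin 2) (Fin 2) R)
  ext i j
  fin_cases i <;> fin_cases j <;> simp

lemma SL2.upper_pow {R : Type*} [CommRing R] (b : R) (n : ℕ) :
    SL2.upper b ^ n = SL2.upper (n * b) := by
  induction n with
  | zero => rw [pow_zero, Nat.cast_zero, zero_mul, upper_zero]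
  | succ n ih => rw [pow_succ, ih, Nat.cast_succ, add_mul, one_mul, upper_add]

lemma SL2.lower_pow {R : Type*} [CommRing R] (b : R) (n : ℕ) :
    SL2.lower b ^ n = SL2.lower (n * b) := by
  induction n with
  | zero => rw [pow_zero, Nat.cast_zero, zero_mul, lower_zero]
  | succ n ih => rw [pow_succ, ih, Nat.cast_succ, add_mul, one_mul, lower_add]

lemma SL2.mem_center_iff_eq {F : Type*} [Field F] {A : SpecialLinearGroup (Fin 2) F} :
    A ∈ Subgroup.center (SpecialLinearGroup (Fin 2) F) ↔ A = 1 ∨ A = -1 := by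
  rw [Matrix.SpecialLinearGroup.mem_center_iff]
  constructor
  · rintro ⟨r, hr, hA⟩
    rw [Fintype.card_fin, sq_eq_one_iff] at hr
    rcases hr with rfl | rfl
    · left; ext i j; rw [← hA]; simp
    · right; ext i j; rw [← hA]; fin_cases i <;> fin_cases j <;> simp
  · rintro (rfl | rfl)
    · exact ⟨1, by simp⟩
    · exact ⟨-1, by simp, by ext i j; fin_cases i <;> fin_cases j <;> simp⟩

lemma SL2.conj_upper {F : Type*} [Field F] (h2 : (2 : F) ≠ 0) {A : SpecialLinearGroup (Fin 2) F}
    {b c : F} (hb : b ≠ 0)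
    (h : (A * upper b * A⁻¹)⁻¹ * upper c ∈ Subgroup.center (SpecialLinearGroup (Fin 2) F)) :
    A 1 0 = 0 ∧ A 0 0 * A 1 1 = 1 ∧ A 0 0 * b = c * A 1 1 := by
  have hdet := A.det_coe
  rw [det_fin_two] at hdet
  have key : upper c * A = A * upper b ∨ upper c * A = -(A * upper b) := by
    rcases mem_center_iff_eq.mp h with h | h
    · left
      rw [inv_mul_eq_one] at h
      rw [← h]; group
    · right
      rw [inv_mul_eq_iff_eq_mul] at h
      rw [h]
      simp [mul_assoc]
  have e (M N : SpecialLinearGroup (Fin 2) F) (hMN : M = N) (i j) : M i j = N i j := by rw [hMN]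
  rcases key with h | h
  · have h00 := e _ _ h 0 0
    have h01 := e _ _ h 0 1
    have h11 := e _ _ h 1 1
    simp [Matrix.mul_apply, Fin.sum_univ_two] at h00 h01 h11
    rcases h11 with h11 | h11
    · refine ⟨h11, by simpa [h11] using hdet, by linear_combination -h01⟩
    · exact absurd h11 hb
  · have h00 := e _ _ h 0 0
    have h10 := e _ _ h 1 0
    have h11 := e _ _ h 1 1
    simp [Matrix.mul_apply, Fin.sum_univ_two] at h00 h10 h11
    have h1 : A 1 0 = 0 := by
      have : 2 * A 1 0 = 0 := by linear_combination h10
      exact (mul_eq_zero.mp this).resolve_left h2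
    have h2 : A 1 1 = 0 := by
      rw [h1] at h11
      have : 2 * A 1 1 = 0 := by linear_combination h11
      exact (mul_eq_zero.mp this).resolve_left h2
    rw [h1, h2] at hdet
    simp at hdet

lemma Matrix.SpecialLinearGroup.card_dvd_card_GL (n : ℕ) (F : Type*) [Field F] [Fintype F] :
    Nat.card (SpecialLinearGroup (Fin n) F) ∣ Nat.card (GL (Fin n) F) :=
  Subgroup.card_dvd_of_injective SpecialLinearGroup.toGL SpecialLinearGroup.toGL_injective

lemma not_sq_dvd_card_PSL₂ {p : ℕ} [Fact p.Prime] (hp2 : p ≠ 2) :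
    ¬ p ^ 2 ∣ Nat.card (PSL₂ (ZMod p)) := by
  have hp : p.Prime := Fact.out
  intro h
  have h1 := (h.trans (Subgroup.card_quotient_dvd_card _)).trans
    (SpecialLinearGroup.card_dvd_card_GL 2 (ZMod p))
  rw [card_GL_field, Fin.prod_univ_two, ZMod.card] at h1
  obtain ⟨q, rfl⟩ : ∃ q, p = q + 2 := ⟨p - 2, by have := hp.two_le; omega⟩
  have h2 : ((q + 2) ^ 2 - (q + 2) ^ (0 : Fin 2).val) * ((q + 2) ^ 2 - (q + 2) ^ (1 : Fin 2).val) =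
      (q + 2) * ((q + 1) * (q + 1) * (q + 3)) := by
    have e1 : (q + 2) ^ 2 - (q + 2) ^ (0 : Fin 2).val = (q + 1) * (q + 3) := by
      simp only [Fin.val_zero, pow_zero]
      rw [Nat.sub_eq_iff_eq_add (Nat.one_le_pow _ _ (by omega))]
      ring
    have e2 : (q + 2) ^ 2 - (q + 2) ^ (1 : Fin 2).val = (q + 2) * (q + 1) := by
      simp only [Fin.val_one, pow_one]
      rw [Nat.sub_eq_iff_eq_add (Nat.le_self_pow (by omega) _)]
      ring
    rw [e1, e2]; ring
  rw [h2, pow_two] at h1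
  have h3 := Nat.dvd_of_mul_dvd_mul_left hp.pos h1
  rw [hp.dvd_mul, hp.dvd_mul] at h3
  rcases h3 with (h3 | h3) | h3
  · have := Nat.le_of_dvd (by omega) h3; omega
  · have := Nat.le_of_dvd (by omega) h3; omega
  · have h4 := (Nat.dvd_sub h3 dvd_rfl)
    have : q + 3 - (q + 2) = 1 := by omega
    rw [this] at h4
    exact hp.one_lt.ne' (Nat.dvd_one.mp h4)

lemma SL2.upper_injective {R : Type*} [CommRing R] : Function.Injective (SL2.upper (R := R)) := by
  intro b c h
  have := congrArg (fun A : SpecialLinearGroup (Fin 2) R => A 0 1) h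
  simpa using this

lemma squareNormalizing_PSL₂ {p : ℕ} (hp : p.Prime) (hp2 : p ≠ 2) :
    SquareNormalizing p (PSL₂ (ZMod p)) := by
  have : Fact p.Prime := ⟨hp⟩
  have h20 : (2 : ZMod p) ≠ 0 := by
    intro h
    have : ((2 : ℕ) : ZMod p) = 0 := by exact_mod_cast h
    rw [ZMod.natCast_eq_zero_iff] at this
    exact hp2 ((Nat.prime_dvd_prime_iff_eq hp Nat.prime_two).mp this)
  let π := QuotientGroup.mk' (Subgroup.center (SpecialLinearGroup (Fin 2) (ZMod p)))
  have hπ : Function.Surjective π := QuotientGroup.mk'_surjective _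
  have hup : ∀ n : ℕ, SL2.upper (1 : ZMod p) ^ n = SL2.upper (n : ZMod p) := fun n => by
    rw [SL2.upper_pow, mul_one]
  have hu : orderOf (π (SL2.upper 1)) = p := by
    refine orderOf_eq_prime ?_ ?_
    · rw [← map_pow, hup, ZMod.natCast_self, SL2.upper_zero, map_one]
    · intro h
      have h := (QuotientGroup.eq_one_iff _).mp h
      rcases SL2.mem_center_iff_eq.mp h with h | h
      · rw [← SL2.upper_zero] at h
        exact one_ne_zero (SL2.upper_injective h)
      · have := congrArg (fun A : SpecialLinearGroup (Fin 2) (ZMod p) => A 0 1) h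
        simp at this
  have hconj : ∀ g : PSL₂ (ZMod p), orderOf g = p → ∃ (x : PSL₂ (ZMod p)) (i : ℕ),
      x * g * x⁻¹ = π (SL2.upper (i : ZMod p)) := by
    intro g hg
    obtain ⟨x, hx⟩ := Subgroup.exists_conj_eq_of_card hp (not_sq_dvd_card_PSL₂ hp2)
      ((Nat.card_zpowers g).trans hg) ((Nat.card_zpowers (π (SL2.upper 1))).trans hu)
    have : x * g * x⁻¹ ∈ Subgroup.zpowers (π (SL2.upper 1)) := by
      rw [← hx]; exact ⟨g, Subgroup.mem_zpowers g, rfl⟩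
    obtain ⟨i, hi⟩ := Submonoid.mem_powers_iff _ _ |>.mp (mem_powers_iff_mem_zpowers.mpr this)
    exact ⟨x, i, by rw [← hi, ← map_pow, hup]⟩
  have key : ∀ (i : ℕ), π (SL2.upper (i : ZMod p)) ≠ 1 → ∀ (A : SpecialLinearGroup (Fin 2) (ZMod p))
      (a : ℕ), π A * π (SL2.upper (i : ZMod p)) * (π A)⁻¹ = π (SL2.upper (i : ZMod p)) ^ a →
      A 1 0 = 0 ∧ A 0 0 * A 1 1 = 1 ∧ (a : ZMod p) = A 0 0 ^ 2 := by
    intro i hi A a h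
    have hi0 : (i : ZMod p) ≠ 0 := by
      intro h0
      rw [h0, SL2.upper_zero, map_one] at hi
      exact hi rfl
    rw [← map_inv, ← map_mul, ← map_mul, ← map_pow, SL2.upper_pow] at h
    obtain ⟨h1, h2, h3⟩ := SL2.conj_upper h20 hi0 (QuotientGroup.eq.mp h)
    refine ⟨h1, h2, ?_⟩
    have : (i : ZMod p) * (A 0 0 ^ 2 - a) = 0 := by
      linear_combination A 0 0 * h3 + (a : ZMod p) * i * h2
    rcases mul_eq_zero.mp this with h | h
    · exact absurd h hi0
    · exact (sub_eq_zero.mp h).symm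
  have htransfer : ∀ (g h x : PSL₂ (ZMod p)) (u : SpecialLinearGroup (Fin 2) (ZMod p)) (a : ℕ),
      x * g * x⁻¹ = π u → h * g * h⁻¹ = g ^ a →
      (x * h * x⁻¹) * π u * (x * h * x⁻¹)⁻¹ = π u ^ a := by
    intro g h x u a hx hg
    rw [← hx, conj_pow, ← hg]; group
  have hne : ∀ (g x : PSL₂ (ZMod p)) (u : SpecialLinearGroup (Fin 2) (ZMod p)),
      orderOf g = p → x * g * x⁻¹ = π u → π u ≠ 1 := by
    rintro g x u hg hx h
    rw [h, conj_eq_one_iff] at hx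
    rw [hx, orderOf_one] at hg
    exact hp.one_lt.ne hg
  refine ⟨not_sq_dvd_card_PSL₂ hp2, ?_, ?_⟩
  · intro g h hg a ha
    obtain ⟨x, i, hx⟩ := hconj g hg
    obtain ⟨A, hA⟩ := hπ (x * h * x⁻¹)
    obtain ⟨-, h2, h3⟩ := key i (hne g x _ hg hx) A a (by rw [hA]; exact htransfer g h x _ a hx ha)
    rw [← ZMod.natCast_eq_natCast_iff]
    push_cast
    rw [h3, ← pow_mul, Nat.mul_div_cancel' (Nat.Odd.sub_odd (hp.odd_of_ne_two hp2) odd_one).two_dvd,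
      ZMod.pow_card_sub_one_eq_one]
    exact left_ne_zero_of_mul_eq_one h2
  · intro g h hg ha
    obtain ⟨x, i, hx⟩ := hconj g hg
    obtain ⟨A, hA⟩ := hπ (x * h * x⁻¹)
    obtain ⟨h1, h2, h3⟩ := key i (hne g x _ hg hx) A 1
      (by rw [hA]; exact htransfer g h x _ 1 hx (by rw [pow_one, ha]))
    have hmem : ∀ b : ZMod p, π (SL2.upper b) ∈ Subgroup.zpowers (π (SL2.upper 1)) := by
      intro b
      refine ⟨b.val, ?_⟩
      simp only [zpow_natCast]
      rw [← map_pow, hup, ZMod.natCast_zmod_val]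
    have hA' : π A ∈ Subgroup.zpowers (π (SL2.upper 1)) := by
      rw [Nat.cast_one, eq_comm, sq_eq_one_iff] at h3
      rcases h3 with h3 | h3
      · rw [h3, one_mul] at h2
        convert hmem (A 0 1) using 2
        refine Matrix.SpecialLinearGroup.ext _ _ fun i j => ?_
        rw [SL2.coe_upper]
        fin_cases i <;> fin_cases j <;> simp [h1, h2, h3]
      · have h2' : A 1 1 = -1 := by rw [h3] at h2; linear_combination -h2
        have : π A = π (SL2.upper (-A 0 1)) := by
          refine QuotientGroup.eq.mpr ?_
          rw [SL2.mem_center_iff_eq, inv_mul_eq_iff_eq_mul, inv_mul_eq_iff_eq_mul]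
          right
          refine Matrix.SpecialLinearGroup.ext _ _ fun i j => ?_
          rw [SL2.coe_upper, mul_neg, mul_one, SpecialLinearGroup.coe_neg]
          fin_cases i <;> fin_cases j <;> simp [h1, h2', h3]
        rw [this]
        exact hmem _
    have hz : Subgroup.zpowers (π (SL2.upper (i : ZMod p))) = Subgroup.zpowers (π (SL2.upper 1)) := by
      refine Subgroup.eq_of_le_of_card_ge ?_ ?_
      · rw [Subgroup.zpowers_le]; exact hmem _
      · rw [Nat.card_zpowers, Nat.card_zpowers, hu, ← hx]
        exact hg.symm.le.trans (MulEquiv.orderOf_eq (MulAut.conj x) g).ge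
    rw [← hz, hA, ← hx] at hA'
    obtain ⟨n, hn⟩ := hA'
    refine ⟨n, ?_⟩
    simp only [conj_zpow] at hn
    exact mul_left_cancel (mul_right_cancel hn)

end ProjectiveSpecialLinear

section Centers

open scoped Pointwise

open IsDedekindDomain WithZero

lemma ValuationSubring.mem_of_isIntegral {R L : Type*} [CommRing R] [Field L] [Algebra R L]
    {O : ValuationSubring L} (hR : ∀ r : R, algebraMap R L r ∈ O) {x : L} (hx : IsIntegral R x) :
    x ∈ O := by
  let : Algebra R O := ((algebraMap R L).codRestrict O.toSubring hR).toAlgebra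
  have : IsScalarTower R O L := IsScalarTower.of_algebraMap_eq fun _ => rfl
  obtain ⟨y, rfl⟩ := IsIntegrallyClosed.isIntegral_iff.mp (hx.tower_top (A := O))
  exact y.2

lemma ValuationSubring.mul_mem_nonunits {L : Type*} [Field L] {O : ValuationSubring L} {x y : L}
    (hx : x ∈ O) (hy : y ∈ O.nonunits) : x * y ∈ O.nonunits := by
  rw [ValuationSubring.mem_nonunits_iff] at hy ⊢
  rw [map_mul]
  exact (mul_le_of_le_one_left' ((O.valuation_le_one_iff x).mpr hx)).trans_lt hy

lemma ValuationSubring.one_notMem_nonunits {L : Type*} [Field L] (O : ValuationSubring L) :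
    (1 : L) ∉ O.nonunits := by
  rw [ValuationSubring.mem_nonunits_iff, map_one]; exact lt_irrefl _

lemma ValuationSubring.inv_mem_of_notMem_nonunits {L : Type*} [Field L] {O : ValuationSubring L}
    {x : L} (hx : x ∉ O.nonunits) : x⁻¹ ∈ O := by
  rw [mem_nonunits_iff_or] at hx
  push Not at hx
  exact hx.2

/-- The elements of the integral closure of `R` in `L` which are not units at `O`. -/
def ValuationSubring.center {R L : Type*} [CommRing R] [Field L] [Algebra R L]
    (O : ValuationSubring L) (hR : ∀ r : R, algebraMap R L r ∈ O) :
    Ideal (integralClosure R L) where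
  carrier := {b | (b : L) ∈ O.nonunits}
  add_mem' ha hb := O.nonunits.add_mem ha hb
  zero_mem' := O.nonunits.zero_mem
  smul_mem' c _ hx := mul_mem_nonunits (mem_of_isIntegral hR c.2) hx

lemma ValuationSubring.mem_center {R L : Type*} [CommRing R] [Field L] [Algebra R L]
    {O : ValuationSubring L} {hR : ∀ r : R, algebraMap R L r ∈ O} {b : integralClosure R L} :
    b ∈ O.center hR ↔ (b : L) ∈ O.nonunits := Iff.rfl

lemma ValuationSubring.center_isPrime {R L : Type*} [CommRing R] [Field L] [Algebra R L]
    (O : ValuationSubring L) (hR : ∀ r : R, algebraMap R L r ∈ O) : (O.center hR).IsPrime := by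
  refine ⟨fun h => O.one_notMem_nonunits ((Ideal.eq_top_iff_one _).mp h), fun {x y} hxy => ?_⟩
  by_contra! h
  refine O.one_notMem_nonunits ?_
  have hx : (x : L) ≠ 0 := fun h0 => h.1 (by rw [mem_center, h0]; exact O.nonunits.zero_mem)
  have hy : (y : L) ≠ 0 := fun h0 => h.2 (by rw [mem_center, h0]; exact O.nonunits.zero_mem)
  have := mul_mem_nonunits (O.mul_mem _ _ (inv_mem_of_notMem_nonunits h.1)
    (inv_mem_of_notMem_nonunits h.2)) hxy
  convert this using 1
  push_cast
  field_simp

lemma ValuationSubring.eq_valuationSubring_of_center_eq {B L : Type*} [CommRing B]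
    [IsDedekindDomain B] [Field L] [Algebra B L] [IsFractionRing B L] {O : ValuationSubring L}
    (hB : ∀ b : B, algebraMap B L b ∈ O) (Q : HeightOneSpectrum B)
    (hQ : ∀ b : B, b ∈ Q.asIdeal ↔ algebraMap B L b ∈ O.nonunits) :
    (Q.valuation L).valuationSubring = O := by
  rw [← HeightOneSpectrum.valuationSubringAtPrime_eq_valuationSubring]
  refine ValuationSubring.eq_of_le_of_ne_top _ ?_ ?_
  · rintro _ ⟨a, s, hs, rfl⟩
    exact O.mul_mem _ _ (hB a) (inv_mem_of_notMem_nonunits fun h => hs ((hQ s).mpr h))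
  · rintro rfl
    apply Q.ne_bot
    rw [Submodule.eq_bot_iff]
    intro b hb
    have := (hQ b).mp hb
    rw [mem_nonunits_iff_or] at this
    rcases this with h | h
    · exact (map_eq_zero_iff _ (IsFractionRing.injective B L)).mp h
    · exact absurd (mem_top _) h

variable {R K L : Type*} [CommRing R] [Field K] [Algebra R K] [Field L] [Algebra K L]
  [Algebra R L] [IsScalarTower R K L]

lemma ValuationSubring.mem_smul_iff {O : ValuationSubring L} {σ : L ≃ₐ[K] L} {x : L} :
    x ∈ σ • O ↔ σ.symm x ∈ O := mem_pointwise_smul_iff_inv_smul_mem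

lemma ValuationSubring.mem_nonunits_smul_iff {O : ValuationSubring L} {σ : L ≃ₐ[K] L} {x : L} :
    x ∈ (σ • O).nonunits ↔ σ.symm x ∈ O.nonunits := by
  rw [mem_nonunits_iff_or, mem_nonunits_iff_or, mem_smul_iff, map_inv₀,
    map_eq_zero_iff _ σ.symm.injective]

lemma ValuationSubring.algebraMap_mem_smul {O : ValuationSubring L}
    (hR : ∀ r : R, algebraMap R L r ∈ O) (σ : L ≃ₐ[K] L) (r : R) : algebraMap R L r ∈ σ • O := by
  rw [mem_smul_iff, IsScalarTower.algebraMap_apply R K L, AlgEquiv.commutes,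
    ← IsScalarTower.algebraMap_apply R K L]
  exact hR r

lemma ValuationSubring.center_smul {O : ValuationSubring L}
    (hR : ∀ r : R, algebraMap R L r ∈ O) (σ : L ≃ₐ[K] L) :
    (σ • O).center (algebraMap_mem_smul hR σ) = σ • O.center hR := by
  ext b
  rw [mem_center, mem_nonunits_smul_iff, Ideal.mem_pointwise_smul_iff_inv_smul_mem, mem_center]
  rfl

variable [IsDedekindDomain R] [IsFractionRing R K]

instance isGaloisGroup_integralClosure [IsGalois K L] [FiniteDimensional K L] :
    IsGaloisGroup (L ≃ₐ[K] L) R (integralClosure R L) :=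
  have := IsIntegralClosure.isFractionRing_of_finite_extension R K L (integralClosure R L)
  IsGaloisGroup.of_isFractionRing _ R (integralClosure R L) K L

/-- A valuation subring of `L` whose trace on `R` is the prime `p` is the localization of the
integral closure of `R` at a prime over `p`. -/
lemma ValuationSubring.exists_heightOneSpectrum {R L : Type*} [CommRing R] [IsDedekindDomain R]
    [Field L] [Algebra R L] (K : Type*) [Field K] [Algebra R K]
    [IsFractionRing R K] [Algebra K L] [IsScalarTower R K L]
    [IsDedekindDomain (integralClosure R L)]
    [IsFractionRing (integralClosure R L) L] {O : ValuationSubring L}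
    (hR : ∀ r : R, algebraMap R L r ∈ O) {p : HeightOneSpectrum R}
    (hp : ∀ r : R, r ∈ p.asIdeal ↔ algebraMap R L r ∈ O.nonunits) :
    ∃ Q : HeightOneSpectrum (integralClosure R L), Q.asIdeal = O.center hR ∧
      Q.asIdeal.LiesOver p.asIdeal ∧ (Q.valuation L).valuationSubring = O := by
  have hlies : (O.center hR).LiesOver p.asIdeal := ⟨by ext r; exact hp r⟩
  have hinj : Function.Injective (algebraMap R L) := by
    rw [IsScalarTower.algebraMap_eq R K L]
    exact (algebraMap K L).injective.comp (IsFractionRing.injective R K)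
  refine ⟨⟨O.center hR, O.center_isPrime hR, fun h => p.ne_bot ?_⟩, rfl, hlies, ?_⟩
  · rw [Submodule.eq_bot_iff]
    intro r hr
    have : algebraMap R (integralClosure R L) r ∈ O.center hR := (hp r).mp hr
    rw [h, Ideal.mem_bot] at this
    exact hinj ((congrArg Subtype.val this).trans (map_zero (algebraMap R L)).symm)
  · exact ValuationSubring.eq_valuationSubring_of_center_eq
      (fun b => mem_of_isIntegral hR b.2) _ fun b => Iff.rfl

theorem ValuationSubring.exists_isIntegral_mul_eq {R L : Type*} [CommRing R] [IsDedekindDomain R]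
    [Field L] [Algebra R L] (K : Type*) [Field K] [Algebra R K]
    [IsFractionRing R K] [Algebra K L] [IsScalarTower R K L]
    [IsGalois K L] [FiniteDimensional K L] {O : ValuationSubring L}
    (hR : ∀ r : R, algebraMap R L r ∈ O)
    {p : HeightOneSpectrum R} (hp : ∀ r : R, r ∈ p.asIdeal ↔ algebraMap R L r ∈ O.nonunits)
    {f : L} (hf : f ∈ O) :
    ∃ b d : L, IsIntegral R b ∧ IsIntegral R d ∧ d ∉ O.nonunits ∧ f * d = b := by
  have := IsIntegralClosure.isDedekindDomain R K L (integralClosure R L)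
  have := IsIntegralClosure.isFractionRing_of_finite_extension R K L (integralClosure R L)
  obtain ⟨Q, hQ, hlies, hO⟩ := exists_heightOneSpectrum K hR hp
  rw [← hO] at hf
  obtain ⟨b, ⟨d, hd⟩, h⟩ := Q.exists_primeCompl_mul_eq_of_integer f hf
  refine ⟨b, d, b.2, d.2, fun h => hd ?_, h⟩
  rw [hQ]; exact h

variable [IsGalois K L] [FiniteDimensional K L] {O : ValuationSubring L}

theorem ValuationSubring.exists_smul_eq {O' : ValuationSubring L}
    (hR : ∀ r : R, algebraMap R L r ∈ O) (hR' : ∀ r : R, algebraMap R L r ∈ O')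
    {p : HeightOneSpectrum R} (hp : ∀ r : R, r ∈ p.asIdeal ↔ algebraMap R L r ∈ O.nonunits)
    (hp' : ∀ r : R, r ∈ p.asIdeal ↔ algebraMap R L r ∈ O'.nonunits) :
    ∃ σ : L ≃ₐ[K] L, σ • O = O' := by
  have := IsIntegralClosure.isDedekindDomain R K L (integralClosure R L)
  have := IsIntegralClosure.isFractionRing_of_finite_extension R K L (integralClosure R L)
  obtain ⟨Q, hQ, hlies, hO⟩ := exists_heightOneSpectrum K hR hp
  obtain ⟨Q', hQ', hlies', hO'⟩ := exists_heightOneSpectrum K hR' hp'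
  obtain ⟨σ, hσ⟩ := Algebra.IsInvariant.exists_smul_of_under_eq R (integralClosure R L)
    (L ≃ₐ[K] L) Q.asIdeal Q'.asIdeal (hlies.over.symm.trans hlies'.over)
  refine ⟨σ, ?_⟩
  rw [← hO']
  refine (eq_valuationSubring_of_center_eq
    (fun b => mem_of_isIntegral (algebraMap_mem_smul hR σ) b.2) _ fun b => ?_).symm
  rw [hσ, hQ, ← center_smul]
  rfl

lemma ValuationSubring.mem_stabilizer_iff (hR : ∀ r : R, algebraMap R L r ∈ O)
    {p : HeightOneSpectrum R} (hp : ∀ r : R, r ∈ p.asIdeal ↔ algebraMap R L r ∈ O.nonunits)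
    (σ : L ≃ₐ[K] L) : σ • O.center hR = O.center hR ↔ σ • O = O := by
  have := IsIntegralClosure.isDedekindDomain R K L (integralClosure R L)
  have := IsIntegralClosure.isFractionRing_of_finite_extension R K L (integralClosure R L)
  rw [← center_smul]
  constructor
  · intro h
    obtain ⟨Q, hQ, hlies, hO⟩ := exists_heightOneSpectrum K hR hp
    refine Eq.trans (eq_valuationSubring_of_center_eq (B := integralClosure R L)
      (fun b => mem_of_isIntegral (algebraMap_mem_smul hR σ) b.2) Q fun b => ?_).symm hO
    rw [hQ, ← h]
    rfl
  · intro h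
    congr 1

end Centers

section RationalPlace

open scoped Pointwise Polynomial

open IsDedekindDomain WithZero

/-- The valuation subring `w` of `K` is discrete, with uniformizer `t` and residue field `k`. -/
structure IsRationalPlace (k : Type) [Field k] {K : Type} [Field K] [Algebra k K]
    (w : ValuationSubring K) (t : K) : Prop where
  isDiscreteValuationRing : IsDiscreteValuationRing w
  algebraMap_mem : ∀ a : k, algebraMap k K a ∈ w
  exists_sub_mem : ∀ x ∈ w, ∃ a : k, x - algebraMap k K a ∈ w.nonunits
  ne_zero : t ≠ 0
  uniformizer_mem : t ∈ w.nonunits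
  div_mem : ∀ x ∈ w.nonunits, x / t ∈ w

variable {k K L : Type} [Field k] [Field K] [Algebra k K] [Field L] [Algebra K L]
  {w : ValuationSubring K} {t : K} {O : ValuationSubring L}

lemma ValuationSubring.algebraMap_mem_iff (hO : O.comap (algebraMap K L) = w) (x : K) :
    algebraMap K L x ∈ O ↔ x ∈ w := by rw [← hO, mem_comap]

lemma ValuationSubring.algebraMap_mem_nonunits_iff (hO : O.comap (algebraMap K L) = w) (x : K) :
    algebraMap K L x ∈ O.nonunits ↔ x ∈ w.nonunits := by
  rw [mem_nonunits_iff_or, mem_nonunits_iff_or, ← map_inv₀, algebraMap_mem_iff hO, map_eq_zero]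

lemma ValuationSubring.nonunits_mem {x : L} (hx : x ∈ O.nonunits) : x ∈ O :=
  O.nonunits_le hx

lemma ValuationSubring.mem_or_mem_of_mul_mem_nonunits {x y : L} (hxy : x * y ∈ O.nonunits) : x ∈ O.nonunits ∨ y ∈ O.nonunits := by
  by_contra! h
  refine O.one_notMem_nonunits ?_
  have hx0 : x ≠ 0 := fun h0 => h.1 (by rw [h0]; exact O.nonunits.zero_mem)
  have hy0 : y ≠ 0 := fun h0 => h.2 (by rw [h0]; exact O.nonunits.zero_mem)
  have := mul_mem_nonunits (O.mul_mem _ _ (inv_mem_of_notMem_nonunits h.1)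
    (inv_mem_of_notMem_nonunits h.2)) hxy
  convert this using 1
  field_simp

lemma ValuationSubring.residue_eq_zero_iff (x : O) :
    IsLocalRing.residue O x = 0 ↔ (x : L) ∈ O.nonunits := by
  rw [IsLocalRing.residue_eq_zero_iff, mem_nonunits_iff_exists_mem_maximalIdeal]
  simp

namespace IsRationalPlace

lemma mem_maximalIdeal_iff [IsDiscreteValuationRing w] (hO : O.comap (algebraMap K L) = w) (r : w) :
    r ∈ (IsDiscreteValuationRing.maximalIdeal w).asIdeal ↔ algebraMap w L r ∈ O.nonunits := by
  rw [IsScalarTower.algebraMap_apply w K L, ValuationSubring.algebraMap_mem_nonunits_iff hO,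
    ValuationSubring.mem_nonunits_iff_exists_mem_maximalIdeal]
  exact ⟨fun h => ⟨r.2, h⟩, fun ⟨_, h⟩ => h⟩

lemma algebraMap_subtype_mem (hO : O.comap (algebraMap K L) = w) (r : w) :
    algebraMap w L r ∈ O := by
  rw [IsScalarTower.algebraMap_apply w K L, ValuationSubring.algebraMap_mem_iff hO]
  exact r.2

lemma algebraMap_algebraMap_mem (hw : IsRationalPlace k w t) (hO : O.comap (algebraMap K L) = w)
    (a : k) : algebraMap K L (algebraMap k K a) ∈ O :=
  (ValuationSubring.algebraMap_mem_iff hO _).mpr (hw.algebraMap_mem a)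

lemma algebraMap_notMem_nonunits (hw : IsRationalPlace k w t)
    (hO : O.comap (algebraMap K L) = w) {a : k} (ha : a ≠ 0) :
    algebraMap K L (algebraMap k K a) ∉ O.nonunits := by
  intro h
  rw [ValuationSubring.mem_nonunits_iff_or, ← map_inv₀, ← map_inv₀] at h
  rcases h with h | h
  · simp [ha] at h
  · exact h (hw.algebraMap_algebraMap_mem hO _)

variable [IsGalois K L] [FiniteDimensional K L]

/-- If the residue field of `w` is algebraically closed then it is also the residue field at the
places of `L` over `w`. -/
theorem exists_sub_mem_nonunits [IsAlgClosed k] (hw : IsRationalPlace k w t)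
    (hO : O.comap (algebraMap K L) = w) {f : L} (hf : f ∈ O) :
    ∃ a : k, f - algebraMap K L (algebraMap k K a) ∈ O.nonunits := by
  have := hw.isDiscreteValuationRing
  have hwO := algebraMap_subtype_mem hO
  let c : k →+* O := ((algebraMap K L).comp (algebraMap k K)).codRestrict O.toSubring
    (hw.algebraMap_algebraMap_mem hO)
  let ψ : k →+* IsLocalRing.ResidueField O := (IsLocalRing.residue O).comp c
  let i : w →+* O := (algebraMap w L).codRestrict O.toSubring hwO
  let φ : w →+* IsLocalRing.ResidueField O := (IsLocalRing.residue O).comp i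
  have hφ : ∀ r, φ r ∈ Set.range ψ := by
    intro r
    obtain ⟨a, ha⟩ := hw.exists_sub_mem r r.2
    refine ⟨a, ?_⟩
    rw [eq_comm, ← sub_eq_zero]
    change IsLocalRing.residue O (i r) - IsLocalRing.residue O (c a) = 0
    rw [← map_sub, ValuationSubring.residue_eq_zero_iff]
    rw [← ValuationSubring.algebraMap_mem_nonunits_iff hO, map_sub] at ha
    exact ha
  have key : ∀ b : O, IsIntegral w (b : L) → IsLocalRing.residue O b ∈ ψ.range := by
    rintro b ⟨P, hP, hb⟩
    have hl : P.map φ ∈ Polynomial.lifts ψ := by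
      rw [Polynomial.lifts_iff_coeff_lifts]
      intro n
      rw [Polynomial.coeff_map]
      exact hφ _
    obtain ⟨q, hq, -, hqm⟩ := Polynomial.lifts_and_natDegree_eq_and_monic hl (hP.map φ)
    refine (IsAlgClosed.splits q).mem_range_of_isRoot hqm.ne_zero ?_
    rw [hq, Polynomial.IsRoot, Polynomial.eval_map]
    change Polynomial.eval₂ ((IsLocalRing.residue O).comp i) (IsLocalRing.residue O b) P = 0
    rw [← Polynomial.hom_eval₂]
    have : Polynomial.eval₂ i b P = 0 := by
      apply Subtype.ext
      change O.subtype _ = O.subtype 0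
      rw [Polynomial.hom_eval₂, map_zero, ← hb]
      rfl
    rw [this, map_zero]
  obtain ⟨b, d, hb, hd, hdn, hfd⟩ := ValuationSubring.exists_isIntegral_mul_eq K hwO
    (mem_maximalIdeal_iff hO) hf
  obtain ⟨β, hβ⟩ := key ⟨b, ValuationSubring.mem_of_isIntegral hwO hb⟩ hb
  obtain ⟨δ, hδ⟩ := key ⟨d, ValuationSubring.mem_of_isIntegral hwO hd⟩ hd
  refine ⟨β / δ, ?_⟩
  change ((⟨f, hf⟩ - c (β / δ) : O) : L) ∈ O.nonunits
  rw [← ValuationSubring.residue_eq_zero_iff, map_sub, sub_eq_zero]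
  change _ = ψ (β / δ)
  have hδ0 : ψ δ ≠ 0 := by
    rw [hδ, Ne, ValuationSubring.residue_eq_zero_iff]; exact hdn
  rw [map_div₀, eq_div_iff hδ0, hδ, hβ, ← map_mul]
  congr 1
  exact Subtype.ext hfd

theorem exists_smul_eq (hw : IsRationalPlace k w t) {O' : ValuationSubring L}
    (hO : O.comap (algebraMap K L) = w) (hO' : O'.comap (algebraMap K L) = w) :
    ∃ σ : L ≃ₐ[K] L, σ • O = O' :=
  have := hw.isDiscreteValuationRing
  ValuationSubring.exists_smul_eq (algebraMap_subtype_mem hO) (algebraMap_subtype_mem hO')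
    (mem_maximalIdeal_iff hO) (mem_maximalIdeal_iff hO')

lemma sub_mem_nonunits [IsAlgClosed k] (hw : IsRationalPlace k w t)
    (hO : O.comap (algebraMap K L) = w) {σ : L ≃ₐ[K] L} (hσ : σ • O = O) {f : L} (hf : f ∈ O) :
    σ f - f ∈ O.nonunits := by
  obtain ⟨a, ha⟩ := hw.exists_sub_mem_nonunits hO hf
  have h2 : σ (f - algebraMap K L (algebraMap k K a)) ∈ O.nonunits := by
    rw [← hσ, ValuationSubring.mem_nonunits_smul_iff, AlgEquiv.symm_apply_apply]
    exact ha
  rw [map_sub, AlgEquiv.commutes] at h2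
  convert O.nonunits.sub_mem h2 ha using 1
  ring

end IsRationalPlace

end RationalPlace

section Ramification

open scoped Pointwise Polynomial

open IsDedekindDomain WithZero

lemma mem_inertiaIn_iff {k L : Type} [Field k] [Field L] [Algebra (RatFunc k) L]
    {O : ValuationSubring L} {σ : L ≃ₐ[RatFunc k] L} :
    σ ∈ inertiaIn k O ↔ σ • O = O ∧ ∀ f ∈ O, σ f - f ∈ O.nonunits := by
  rw [inertiaIn, Subgroup.mem_map]
  have key : ∀ s : O.decompositionSubgroup (RatFunc k), s ∈ O.inertiaSubgroup (RatFunc k) ↔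
      ∀ f ∈ O, (s : L ≃ₐ[RatFunc k] L) f - f ∈ O.nonunits := by
    intro s
    rw [ValuationSubring.inertiaSubgroup, MonoidHom.mem_ker, RingEquiv.ext_iff]
    have h : ∀ f : O, (MulSemiringAction.toRingAut (O.decompositionSubgroup (RatFunc k))
        (IsLocalRing.ResidueField O) s (IsLocalRing.residue O f) = IsLocalRing.residue O f) ↔
        (s : L ≃ₐ[RatFunc k] L) f - f ∈ O.nonunits := by
      intro f
      change IsLocalRing.residue O (s • f) = IsLocalRing.residue O f ↔ _
      rw [← sub_eq_zero, ← map_sub, ValuationSubring.residue_eq_zero_iff]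
      rfl
    constructor
    · intro hs f hf
      exact (h ⟨f, hf⟩).mp (hs _)
    · intro hs x
      obtain ⟨f, rfl⟩ := IsLocalRing.residue_surjective x
      exact (h f).mpr (hs f f.2)
  constructor
  · rintro ⟨s, hs, rfl⟩
    exact ⟨s.2, (key s).mp hs⟩
  · rintro ⟨h1, h2⟩
    exact ⟨⟨σ, h1⟩, (key ⟨σ, h1⟩).mpr h2, rfl⟩

/-- Every valuation subring of `K` extends to `L`. -/
theorem ValuationSubring.exists_comap_eq {K L : Type*} [Field K] [Field L] [Algebra K L]
    (w : ValuationSubring K) : ∃ O : ValuationSubring L, O.comap (algebraMap K L) = w := by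
  obtain ⟨O, hle, hloc⟩ := (w.toLocalSubring.map (algebraMap K L)).exists_le_valuationSubring
  refine ⟨O, ?_⟩
  have hmem : ∀ x ∈ w, algebraMap K L x ∈ O := fun x hx => hle ⟨x, hx, rfl⟩
  ext x
  rw [mem_comap]
  refine ⟨fun h => ?_, hmem x⟩
  by_contra hx
  have hx0 : x ≠ 0 := fun h0 => hx (h0 ▸ w.zero_mem)
  have hxi : x⁻¹ ∈ w := (w.mem_or_inv_mem x).resolve_left hx
  have hu : IsUnit (Subring.inclusion hle ⟨algebraMap K L x⁻¹, ⟨x⁻¹, hxi, rfl⟩⟩) := by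
    refine IsUnit.of_mul_eq_one ⟨algebraMap K L x, h⟩ (Subtype.ext ?_)
    change algebraMap K L x⁻¹ * algebraMap K L x = 1
    rw [← map_mul, inv_mul_cancel₀ hx0, map_one]
  obtain ⟨⟨_, y, hy, rfl⟩, h1⟩ := (hloc.1 _ hu).exists_right_inv
  have h2 : x⁻¹ * y = 1 := by
    apply (algebraMap K L).injective
    rw [map_mul, map_one]
    exact congrArg Subtype.val h1
  rw [inv_mul_eq_one₀ hx0] at h2
  exact hx (h2 ▸ hy)

variable {k K L : Type} [Field k] [Field K] [Algebra k K] [Field L] [Algebra K L]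
  {w : ValuationSubring K} {t : K} {O : ValuationSubring L} [IsGalois K L] [FiniteDimensional K L]

namespace IsRationalPlace

/-- The normalized valuation of a place `O` over `w`; its ramification index is the order of the
stabilizer of `O`. -/
theorem exists_valuation [IsAlgClosed k] (hw : IsRationalPlace k w t)
    (hO : O.comap (algebraMap K L) = w) :
    ∃ v : Valuation L ℤᵐ⁰, v.valuationSubring = O ∧ Function.Surjective v ∧
      v (algebraMap K L t) = exp (-(Nat.card (MulAction.stabilizer (L ≃ₐ[K] L) O) : ℤ)) := by
  have := hw.isDiscreteValuationRing
  have hwO := algebraMap_subtype_mem hO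
  have hmem := mem_maximalIdeal_iff hO
  have := IsIntegralClosure.isDedekindDomain w K L (integralClosure w L)
  have := IsIntegralClosure.isFractionRing_of_finite_extension w K L (integralClosure w L)
  have := IsIntegralClosure.finite w K L (integralClosure w L)
  set p := IsDiscreteValuationRing.maximalIdeal w with hp
  obtain ⟨Q, hQ, hlies, hQO⟩ := ValuationSubring.exists_heightOneSpectrum K hwO hmem
  refine ⟨Q.valuation L, hQO, Q.valuation_surjective L, ?_⟩
  have : p.asIdeal.IsMaximal := p.isMaximal
  have : IsAlgClosed p.asIdeal.ResidueField := by
    let c : k →+* w := (algebraMap k K).codRestrict w.toSubring hw.algebraMap_mem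
    let ψ : k →+* p.asIdeal.ResidueField := (algebraMap w p.asIdeal.ResidueField).comp c
    refine IsAlgClosed.of_ringEquiv k _ (RingEquiv.ofBijective ψ ⟨ψ.injective, fun x => ?_⟩)
    obtain ⟨y, rfl⟩ := (Ideal.bijective_algebraMap_quotient_residueField p.asIdeal).2 x
    obtain ⟨r, rfl⟩ := Ideal.Quotient.mk_surjective y
    obtain ⟨a, ha⟩ := hw.exists_sub_mem r r.2
    refine ⟨a, ?_⟩
    change algebraMap w _ (c a) = _
    rw [IsScalarTower.algebraMap_apply w (w ⧸ p.asIdeal) p.asIdeal.ResidueField]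
    congr 1
    refine (Ideal.Quotient.eq.mpr ?_).symm
    rw [hmem]
    rw [← ValuationSubring.algebraMap_mem_nonunits_iff hO] at ha
    exact ha
  have hcard := Ideal.card_inertia_eq_ramificationIdxIn (G := L ≃ₐ[K] L) p.asIdeal Q.asIdeal
  have hst : Ideal.inertia (L ≃ₐ[K] L) Q.asIdeal = MulAction.stabilizer (L ≃ₐ[K] L) O := by
    ext σ
    rw [MulAction.mem_stabilizer_iff, ← ValuationSubring.mem_stabilizer_iff hwO hmem, ← hQ]
    constructor
    · intro h
      exact Ideal.inertia_le_stabilizer Q.asIdeal h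
    · intro h b
      rw [hQ, ValuationSubring.mem_stabilizer_iff hwO hmem] at h
      have := hw.sub_mem_nonunits hO h (ValuationSubring.mem_of_isIntegral hwO b.2)
      change _ ∈ Q.asIdeal
      rw [hQ]
      exact this
  rw [hst, Ideal.ramificationIdxIn_eq_ramificationIdx p.asIdeal Q.asIdeal (L ≃ₐ[K] L),
    ← Ideal.ramificationIdx'_eq_ramificationIdx p.asIdeal Q.asIdeal p.ne_bot] at hcard
  rw [hcard, ← HeightOneSpectrum.valuation_liesOver L p Q]
  have htw : t ∈ w := ValuationSubring.nonunits_mem hw.uniformizer_mem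
  have ht : p.valuation K t = exp (-1 : ℤ) := by
    change p.valuation K (algebraMap w K ⟨t, htw⟩) = _
    rw [HeightOneSpectrum.valuation_of_algebraMap]
    refine HeightOneSpectrum.intValuation_singleton _
      (fun h0 => hw.ne_zero (congrArg Subtype.val h0)) ?_
    ext r
    have hr : r ∈ p.asIdeal ↔ (r : K) ∈ w.nonunits :=
      ⟨fun h => ValuationSubring.mem_nonunits_iff_exists_mem_maximalIdeal.mpr ⟨r.2, h⟩,
        fun h => (ValuationSubring.mem_nonunits_iff_exists_mem_maximalIdeal.mp h).2⟩
    rw [hr, Ideal.mem_span_singleton']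
    constructor
    · intro h
      exact ⟨⟨_, hw.div_mem _ h⟩, Subtype.ext (div_mul_cancel₀ _ hw.ne_zero)⟩
    · rintro ⟨a, rfl⟩
      exact ValuationSubring.mul_mem_nonunits a.2 hw.uniformizer_mem
  rw [ht, ← exp_nsmul]
  simp

end IsRationalPlace

end Ramification

section TameCharacter

open scoped Pointwise

variable {k K L : Type} [Field k] [Field K] [Algebra k K] [Field L] [Algebra K L]
  {w : ValuationSubring K} {t : K} {O : ValuationSubring L} [IsGalois K L] [FiniteDimensional K L]

namespace IsRationalPlace

lemma valuation_smul_div [IsAlgClosed k] (hw : IsRationalPlace k w t)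
    (hO : O.comap (algebraMap K L) = w) {m : ℕ} (hm : m ≠ 0) {δ : L} {z : K}
    (hz : O.valuation (δ ^ m * algebraMap K L z) = 1) {σ : L ≃ₐ[K] L} (hσ : σ • O = O) :
    (σ δ / δ) ^ m - 1 ∈ O.nonunits ∧ O.valuation (σ δ / δ) = 1 := by
  set u := δ ^ m * algebraMap K L z with hu
  have hu0 : u ≠ 0 := fun h => by simp [h] at hz
  have hz0 : algebraMap K L z ≠ 0 := right_ne_zero_of_mul hu0
  have hδ0 : δ ^ m ≠ 0 := left_ne_zero_of_mul hu0
  have h1 := hw.sub_mem_nonunits hO hσ ((O.valuation_le_one_iff u).mp hz.le)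
  have h2 : (σ δ / δ) ^ m - 1 = (σ u - u) / u := by
    rw [hu, map_mul, AlgEquiv.commutes, map_pow, div_pow]
    field_simp
  have h3 : (σ δ / δ) ^ m - 1 ∈ O.nonunits := by
    rw [ValuationSubring.mem_nonunits_iff] at h1 ⊢
    rw [h2, map_div₀, hz, div_one]
    exact h1
  refine ⟨h3, ?_⟩
  have h4 : O.valuation ((σ δ / δ) ^ m) = 1 := by
    rw [ValuationSubring.mem_nonunits_iff] at h3
    have := O.valuation.map_add_eq_of_lt_right (x := (σ δ / δ) ^ m - 1) (y := 1)
      (by rwa [map_one])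
    rwa [sub_add_cancel, map_one] at this
  rw [map_pow] at h4
  exact (pow_eq_one_iff.mp h4).resolve_right hm

/-- The structure of the inertia group, when the tame part is detected by the action on `δ`. -/
theorem exists_wild_subgroup [IsAlgClosed k] (hw : IsRationalPlace k w t)
    (hO : O.comap (algebraMap K L) = w) {m p : ℕ} (hm : m ≠ 0) (hp : p ≠ 0) {δ : L} {z : K}
    (hz : O.valuation (δ ^ m * algebraMap K L z) = 1)
    (hN : ∀ N : Subgroup (L ≃ₐ[K] L), (∀ σ ∈ N, σ • O = O ∧ σ δ / δ - 1 ∈ O.nonunits) →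
      Nat.card N ∣ p)
    (hpm : p * m ∣ Nat.card (MulAction.stabilizer (L ≃ₐ[K] L) O)) :
    ∃ N ≤ MulAction.stabilizer (L ≃ₐ[K] L) O,
      MulAction.stabilizer (L ≃ₐ[K] L) O ≤ Subgroup.normalizer (N : Set (L ≃ₐ[K] L)) ∧
      Nat.card N = p ∧ Nat.card (MulAction.stabilizer (L ≃ₐ[K] L) O) = p * m := by
  set I := MulAction.stabilizer (L ≃ₐ[K] L) O with hI
  have hu0 : δ ^ m * algebraMap K L z ≠ 0 := fun h => by simp [h] at hz
  have hδ0 : δ ≠ 0 := fun h => hu0 (by simp [h, hm])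
  have hval := fun σ : I => (hw.valuation_smul_div hO hm hz σ.2).2
  have hpow := fun σ : I => (hw.valuation_smul_div hO hm hz σ.2).1
  let c : I → O := fun σ => ⟨(σ : L ≃ₐ[K] L) δ / δ, (O.valuation_le_one_iff _).mp (hval σ).le⟩
  let θ : I →* IsLocalRing.ResidueField O :=
    { toFun := fun σ => IsLocalRing.residue O (c σ)
      map_one' := by
        rw [← map_one (IsLocalRing.residue O)]
        congr 1
        exact Subtype.ext (div_self hδ0)
      map_mul' := by
        intro σ τ
        rw [← map_mul, ← sub_eq_zero, ← map_sub, ValuationSubring.residue_eq_zero_iff]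
        have h := ValuationSubring.mul_mem_nonunits (c σ).2
          (hw.sub_mem_nonunits hO σ.2 (c τ).2)
        convert h using 1
        change (σ : L ≃ₐ[K] L) ((τ : L ≃ₐ[K] L) δ) / δ -
          (σ : L ≃ₐ[K] L) δ / δ * ((τ : L ≃ₐ[K] L) δ / δ) = (σ : L ≃ₐ[K] L) δ / δ *
          ((σ : L ≃ₐ[K] L) ((τ : L ≃ₐ[K] L) δ / δ) - (τ : L ≃ₐ[K] L) δ / δ)
        have : (σ : L ≃ₐ[K] L) δ ≠ 0 := by simpa using hδ0
        rw [map_div₀]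
        field_simp }
  have hker : ∀ σ : I, σ ∈ θ.toHomUnits.ker ↔ (σ : L ≃ₐ[K] L) δ / δ - 1 ∈ O.nonunits := by
    intro σ
    rw [MonoidHom.mem_ker, Units.ext_iff, MonoidHom.coe_toHomUnits, Units.val_one,
      ← sub_eq_zero, ← map_one (IsLocalRing.residue O)]
    change IsLocalRing.residue O (c σ) - _ = 0 ↔ _
    rw [← map_sub, ValuationSubring.residue_eq_zero_iff]
    rfl
  have hrange : Nat.card θ.toHomUnits.range ∣ m := by
    have : Finite θ.toHomUnits.range :=
      Finite.of_surjective _ θ.toHomUnits.rangeRestrict_surjective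
    have : IsCyclic θ.toHomUnits.range := inferInstance
    rw [← IsCyclic.exponent_eq_card]
    refine Monoid.exponent_dvd_of_forall_pow_eq_one ?_
    rintro ⟨_, σ, rfl⟩
    apply Subtype.ext
    rw [SubmonoidClass.coe_pow, OneMemClass.coe_one, Units.ext_iff, Units.val_pow_eq_pow_val,
      MonoidHom.coe_toHomUnits, Units.val_one, ← sub_eq_zero, ← map_one (IsLocalRing.residue O)]
    change IsLocalRing.residue O (c σ) ^ m - _ = 0
    rw [← map_pow, ← map_sub, ValuationSubring.residue_eq_zero_iff]
    exact hpow σ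
  have hcard : Nat.card I = Nat.card θ.toHomUnits.ker * Nat.card θ.toHomUnits.range := by
    rw [← Subgroup.index_ker, Subgroup.card_mul_index]
  set N := θ.toHomUnits.ker.map I.subtype with hNdef
  have hNcard : Nat.card N = Nat.card θ.toHomUnits.ker :=
    Subgroup.card_map_of_injective I.subtype_injective
  have hNp : Nat.card N ∣ p := by
    refine hN N ?_
    rintro _ ⟨σ, hσ, rfl⟩
    exact ⟨σ.2, (hker σ).mp hσ⟩
  rw [← hNcard] at hcard
  have hpm0 : 0 < p * m := Nat.pos_of_ne_zero (mul_ne_zero hp hm)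
  have heq : Nat.card I = p * m :=
    Nat.dvd_antisymm (hcard ▸ mul_dvd_mul hNp hrange) hpm
  refine ⟨N, ?_, ?_, ?_, heq⟩
  · rintro _ ⟨σ, -, rfl⟩
    exact σ.2
  · have := Subgroup.le_normalizer_map (H := θ.toHomUnits.ker) I.subtype
    rwa [Subgroup.normalizer_eq_top, ← MonoidHom.range_eq_map, Subgroup.range_subtype] at this
  · rw [heq] at hcard
    have h1 : Nat.card N ≤ p := Nat.le_of_dvd (Nat.pos_of_ne_zero hp) hNp
    have h2 : Nat.card θ.toHomUnits.range ≤ m := Nat.le_of_dvd (Nat.pos_of_ne_zero hm) hrange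
    by_contra h
    have h3 : Nat.card N < p := lt_of_le_of_ne h1 h
    have : Nat.card N * Nat.card θ.toHomUnits.range < p * m :=
      Nat.mul_lt_mul_of_lt_of_le h3 h2 (Nat.pos_of_ne_zero hm)
    omega

end IsRationalPlace

end TameCharacter

section Places

open WithZero IsDedekindDomain

lemma Valuation.mem_nonunits_valuationSubring {K Γ : Type*} [Field K]
    [LinearOrderedCommGroupWithZero Γ] (ν : Valuation K Γ) (x : K) :
    x ∈ ν.valuationSubring.nonunits ↔ ν x < 1 := by
  rw [ValuationSubring.mem_nonunits_iff_or, Valuation.mem_valuationSubring_iff, map_inv₀, not_le]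
  rcases eq_or_ne x 0 with rfl | hx
  · simp
  · simp only [hx, false_or]
    exact one_lt_inv₀ (by simpa [zero_lt_iff] using hx)

lemma isRationalPlace_of_valuation {k K : Type} [Field k] [Field K] [Algebra k K]
    (ν : Valuation K ℤᵐ⁰) {t : K} (ht : ν t = exp (-1 : ℤ))
    (hc : ∀ a : k, ν (algebraMap k K a) ≤ 1)
    (hr : ∀ x, ν x ≤ 1 → ∃ a : k, ν (x - algebraMap k K a) < 1) :
    IsRationalPlace k ν.valuationSubring t where
  isDiscreteValuationRing := by
    have ht0 : t ≠ 0 := by rintro rfl; exact exp_ne_zero (ht.symm.trans ν.map_zero)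
    have : Nontrivial (MonoidWithZeroHom.ofClass ν).valueGroup := by
      refine ⟨1, ⟨Units.mk0 (ν t) (by simpa using ht0), ?_⟩, ?_⟩
      · exact Subgroup.subset_closure ⟨t, rfl⟩
      · intro h
        rw [Subtype.ext_iff, Units.ext_iff] at h
        have h1 : exp (0 : ℤ) = exp (-1 : ℤ) := by rw [← ht]; exact h
        rw [exp_inj] at h1
        omega
    infer_instance
  ne_zero := by rintro rfl; exact exp_ne_zero (ht.symm.trans ν.map_zero)
  algebraMap_mem := hc
  exists_sub_mem x hx := by
    obtain ⟨a, ha⟩ := hr x hx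
    exact ⟨a, (ν.mem_nonunits_valuationSubring _).mpr ha⟩
  uniformizer_mem := by
    rw [Valuation.mem_nonunits_valuationSubring, ht, ← exp_zero, exp_lt_exp]
    norm_num
  div_mem x hx := by
    rw [Valuation.mem_nonunits_valuationSubring] at hx
    rw [Valuation.mem_valuationSubring_iff, map_div₀, ht]
    rcases eq_or_ne x 0 with rfl | hx0
    · simp
    · have h0 : ν x ≠ 0 := by simpa using hx0
      rw [← exp_log h0] at hx ⊢
      rw [← exp_sub, ← exp_zero, exp_le_exp]
      rw [← exp_zero, exp_lt_exp] at hx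
      omega

variable (k : Type) [Field k]

theorem isRationalPlace_inftyPlace : IsRationalPlace k (inftyPlace k) (RatFunc.X : RatFunc k)⁻¹ := by
  classical
  let := Classical.decEq (RatFunc k)
  change IsRationalPlace k (RatFunc.inftyValuation k).valuationSubring _
  have hle : ∀ f : Polynomial k, ∀ n : ℕ, f.natDegree ≤ n →
      RatFunc.inftyValuation k (algebraMap _ _ f) ≤ exp (n : ℤ) := by
    intro f n hf
    rcases eq_or_ne f 0 with rfl | h
    · simp
    · rw [RatFunc.inftyValuation_apply, RatFunc.inftyValuation.polynomial k h, exp_le_exp]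
      exact_mod_cast hf
  have hlt : ∀ f g : Polynomial k, f.degree < g.degree →
      RatFunc.inftyValuation k (algebraMap _ _ f) < RatFunc.inftyValuation k (algebraMap _ _ g) := by
    intro f g h
    have hg : g ≠ 0 := Polynomial.ne_zero_of_degree_gt h
    rcases eq_or_ne f 0 with rfl | hf
    · rw [map_zero, map_zero, zero_lt_iff]
      simpa using hg
    · rw [RatFunc.inftyValuation_apply, RatFunc.inftyValuation_apply,
        RatFunc.inftyValuation.polynomial k hf, RatFunc.inftyValuation.polynomial k hg, exp_lt_exp]
      exact_mod_cast Polynomial.natDegree_lt_natDegree hf h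
  refine isRationalPlace_of_valuation _ ?_ ?_ ?_
  · rw [map_inv₀, RatFunc.inftyValuation.X, exp_neg]
  · intro a
    rw [IsScalarTower.algebraMap_apply k (Polynomial k) (RatFunc k)]
    simpa using hle (Polynomial.C a) 0 (by simp)
  · intro x hx
    have hd := x.denom_ne_zero
    have hd' : RatFunc.inftyValuation k (algebraMap (Polynomial k) _ x.denom) ≠ 0 := by
      simpa using hd
    have hdv : (0 : ℤᵐ⁰) < RatFunc.inftyValuation k (algebraMap (Polynomial k) _ x.denom) :=
      zero_lt_iff.mpr hd'
    have hdeg : x.num.degree ≤ x.denom.degree := by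
      by_contra! h
      have := hlt _ _ h
      rw [← RatFunc.num_div_denom x, map_div₀, div_le_one₀ hdv] at hx
      exact absurd this (not_lt.mpr hx)
    have key : ∀ a : k, (x.num - Polynomial.C a * x.denom).degree < x.denom.degree →
        RatFunc.inftyValuation k (x - algebraMap k _ a) < 1 := by
      intro a h
      have h2 : x - algebraMap k _ a = algebraMap (Polynomial k) (RatFunc k)
          (x.num - Polynomial.C a * x.denom) / algebraMap (Polynomial k) _ x.denom := by
        have hd2 : algebraMap (Polynomial k) (RatFunc k) x.denom ≠ 0 := by simpa using hd
        rw [eq_div_iff hd2, map_sub, map_mul, sub_mul]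
        nth_rewrite 1 [← RatFunc.num_div_denom x]
        rw [div_mul_cancel₀ _ hd2]
        rfl
      rw [h2, map_div₀, div_lt_one₀ hdv]
      exact hlt _ _ h
    rcases hdeg.lt_or_eq with h | h
    · exact ⟨0, key 0 (by simpa using h)⟩
    · refine ⟨x.num.leadingCoeff, key _ ?_⟩
      rw [← h]
      have hn : x.num ≠ 0 := by
        intro h0
        rw [h0, Polynomial.degree_zero] at h
        exact hd (Polynomial.degree_eq_bot.mp h.symm)
      have hl : x.num.leadingCoeff ≠ 0 := by simpa using hn
      refine Polynomial.degree_sub_lt_left ?_ hn ?_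
      · rw [Polynomial.degree_C_mul hl, h]
      · rw [Polynomial.leadingCoeff_mul, Polynomial.leadingCoeff_C, x.monic_denom, mul_one]

/-- The place of `k(X)` at the origin. -/
noncomputable def zeroPlace : ValuationSubring (RatFunc k) :=
  ((Polynomial.idealX k).valuation (RatFunc k)).valuationSubring

lemma algebraMap_mem_nonunits_zeroPlace_iff (f : Polynomial k) :
    algebraMap _ (RatFunc k) f ∈ (zeroPlace k).nonunits ↔ f.eval 0 = 0 := by
  rw [zeroPlace, Valuation.mem_nonunits_valuationSubring]
  refine ((Polynomial.idealX k).valuation_lt_one_iff_mem f).trans ?_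
  rw [Polynomial.idealX_span, Ideal.mem_span_singleton, Polynomial.X_dvd_iff,
    Polynomial.coeff_zero_eq_eval_zero]

theorem isRationalPlace_zeroPlace : IsRationalPlace k (zeroPlace k) (RatFunc.X : RatFunc k) := by
  refine isRationalPlace_of_valuation _ (by simp) ?_ ?_
  · intro a
    rw [IsScalarTower.algebraMap_apply k (Polynomial k) (RatFunc k)]
    exact HeightOneSpectrum.valuation_le_one _ _
  · intro x hx
    have hn : ∀ y, ((Polynomial.idealX k).valuation (RatFunc k)) y < 1 ↔
        y ∈ (zeroPlace k).nonunits :=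
      fun y => (Valuation.mem_nonunits_valuationSubring _ y).symm
    obtain ⟨b, ⟨d, hd⟩, h⟩ := (Polynomial.idealX k).exists_primeCompl_mul_eq_of_integer x hx
    have hd' : d.eval 0 ≠ 0 := by
      rw [← Polynomial.coeff_zero_eq_eval_zero, Ne, ← Polynomial.X_dvd_iff,
        ← Ideal.mem_span_singleton]
      exact hd
    refine ⟨b.eval 0 / d.eval 0, ?_⟩
    have h1 : algebraMap (Polynomial k) (RatFunc k)
        (b - Polynomial.C (b.eval 0 / d.eval 0) * d) ∈ (zeroPlace k).nonunits := by
      rw [algebraMap_mem_nonunits_zeroPlace_iff]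
      simp [hd']
    have hdu : algebraMap (Polynomial k) (RatFunc k) d ∉ (zeroPlace k).nonunits := by
      rwa [algebraMap_mem_nonunits_zeroPlace_iff]
    have hd0 : algebraMap (Polynomial k) (RatFunc k) d ≠ 0 :=
      fun h => hdu (h ▸ (zeroPlace k).nonunits.zero_mem)
    rw [hn]
    convert ValuationSubring.mul_mem_nonunits
      (ValuationSubring.inv_mem_of_notMem_nonunits hdu) h1 using 1
    change x * algebraMap (Polynomial k) (RatFunc k) d = algebraMap _ _ b at h
    rw [map_sub, map_mul, ← h]
    field_simp
    rfl

end Places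

section Etale

open scoped Pointwise Polynomial

open IsDedekindDomain

lemma Polynomial.isAlgClosed_residueField {k : Type} [Field k] [IsAlgClosed k] (p : Ideal k[X])
    [p.IsMaximal] : IsAlgClosed p.ResidueField := by
  let := Ideal.Quotient.field p
  have : Module.Finite k (k[X] ⧸ p) := finite_of_finite_type_of_isJacobsonRing _ _
  have h1 := IsAlgClosed.algebraMap_bijective_of_isIntegral (k := k) (K := k[X] ⧸ p)
  have h2 := Ideal.bijective_algebraMap_quotient_residueField p
  exact IsAlgClosed.of_ringEquiv k _ ((RingEquiv.ofBijective _ h1).trans (RingEquiv.ofBijective _ h2))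

/-- A cover of the affine line is étale as soon as its inertia groups are trivial. -/
theorem etale_integralClosure {k L : Type} [Field k] [IsAlgClosed k] [Field L]
    [Algebra (RatFunc k) L] [Algebra k[X] L] [IsScalarTower k[X] (RatFunc k) L]
    [FiniteDimensional (RatFunc k) L] [IsGalois (RatFunc k) L]
    (h : ∀ O : ValuationSubring L, (∀ f : k[X], algebraMap k[X] L f ∈ O) →
      ∀ σ : L ≃ₐ[RatFunc k] L, σ • O = O → (∀ f ∈ O, σ f - f ∈ O.nonunits) → σ = 1) :
    Algebra.Etale k[X] (integralClosure k[X] L) := by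
  have := IsIntegralClosure.isDedekindDomain k[X] (RatFunc k) L (integralClosure k[X] L)
  have := IsIntegralClosure.isFractionRing_of_finite_extension k[X] (RatFunc k) L
    (integralClosure k[X] L)
  have := IsIntegralClosure.finite k[X] (RatFunc k) L (integralClosure k[X] L)
  have := isGaloisGroup_integralClosure (R := k[X]) (K := RatFunc k) (L := L)
  have hinj : Function.Injective (algebraMap k[X] L) := by
    rw [IsScalarTower.algebraMap_eq k[X] (RatFunc k) L]
    exact (algebraMap (RatFunc k) L).injective.comp (IsFractionRing.injective _ _)
  have : Module.IsTorsionFree k[X] L := (Module.isTorsionFree_iff_algebraMap_injective).mpr hinj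
  have : Module.Free k[X] (integralClosure k[X] L) := Module.free_of_finite_type_torsion_free'
  have hflat : Module.Flat k[X] (integralClosure k[X] L) := inferInstance
  have hmax : ∀ q : PrimeSpectrum (integralClosure k[X] L), q.asIdeal.IsMaximal →
      Algebra.IsUnramifiedAt k[X] q.asIdeal := by
    intro q hq
    have hp : (q.asIdeal.under k[X]).IsMaximal := Ideal.IsMaximal.under k[X] q.asIdeal
    have := Polynomial.isAlgClosed_residueField (q.asIdeal.under k[X])
    rw [← Ideal.ramificationIdx_eq_one_iff, ← Ideal.ramificationIdxIn_eq_ramificationIdx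
      (q.asIdeal.under k[X]) q.asIdeal (L ≃ₐ[RatFunc k] L),
      ← Ideal.card_inertia_eq_ramificationIdxIn (G := L ≃ₐ[RatFunc k] L) _ q.asIdeal,
      Subgroup.card_eq_one, Subgroup.eq_bot_iff_forall]
    intro σ hσ
    have hq0 : q.asIdeal ≠ ⊥ := by
      intro h0
      refine Ring.ne_bot_of_isMaximal_of_not_isField hp (Polynomial.not_isField k) ?_
      rw [h0]
      exact Ideal.under_bot _ _
    let Q : HeightOneSpectrum (integralClosure k[X] L) := ⟨q.asIdeal, q.isPrime, hq0⟩
    have hst : σ • q.asIdeal = q.asIdeal := Ideal.inertia_le_stabilizer q.asIdeal hσ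
    set O := (Q.valuation L).valuationSubring with hO
    have hBO : ∀ b : integralClosure k[X] L, (b : L) ∈ O := fun b => Q.valuation_le_one b
    have hBn : ∀ b : integralClosure k[X] L, (b : L) ∈ O.nonunits ↔ b ∈ q.asIdeal := fun b =>
      (Valuation.mem_nonunits_valuationSubring _ _).trans (Q.valuation_lt_one_iff_mem b)
    have hσO : σ • O = O := by
      symm
      refine ValuationSubring.eq_valuationSubring_of_center_eq (B := integralClosure k[X] L)
        (O := σ • O) ?_ Q ?_
      · intro b
        rw [ValuationSubring.mem_smul_iff]
        exact hBO (σ⁻¹ • b)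
      · intro b
        rw [ValuationSubring.mem_nonunits_smul_iff]
        refine Iff.trans ?_ (hBn (σ⁻¹ • b)).symm
        change b ∈ q.asIdeal ↔ _
        rw [← Ideal.mem_pointwise_smul_iff_inv_smul_mem, hst]
    refine h O (fun f => hBO (algebraMap _ _ f)) σ hσO fun f hf => ?_
    obtain ⟨b, ⟨d, hd⟩, hfd⟩ := Q.exists_primeCompl_mul_eq_of_integer f hf
    have hdu : (d : L) ∉ O.nonunits := fun h => hd ((hBn d).mp h)
    have hdu' : σ d ∉ O.nonunits := by
      intro h
      rw [← hσO, ValuationSubring.mem_nonunits_smul_iff, AlgEquiv.symm_apply_apply] at h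
      exact hdu h
    refine (ValuationSubring.mem_or_mem_of_mul_mem_nonunits (y := σ d) ?_).resolve_right hdu'
    have h1 := (hBn _).mpr (hσ b)
    have h2 := ValuationSubring.mul_mem_nonunits hf ((hBn _).mpr (hσ d))
    convert O.nonunits.sub_mem h1 h2 using 1
    change f * (d : L) = (b : L) at hfd
    change (σ f - f) * σ d = (σ (b : L) - b) - f * (σ (d : L) - d)
    rw [← hfd, map_mul]
    ring
  have : Algebra.FormallyUnramified k[X] (integralClosure k[X] L) := by
    rw [Algebra.formallyUnramified_iff_forall]
    intro q
    obtain ⟨M, hM, hqM⟩ := q.asIdeal.exists_le_maximal q.isPrime.ne_top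
    have hmem : (⟨M, hM.isPrime⟩ : PrimeSpectrum (integralClosure k[X] L)) ∈
        Algebra.unramifiedLocus k[X] (integralClosure k[X] L) := hmax ⟨M, hM.isPrime⟩ hM
    exact Algebra.isOpen_unramifiedLocus.stableUnderGeneralization
      ((PrimeSpectrum.le_iff_specializes q ⟨M, hM.isPrime⟩).mp hqM) hmem
  have : Algebra.FinitePresentation k[X] (integralClosure k[X] L) :=
    Algebra.FinitePresentation.of_finiteType.mp inferInstance
  exact Algebra.Etale.of_formallyUnramified_of_flat

end Etale

section Derivations

open scoped Polynomial

open KaehlerDifferential in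
lemma Derivation.exists_extension {R S T M : Type*} [CommRing R] [CommRing S] [CommRing T]
    [Algebra R S] [Algebra R T] [Algebra S T] [IsScalarTower R S T] [Algebra.FormallyEtale S T]
    [AddCommGroup M] [Module R M] [Module S M] [Module T M] [IsScalarTower S T M]
    [IsScalarTower R S M] [IsScalarTower R T M]
    (d : Derivation R S M) : ∃ D : Derivation R T M, ∀ s, D (algebraMap S T s) = d s := by
  refine ⟨((d.liftKaehlerDifferential.liftBaseChange T).comp
    (tensorKaehlerEquivOfFormallyEtale R S T).symm.toLinearMap).compDer (KaehlerDifferential.D R T),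
    fun s => ?_⟩
  change d.liftKaehlerDifferential.liftBaseChange T
    ((tensorKaehlerEquivOfFormallyEtale R S T).symm (KaehlerDifferential.D R T _)) = _
  rw [tensorKaehlerEquivOfFormallyEtale_symm_D_algebraMap]
  simp

lemma Derivation.eq_of_formallyUnramified {R S T M : Type*} [CommRing R] [CommRing S] [CommRing T]
    [Algebra R S] [Algebra R T] [Algebra S T] [IsScalarTower R S T] [Algebra.FormallyUnramified S T]
    [AddCommGroup M] [Module R M] [Module S M] [Module T M] [IsScalarTower S T M]
    [IsScalarTower R S M] [IsScalarTower R T M]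
    {D₁ D₂ : Derivation R T M} (h : ∀ s, D₁ (algebraMap S T s) = D₂ (algebraMap S T s)) :
    D₁ = D₂ := by
  let E : Derivation S T M := Derivation.mk'
    { toFun := fun x => D₁ x - D₂ x
      map_add' := fun x y => by rw [map_add, map_add]; abel
      map_smul' := fun s x => by
        rw [RingHom.id_apply, Algebra.smul_def, Derivation.leibniz, Derivation.leibniz, h,
          algebraMap_smul, algebraMap_smul, smul_sub]
        abel }
    fun a b => by
      change D₁ (a * b) - D₂ (a * b) = a • (D₁ b - D₂ b) + b • (D₁ a - D₂ a)
      rw [Derivation.leibniz, Derivation.leibniz, smul_sub, smul_sub]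
      abel
  have hE : E = 0 := by
    ext x
    rw [← E.liftKaehlerDifferential_comp_D x,
      Subsingleton.elim (KaehlerDifferential.D S T x) 0, map_zero, Derivation.zero_apply]
  ext x
  exact sub_eq_zero.mp (congrArg (fun E : Derivation S T M => E x) hE)

theorem exists_derivation {k L : Type} [Field k] [Field L]
    [Algebra (RatFunc k) L] [Algebra k[X] L] [IsScalarTower k[X] (RatFunc k) L]
    [FiniteDimensional (RatFunc k) L] [IsGalois (RatFunc k) L]
    [Algebra.Etale k[X] (integralClosure k[X] L)] :
    ∃ D : Derivation ℤ L L, (∀ f : k[X], D (algebraMap k[X] L f) =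
      algebraMap k[X] L (Polynomial.derivative f)) ∧ ∀ b, IsIntegral k[X] b → IsIntegral k[X] (D b) := by
  have : Algebra.FormallyEtale k[X] (RatFunc k) :=
    Algebra.FormallyEtale.of_isLocalization (nonZeroDivisors k[X])
  have : Algebra.FormallyEtale (RatFunc k) L := Algebra.FormallyEtale.of_isSeparable _ _
  have : Algebra.FormallyEtale k[X] L := Algebra.FormallyEtale.comp _ (RatFunc k) _
  let d : Derivation ℤ k[X] k[X] := (Polynomial.derivative' (R := k)).restrictScalars ℤ
  let B := integralClosure k[X] L
  obtain ⟨D, hD⟩ := Derivation.exists_extension (T := L)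
    ((Algebra.linearMap k[X] L).compDer d)
  obtain ⟨E, hE⟩ := Derivation.exists_extension (T := B) ((Algebra.linearMap k[X] B).compDer d)
  refine ⟨D, hD, fun b hb => ?_⟩
  have h : (Algebra.linearMap B L).compDer E = D.compAlgebraMap B := by
    refine Derivation.eq_of_formallyUnramified (S := k[X]) fun s => ?_
    change algebraMap B L (E (algebraMap k[X] B s)) = D (algebraMap B L (algebraMap k[X] B s))
    rw [hE, ← IsScalarTower.algebraMap_apply, hD]
    rfl
  have h1 : ((E ⟨b, hb⟩ : B) : L) = D b :=
    congrArg (fun F : Derivation ℤ B L => F ⟨b, hb⟩) h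
  rw [← h1]
  exact (E ⟨b, hb⟩).2

end Derivations

section TameDerivation

open IsDedekindDomain WithZero

variable {k K L : Type} [Field k] [Field K] [Algebra k K] [Field L] [Algebra K L]
  {w : ValuationSubring K} {t : K} {O : ValuationSubring L}

lemma Valuation.map_derivation_le_mul {v : Valuation L ℤᵐ⁰} {t : L} {e : ℕ}
    (ht : v t = exp (-(e : ℤ))) (he : v e = 1) (hint : ∀ n : ℤ, v n ≤ 1)
    (θ : Derivation ℤ L L) (hθt : θ t = -t) {M : ℤᵐ⁰} (hM1 : 1 ≤ M)
    (hM : ∀ u, v u = 1 → v (θ u) ≤ M) (f : L) : v (θ f) ≤ v f * M := by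
  rcases eq_or_ne f 0 with rfl | hf
  · simp
  have ht0 : t ≠ 0 := by
    rintro rfl
    rw [map_zero] at ht
    exact exp_ne_zero ht.symm
  have hvf : v f ≠ 0 := (v.ne_zero_iff).mpr hf
  set n := log (v f)
  have hn : v f = exp n := (exp_log hvf).symm
  have hu : v (f ^ e * t ^ n) = 1 := by
    rw [map_mul, map_pow, map_zpow₀, ht, hn, ← exp_nsmul, ← exp_zsmul, ← exp_add]
    simp [mul_comm]
  have hu0 : f ^ e * t ^ n ≠ 0 := by
    rw [← v.ne_zero_iff, hu]
    exact one_ne_zero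
  have key : f * θ (f ^ e * t ^ n) = (f ^ e * t ^ n) * (e * θ f) - (f ^ e * t ^ n) * (n * f) := by
    rw [Derivation.leibniz, Derivation.leibniz_pow, Derivation.leibniz_zpow, hθt, zpow_sub_one₀ ht0]
    simp only [smul_eq_mul, nsmul_eq_mul, zsmul_eq_mul]
    rcases Nat.eq_zero_or_pos e with h0 | h0
    · subst h0
      field_simp
      simp
    · obtain ⟨e', rfl⟩ := Nat.exists_eq_succ_of_ne_zero h0.ne'
      simp only [Nat.succ_eq_add_one, Nat.add_sub_cancel]
      field_simp
      ring
  have h2 : (f ^ e * t ^ n) * (e * θ f) = f * (θ (f ^ e * t ^ n) + n * (f ^ e * t ^ n)) := by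
    linear_combination -key
  have h3 : v (θ f) = v f * v (θ (f ^ e * t ^ n) + n * (f ^ e * t ^ n)) := by
    rw [← map_mul, ← h2, map_mul v (f ^ e * t ^ n), hu, one_mul, map_mul, he, one_mul]
  rw [h3]
  gcongr
  refine (v.map_add _ _).trans (max_le (hM _ hu) ?_)
  rw [map_mul, hu, mul_one]
  exact (hint n).trans hM1

namespace IsRationalPlace

variable [IsAlgClosed k] [IsGalois K L] [FiniteDimensional K L]

lemma valuation_derivation_le_one (hw : IsRationalPlace k w t)
    (hO : O.comap (algebraMap K L) = w) {v : Valuation L ℤᵐ⁰} (hv : v.valuationSubring = O) {e : ℕ}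
    (ht : v (algebraMap K L t) = exp (-(e : ℤ))) (he : v e = 1) (hint : ∀ n : ℤ, v n ≤ 1)
    (θ : Derivation ℤ L L) (hθt : θ (algebraMap K L t) = -algebraMap K L t)
    (hθk : ∀ a : k, θ (algebraMap K L (algebraMap k K a)) = 0) (M : ℕ)
    (hM : ∀ f ∈ O, v (θ f) ≤ exp (M : ℤ)) : ∀ f ∈ O, v (θ f) ≤ 1 := by
  induction M with
  | zero => simpa using hM
  | succ M ih =>
    refine ih fun f hf => ?_
    obtain ⟨a, ha⟩ := hw.exists_sub_mem_nonunits hO hf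
    rw [← hv, Valuation.mem_nonunits_valuationSubring] at ha
    have h1 := Valuation.map_derivation_le_mul ht he hint θ hθt (M := exp ((M + 1 : ℕ) : ℤ))
      (by rw [← exp_zero, exp_le_exp]; positivity)
      (fun u hu => hM u (by rw [← hv, Valuation.mem_valuationSubring_iff, hu])) (f - algebraMap K L (algebraMap k K a))
    rw [map_sub, hθk, sub_zero] at h1
    refine h1.trans ?_
    rw [← exp_zero] at ha
    have : v (f - algebraMap K L (algebraMap k K a)) ≤ exp (-1 : ℤ) := by
      rcases eq_or_ne (v (f - algebraMap K L (algebraMap k K a))) 0 with h | h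
      · rw [h]; exact zero_le
      · rw [← exp_log h, exp_lt_exp] at ha
        rw [← exp_log h, exp_le_exp]
        omega
    calc _ ≤ exp (-1 : ℤ) * exp ((M + 1 : ℕ) : ℤ) := by gcongr
      _ = exp (M : ℤ) := by rw [← exp_add]; congr 1; push_cast; ring

theorem valuation_derivation_le (hw : IsRationalPlace k w t)
    (hO : O.comap (algebraMap K L) = w) {v : Valuation L ℤᵐ⁰} (hv : v.valuationSubring = O) {e : ℕ}
    (ht : v (algebraMap K L t) = exp (-(e : ℤ))) (he : v e = 1) (hint : ∀ n : ℤ, v n ≤ 1)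
    (θ : Derivation ℤ L L) (hθt : θ (algebraMap K L t) = -algebraMap K L t)
    (hθk : ∀ a : k, θ (algebraMap K L (algebraMap k K a)) = 0)
    (hθw : ∀ c ∈ w, θ (algebraMap K L c) ∈ O) (f : L) : v (θ f) ≤ v f := by
  have := hw.isDiscreteValuationRing
  have hwO := algebraMap_subtype_mem hO
  have hmem := mem_maximalIdeal_iff hO
  have hvO (x : L) : v x ≤ 1 ↔ x ∈ O := by rw [← hv, Valuation.mem_valuationSubring_iff]
  suffices h : ∀ f ∈ O, v (θ f) ≤ 1 by
    simpa using Valuation.map_derivation_le_mul ht he hint θ hθt le_rfl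
      (fun u hu => h u ((hvO u).mp hu.le)) f
  obtain ⟨M, hM⟩ : ∃ M : ℕ, ∀ b : L, IsIntegral w b → v (θ b) ≤ exp (M : ℤ) := by
    have := IsIntegralClosure.finite w K L (integralClosure w L)
    obtain ⟨s, hs⟩ := (Module.Finite.fg_top : (⊤ : Submodule w (integralClosure w L)).FG)
    obtain ⟨M, hM⟩ : ∃ M : ℕ, ∀ b ∈ s, v (θ (b : L)) ≤ exp (M : ℤ) := by
      classical
      refine ⟨s.sup fun b => (log (v (θ (b : L)))).toNat, fun b hb => ?_⟩
      rcases eq_or_ne (v (θ (b : L))) 0 with h | h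
      · rw [h]; exact zero_le
      · rw [← exp_log h, exp_le_exp]
        refine (Int.self_le_toNat _).trans ?_
        exact_mod_cast Finset.le_sup (f := fun b => (log (v (θ ((b : integralClosure w L) : L)))).toNat) hb
    refine ⟨M, fun b hb => ?_⟩
    have hb' : (⟨b, hb⟩ : integralClosure w L) ∈ Submodule.span w (s : Set (integralClosure w L)) := by
      rw [hs]; trivial
    suffices h : ∀ c : integralClosure w L, c ∈ Submodule.span w (s : Set (integralClosure w L)) →
        v (θ (c : L)) ≤ exp (M : ℤ) from h _ hb'
    intro c hc
    induction hc using Submodule.span_induction with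
    | mem x hx => exact hM x hx
    | zero => simp
    | add x y _ _ hx hy =>
      rw [AddMemClass.coe_add, map_add]
      exact (v.map_add _ _).trans (max_le hx hy)
    | smul r x _ hx =>
      have h1 : ((r • x : integralClosure w L) : L) = algebraMap K L r * x := by
        rw [SetLike.val_smul, Algebra.smul_def]
        rfl
      rw [h1, Derivation.leibniz, smul_eq_mul, smul_eq_mul]
      refine (v.map_add _ _).trans (max_le ?_ ?_)
      · rw [map_mul]
        exact (mul_le_of_le_one_left' ((hvO _).mpr (hwO r))).trans hx
      · rw [map_mul]
        have : (1 : ℤᵐ⁰) ≤ exp (M : ℤ) := by rw [← exp_zero, exp_le_exp]; positivity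
        refine le_trans ?_ this
        exact mul_le_one' ((hvO _).mpr (ValuationSubring.mem_of_isIntegral hwO x.2)) ((hvO _).mpr (hθw r r.2))
  refine hw.valuation_derivation_le_one hO hv ht he hint θ hθt hθk M fun f hf => ?_
  obtain ⟨b, d, hb, hd, hdu, h⟩ := ValuationSubring.exists_isIntegral_mul_eq K hwO hmem hf
  have hd1 : v d = 1 := by
    refine le_antisymm ((hvO _).mpr (ValuationSubring.mem_of_isIntegral hwO hd)) ?_
    rw [← hv, Valuation.mem_nonunits_valuationSubring, not_lt] at hdu
    exact hdu
  have h2 : d * θ f = θ b - f * θ d := by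
    rw [← h, Derivation.leibniz, smul_eq_mul, smul_eq_mul]
    ring
  rw [← one_mul (v (θ f)), ← hd1, ← map_mul, h2]
  refine (v.map_sub _ _).trans (max_le (hM b hb) ?_)
  rw [map_mul]
  exact (mul_le_of_le_one_left' ((hvO _).mpr hf)).trans (hM d hd)

end IsRationalPlace

end TameDerivation

section TameTrivial

open IsDedekindDomain WithZero
open scoped Polynomial

variable {k L : Type} [Field k] [Field L] [Algebra (RatFunc k) L] [Algebra k[X] L]
  [IsScalarTower k[X] (RatFunc k) L]

lemma algebraMap_mul_derivative_div_mem_inftyPlace (f g : k[X]) (hg : g ≠ 0)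
    (h : algebraMap k[X] (RatFunc k) f / algebraMap k[X] (RatFunc k) g ∈ inftyPlace k) :
    algebraMap k[X] (RatFunc k) (Polynomial.X * Polynomial.derivative f) /
      algebraMap k[X] (RatFunc k) g ∈ inftyPlace k := by
  classical
  let := Classical.decEq (RatFunc k)
  change _ ∈ (RatFunc.inftyValuation k).valuationSubring
  change _ ∈ (RatFunc.inftyValuation k).valuationSubring at h
  rw [Valuation.mem_valuationSubring_iff] at h ⊢
  have hg' : algebraMap k[X] (RatFunc k) g ≠ 0 := by simpa using hg
  have h0 : 0 < RatFunc.inftyValuation k (algebraMap k[X] (RatFunc k) g) := by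
    rw [zero_lt_iff]; exact (Valuation.ne_zero_iff _).mpr hg'
  rw [map_div₀, div_le_one₀ h0] at h ⊢
  refine le_trans ?_ h
  rcases eq_or_ne f 0 with rfl | hf
  · simp
  rcases eq_or_ne (Polynomial.derivative f) 0 with hd | hd
  · simp [hd]
  · have hd0 : f.natDegree ≠ 0 := by
      intro h
      rw [Polynomial.eq_C_of_natDegree_eq_zero h] at hd
      simp at hd
    have hXd : Polynomial.X * Polynomial.derivative f ≠ 0 := mul_ne_zero Polynomial.X_ne_zero hd
    rw [RatFunc.inftyValuation_apply, RatFunc.inftyValuation_apply, RatFunc.inftyValuation.polynomial _ hf, RatFunc.inftyValuation.polynomial _ hXd, exp_le_exp]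
    rw [Polynomial.natDegree_X_mul hd]
    have := Polynomial.natDegree_derivative_lt hd0
    omega

lemma derivation_mem_of_mem_inftyPlace {O : ValuationSubring L}
    (hO : O.comap (algebraMap (RatFunc k) L) = inftyPlace k) (D : Derivation ℤ L L)
    (hD : ∀ f : k[X], D (algebraMap k[X] L f) = algebraMap k[X] L (Polynomial.derivative f))
    (c : RatFunc k) (hc : c ∈ inftyPlace k) :
    algebraMap k[X] L Polynomial.X * D (algebraMap (RatFunc k) L c) ∈ O := by
  obtain ⟨f, g, hg, hcdef⟩ := IsFractionRing.div_surjective (A := k[X]) c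
  have hg0 : g ≠ 0 := nonZeroDivisors.ne_zero hg
  have hg' : algebraMap k[X] (RatFunc k) g ≠ 0 := by simpa using hg0
  have hcg : algebraMap (RatFunc k) L c * algebraMap k[X] L g = algebraMap k[X] L f := by
    rw [IsScalarTower.algebraMap_apply k[X] (RatFunc k) L, ← map_mul, ← hcdef, div_mul_cancel₀ _ hg',
      ← IsScalarTower.algebraMap_apply]
  have h1 := congrArg D hcg
  rw [Derivation.leibniz, hD, hD, smul_eq_mul, smul_eq_mul] at h1
  have hgL : algebraMap k[X] L g ≠ 0 := by
    rw [IsScalarTower.algebraMap_apply k[X] (RatFunc k) L]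
    simpa using hg0
  have h2 : algebraMap k[X] L Polynomial.X * D (algebraMap (RatFunc k) L c) =
      algebraMap (RatFunc k) L (algebraMap k[X] (RatFunc k) (Polynomial.X * Polynomial.derivative f) /
        algebraMap k[X] (RatFunc k) g - c * (algebraMap k[X] (RatFunc k) (Polynomial.X * Polynomial.derivative g) /
        algebraMap k[X] (RatFunc k) g)) := by
    have hq (q : k[X]) : algebraMap (RatFunc k) L (algebraMap k[X] (RatFunc k) q) =
        algebraMap k[X] L q := (IsScalarTower.algebraMap_apply ..).symm
    simp only [map_sub, map_mul, map_div₀, hq]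
    field_simp
    linear_combination (algebraMap k[X] L Polynomial.X) * h1
  rw [h2, ValuationSubring.algebraMap_mem_iff hO]
  refine sub_mem (algebraMap_mul_derivative_div_mem_inftyPlace f g hg0 (hcdef ▸ hc)) (mul_mem hc ?_)
  refine algebraMap_mul_derivative_div_mem_inftyPlace g g hg0 ?_
  rw [div_self hg']
  exact one_mem _

variable [IsAlgClosed k] [FiniteDimensional (RatFunc k) L] [IsGalois (RatFunc k) L]

theorem valuation_mul_derivation_le {O : ValuationSubring L}
    (hO : O.comap (algebraMap (RatFunc k) L) = inftyPlace k) {v : Valuation L ℤᵐ⁰}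
    (hv : v.valuationSubring = O) {e : ℕ} (he : (e : k) ≠ 0)
    (ht : v (algebraMap (RatFunc k) L RatFunc.X⁻¹) = exp (-(e : ℤ))) (D : Derivation ℤ L L)
    (hD : ∀ f : k[X], D (algebraMap k[X] L f) = algebraMap k[X] L (Polynomial.derivative f)) (f : L) :
    v (D f) * v (algebraMap k[X] L Polynomial.X) ≤ v f := by
  have hw := isRationalPlace_inftyPlace k
  have hvO (x : L) : v x ≤ 1 ↔ x ∈ O := by rw [← hv, Valuation.mem_valuationSubring_iff]
  have hX : algebraMap (RatFunc k) L RatFunc.X = algebraMap k[X] L Polynomial.X := by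
    rw [IsScalarTower.algebraMap_apply k[X] (RatFunc k) L, RatFunc.algebraMap_X]
  have hX0 : algebraMap k[X] L Polynomial.X ≠ 0 := by
    rw [← hX]
    exact (map_ne_zero _).mpr RatFunc.X_ne_zero
  have hc (a : k) : algebraMap (RatFunc k) L (algebraMap k (RatFunc k) a) = algebraMap k[X] L (Polynomial.C a) := by
    rw [IsScalarTower.algebraMap_apply k k[X] (RatFunc k), ← IsScalarTower.algebraMap_apply k[X] (RatFunc k) L]
    rfl
  have hDX : D (algebraMap k[X] L Polynomial.X) = 1 := by
    rw [hD]
    simp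
  have := hw.valuation_derivation_le hO hv ht ?_ ?_ (algebraMap k[X] L Polynomial.X • D) ?_ ?_
    (derivation_mem_of_mem_inftyPlace hO D hD) f
  · rwa [Derivation.smul_apply, smul_eq_mul, mul_comm, map_mul] at this
  · have h1 : ((e : ℕ) : L) = algebraMap (RatFunc k) L (algebraMap k (RatFunc k) e) := by simp
    rw [h1]
    refine le_antisymm ((hvO _).mpr (hw.algebraMap_algebraMap_mem hO _)) ?_
    have := hw.algebraMap_notMem_nonunits hO he
    rwa [← hv, Valuation.mem_nonunits_valuationSubring, not_lt] at this
  · intro n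
    exact (hvO _).mpr (intCast_mem _ n)
  · rw [Derivation.smul_apply, map_inv₀, hX, Derivation.leibniz_inv, hDX, smul_eq_mul, smul_eq_mul]
    field_simp
  · intro a
    rw [Derivation.smul_apply, hc, hD]
    simp

end TameTrivial

section TameTrivial

open IsDedekindDomain WithZero
open scoped Polynomial

variable {k L : Type} [Field k] [Field L] [Algebra k[X] L]

theorem exists_eq_sum_pow_mul_X_pow {p : ℕ} [Fact p.Prime] [CharP k p] [IsAlgClosed k]
    [Algebra (RatFunc k) L] [IsScalarTower k[X] (RatFunc k) L]
    [FiniteDimensional (RatFunc k) L] [Algebra.IsSeparable (RatFunc k) L] (f : L) :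
    ∃ g : ℕ → L, f = ∑ i ∈ Finset.range p, g i ^ p * algebraMap k[X] L Polynomial.X ^ i := by
  have hp : p.Prime := Fact.out
  have : CharP (RatFunc k) p := charP_of_injective_algebraMap (algebraMap k (RatFunc k)).injective p
  have : CharP L p := charP_of_injective_algebraMap (algebraMap (RatFunc k) L).injective p
  let S : Set L := {f | ∃ g : ℕ → L,
    f = ∑ i ∈ Finset.range p, g i ^ p * algebraMap k[X] L Polynomial.X ^ i}
  have hadd : ∀ a ∈ S, ∀ b ∈ S, a + b ∈ S := by
    rintro _ ⟨g, rfl⟩ _ ⟨h, rfl⟩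
    refine ⟨g + h, ?_⟩
    rw [← Finset.sum_add_distrib]
    refine Finset.sum_congr rfl fun i _ => ?_
    rw [Pi.add_apply, add_pow_char, add_mul]
  have hmul : ∀ c : L, ∀ a ∈ S, c ^ p * a ∈ S := by
    rintro c _ ⟨g, rfl⟩
    refine ⟨fun i => c * g i, ?_⟩
    rw [Finset.mul_sum]
    refine Finset.sum_congr rfl fun i _ => ?_
    rw [mul_pow, mul_assoc]
  have hzero : (0 : L) ∈ S := ⟨0, by simp [hp.ne_zero]⟩
  have hsum {ι : Type} (s : Finset ι) (F : ι → L) (h : ∀ i ∈ s, F i ∈ S) : ∑ i ∈ s, F i ∈ S :=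
    Finset.sum_induction F (· ∈ S) (fun a b ha hb => hadd a ha b hb) hzero h
  have hXlt (i : ℕ) (hi : i < p) : algebraMap k[X] L Polynomial.X ^ i ∈ S := by
    refine ⟨fun j => if j = i then 1 else 0, ?_⟩
    rw [Finset.sum_eq_single i]
    · simp
    · intro j _ hj
      simp [hj, hp.ne_zero]
    · intro h
      exact absurd (Finset.mem_range.mpr hi) h
  have hX (n : ℕ) : algebraMap k[X] L Polynomial.X ^ n ∈ S := by
    rw [← Nat.div_add_mod n p, pow_add, mul_comm p, pow_mul]
    exact hmul _ _ (hXlt _ (Nat.mod_lt _ hp.pos))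
  have hpoly (q : k[X]) : algebraMap k[X] L q ∈ S := by
    rw [q.as_sum_range_C_mul_X_pow, map_sum]
    refine hsum _ _ fun i _ => ?_
    obtain ⟨c, hc⟩ := IsAlgClosed.exists_pow_nat_eq (q.coeff i) hp.pos
    rw [← hc, map_mul, map_pow, map_pow, map_pow]
    exact hmul _ _ (hX i)
  have hrat (c : RatFunc k) : algebraMap (RatFunc k) L c ∈ S := by
    obtain ⟨a, b, hb, rfl⟩ := IsFractionRing.div_surjective (A := k[X]) c
    have hb' : algebraMap k[X] L b ≠ 0 := by
      rw [IsScalarTower.algebraMap_apply k[X] (RatFunc k) L]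
      simpa using nonZeroDivisors.ne_zero hb
    rw [map_div₀, ← IsScalarTower.algebraMap_apply, ← IsScalarTower.algebraMap_apply]
    have : algebraMap k[X] L a / algebraMap k[X] L b =
        ((algebraMap k[X] L b)⁻¹) ^ p * algebraMap k[X] L (a * b ^ (p - 1)) := by
      rw [map_mul, map_pow, inv_pow]
      obtain ⟨q, rfl⟩ := Nat.exists_eq_succ_of_ne_zero hp.ne_zero
      rw [Nat.succ_eq_add_one, Nat.add_sub_cancel]
      field_simp
      ring
    rw [this]
    exact hmul _ _ (hpoly _)
  let b := (Module.finBasis (RatFunc k) L).mapPowExpCharPowOfIsSeparable p 1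
  have hb (i) : b i = Module.finBasis (RatFunc k) L i ^ p := by
    simp [b, Module.Basis.mapPowExpCharPowOfIsSeparable]
  rw [← b.sum_repr f]
  refine hsum _ _ fun i _ => ?_
  rw [hb, Algebra.smul_def, mul_comm]
  exact hmul _ _ (hrat _)

lemma Derivation.iterate_pow_mul_algebraMap {p : ℕ} [CharP L p] (D : Derivation ℤ L L)
    (hD : ∀ f : k[X], D (algebraMap k[X] L f) = algebraMap k[X] L (Polynomial.derivative f))
    (g : L) (q : k[X]) (j : ℕ) : D^[j] (g ^ p * algebraMap k[X] L q) =
      g ^ p * algebraMap k[X] L (Polynomial.derivative^[j] q) := by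
  induction j generalizing q with
  | zero => rfl
  | succ j ih =>
    rw [Function.iterate_succ_apply, Function.iterate_succ_apply, Derivation.leibniz,
      Derivation.leibniz_pow, hD, ← ih]
    simp

lemma Derivation.iterate_sum_pow_mul_X_pow {p : ℕ} [CharP L p] (D : Derivation ℤ L L)
    (hD : ∀ f : k[X], D (algebraMap k[X] L f) = algebraMap k[X] L (Polynomial.derivative f))
    (g : ℕ → L) (j : ℕ) :
    D^[j] (∑ i ∈ Finset.range (j + 1), g i ^ p * algebraMap k[X] L Polynomial.X ^ i) =
      g j ^ p * (j.factorial : ℕ) := by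
  have hsum (s : Finset ℕ) (F : ℕ → L) : D^[j] (∑ i ∈ s, F i) = ∑ i ∈ s, D^[j] (F i) := by
    have h (x : L) : D^[j] x = ((D : L →ₗ[ℤ] L) ^ j) x := by
      rw [Module.End.pow_apply]
      rfl
    simp only [h, map_sum]
  rw [hsum, Finset.sum_range_succ, Finset.sum_eq_zero, zero_add]
  · rw [← map_pow, iterate_pow_mul_algebraMap D hD, Polynomial.iterate_derivative_X_pow_eq_natCast_mul]
    simp [Nat.descFactorial_self]
  · intro i hi
    rw [← map_pow, iterate_pow_mul_algebraMap D hD, Polynomial.iterate_derivative_X_pow_eq_natCast_mul,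
      Nat.descFactorial_of_lt (Finset.mem_range.mp hi)]
    simp

end TameTrivial

section TameTrivial

open IsDedekindDomain WithZero
open scoped Polynomial Pointwise

variable {k L : Type} [Field k] [Field L] [Algebra (RatFunc k) L] [Algebra k[X] L]
  [IsScalarTower k[X] (RatFunc k) L]
  [IsAlgClosed k] [FiniteDimensional (RatFunc k) L] [IsGalois (RatFunc k) L]

lemma exists_algebraMap_eq_of_bounded {O : ValuationSubring L}
    (hO : O.comap (algebraMap (RatFunc k) L) = inftyPlace k)
    {f : L} (hf : IsIntegral k[X] f) (hfO : ∀ σ : L ≃ₐ[RatFunc k] L, σ f ∈ O) :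
    ∃ q : k[X], f = algebraMap k[X] L q := by
  have hw := isRationalPlace_inftyPlace k
  obtain ⟨a, ha⟩ := hw.exists_sub_mem_nonunits hO (hfO 1)
  refine ⟨Polynomial.C a, ?_⟩
  have hC : algebraMap (RatFunc k) L (algebraMap k (RatFunc k) a) = algebraMap k[X] L (Polynomial.C a) := by
    rw [IsScalarTower.algebraMap_apply k k[X] (RatFunc k), ← IsScalarTower.algebraMap_apply k[X] (RatFunc k) L]
    rfl
  have hint : IsIntegral k[X] (f - algebraMap k[X] L (Polynomial.C a)) := hf.sub isIntegral_algebraMap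
  have hN := Algebra.isIntegral_norm (RatFunc k) hint
  obtain ⟨q, hq⟩ := IsIntegrallyClosed.isIntegral_iff.mp hN
  have hprod := Algebra.norm_eq_prod_automorphisms (RatFunc k) (f - algebraMap k[X] L (Polynomial.C a))
  have hσ (σ : L ≃ₐ[RatFunc k] L) : σ (f - algebraMap k[X] L (Polynomial.C a)) =
      σ f - algebraMap k[X] L (Polynomial.C a) := by
    rw [map_sub, ← hC, AlgEquiv.commutes]
  have hmem : algebraMap (RatFunc k) L (algebraMap k[X] (RatFunc k) q) ∈ O.nonunits := by
    classical
    rw [hq, hprod, ← Finset.prod_erase_mul _ _ (Finset.mem_univ (1 : L ≃ₐ[RatFunc k] L))]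
    refine ValuationSubring.mul_mem_nonunits (prod_mem fun σ _ => ?_) ?_
    · rw [hσ, ← hC]
      exact sub_mem (hfO σ) (hw.algebraMap_algebraMap_mem hO a)
    · rw [hσ, ← hC]
      exact ha
  rw [ValuationSubring.algebraMap_mem_nonunits_iff hO] at hmem
  have hq0 : q = 0 := by
    by_contra hq0
    let := Classical.decEq (RatFunc k)
    change _ ∈ (RatFunc.inftyValuation k).valuationSubring.nonunits at hmem
    rw [Valuation.mem_nonunits_valuationSubring, RatFunc.inftyValuation_apply,
      RatFunc.inftyValuation.polynomial _ hq0, ← exp_zero, exp_lt_exp] at hmem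
    omega
  rw [hq0, map_zero, eq_comm, Algebra.norm_eq_zero_iff] at hq
  exact sub_eq_zero.mp hq

theorem eq_one_of_not_dvd_card_stabilizer [Algebra.Etale k[X] (integralClosure k[X] L)] {p : ℕ}
    (hp : p.Prime) [CharP k p] {O : ValuationSubring L}
    (hO : O.comap (algebraMap (RatFunc k) L) = inftyPlace k)
    (h : ¬ p ∣ Nat.card (MulAction.stabilizer (L ≃ₐ[RatFunc k] L) O)) (σ : L ≃ₐ[RatFunc k] L) :
    σ = 1 := by
  have : Fact p.Prime := ⟨hp⟩
  have : CharP (RatFunc k) p := charP_of_injective_algebraMap (algebraMap k (RatFunc k)).injective p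
  have : CharP L p := charP_of_injective_algebraMap (algebraMap (RatFunc k) L).injective p
  have hw := isRationalPlace_inftyPlace k
  obtain ⟨v, hv, -, ht⟩ := hw.exists_valuation hO
  obtain ⟨D, hD, hDint⟩ := exists_derivation (k := k) (L := L)
  set e := Nat.card (MulAction.stabilizer (L ≃ₐ[RatFunc k] L) O)
  have he : (e : k) ≠ 0 := by rwa [Ne, CharP.cast_eq_zero_iff k p]
  have hvO (x : L) : v x ≤ 1 ↔ x ∈ O := by rw [← hv, Valuation.mem_valuationSubring_iff]
  have hpoly (σ : L ≃ₐ[RatFunc k] L) (q : k[X]) : σ (algebraMap k[X] L q) = algebraMap k[X] L q := by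
    rw [IsScalarTower.algebraMap_apply k[X] (RatFunc k) L, AlgEquiv.commutes]
  have hX : 1 ≤ v (algebraMap k[X] L Polynomial.X) := by
    rw [IsScalarTower.algebraMap_apply k[X] (RatFunc k) L, RatFunc.algebraMap_X,
      ← inv_inv (RatFunc.X), map_inv₀, map_inv₀, ht, ← exp_neg, ← exp_zero, exp_le_exp]
    simp
  have hC (a : k) : v (algebraMap k[X] L (Polynomial.C a)) ≤ 1 := by
    rw [hvO]
    have := hw.algebraMap_algebraMap_mem hO a
    rwa [IsScalarTower.algebraMap_apply k k[X] (RatFunc k),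
      ← IsScalarTower.algebraMap_apply k[X] (RatFunc k) L] at this
  have hvD (σ : L ≃ₐ[RatFunc k] L) (f : L) :
      v (σ (D f)) * v (algebraMap k[X] L Polynomial.X) ≤ v (σ f) := by
    have h1 := valuation_mul_derivation_le (v := v.comap (σ : L →+* L))
      (O := (v.comap (σ : L →+* L)).valuationSubring) ?_ rfl he ?_ D hD f
    · rw [Valuation.comap_apply, Valuation.comap_apply, Valuation.comap_apply] at h1
      have h2 : v (σ (algebraMap k[X] L Polynomial.X)) = v (algebraMap k[X] L Polynomial.X) := by
        rw [hpoly]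
      rw [← h2]
      exact h1
    · ext x
      rw [← hO, ValuationSubring.mem_comap, ValuationSubring.mem_comap,
        Valuation.mem_valuationSubring_iff, Valuation.comap_apply, ← hvO]
      change v (σ _) ≤ 1 ↔ _
      rw [AlgEquiv.commutes]
    · change v (σ _) = _
      rw [AlgEquiv.commutes, ht]
  have hvDj (σ : L ≃ₐ[RatFunc k] L) (j : ℕ) (f : L) :
      v (σ (D^[j] f)) * v (algebraMap k[X] L Polynomial.X) ^ j ≤ v (σ f) := by
    induction j generalizing f with
    | zero => simp
    | succ j ih =>
      rw [Function.iterate_succ_apply, pow_succ, ← mul_assoc]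
      exact (mul_le_mul_left (ih (D f)) _).trans (hvD σ f)
  have hDj (j : ℕ) (f : L) (hf : IsIntegral k[X] f) : IsIntegral k[X] (D^[j] f) := by
    induction j generalizing f with
    | zero => exact hf
    | succ j ih => exact ih _ (hDint f hf)
  have hmain (N : ℕ) : ∀ f : L, IsIntegral k[X] f → (∀ σ : L ≃ₐ[RatFunc k] L, v (σ f) ≤ exp (N : ℤ)) →
      ∃ q : k[X], f = algebraMap k[X] L q := by
    induction N with
    | zero =>
      intro f hf hb
      refine exists_algebraMap_eq_of_bounded hO hf fun σ => ?_
      rw [← hvO]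
      exact hb σ
    | succ N ih =>
      intro f hf hb
      obtain ⟨g, hg⟩ := exists_eq_sum_pow_mul_X_pow (k := k) (p := p) f
      suffices H : ∀ j ≤ p, ∀ f : L, IsIntegral k[X] f →
          (∀ σ : L ≃ₐ[RatFunc k] L, v (σ f) ≤ exp ((N + 1 : ℕ) : ℤ)) →
          f = ∑ i ∈ Finset.range j, g i ^ p * algebraMap k[X] L Polynomial.X ^ i →
          ∃ q : k[X], f = algebraMap k[X] L q from H p le_rfl f hf hb hg
      intro j
      induction j with
      | zero =>
        intro _ f _ _ hfg
        exact ⟨0, by simpa using hfg⟩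
      | succ j ihj =>
        intro hj f hf hb hfg
        have h1 : g j ^ p * (j.factorial : ℕ) = D^[j] f := by
          rw [hfg, Derivation.iterate_sum_pow_mul_X_pow D hD]
        have hfac : (j.factorial : k) ≠ 0 := by
          rw [Ne, CharP.cast_eq_zero_iff k p, hp.dvd_factorial]
          omega
        have h2 : g j ^ p = algebraMap k[X] L (Polynomial.C (j.factorial : k)⁻¹) * D^[j] f := by
          rw [← h1, mul_left_comm, ← map_natCast (algebraMap k[X] L), ← map_natCast Polynomial.C,
            ← map_mul, ← map_mul, inv_mul_cancel₀ hfac]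
          simp
        have hgint : IsIntegral k[X] (g j) := by
          refine IsIntegral.of_pow hp.pos ?_
          rw [h2]
          exact isIntegral_algebraMap.mul (hDj j f hf)
        have h3 (σ : L ≃ₐ[RatFunc k] L) :
            v (σ (g j ^ p)) * v (algebraMap k[X] L Polynomial.X) ^ j ≤ v (σ f) := by
          refine le_trans ?_ (hvDj σ j f)
          gcongr
          rw [h2, map_mul, hpoly, map_mul]
          exact mul_le_of_le_one_left' (hC _)
        obtain ⟨q, hq⟩ := ih (g j) hgint fun σ => by
          have h4 : v (σ (g j)) ^ p ≤ exp ((N + 1 : ℕ) : ℤ) := by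
            rw [← map_pow, ← map_pow]
            exact (le_mul_of_one_le_right' (one_le_pow₀ hX)).trans ((h3 σ).trans (hb σ))
          rcases eq_or_ne (v (σ (g j))) 0 with h0 | h0
          · rw [h0]
            exact zero_le
          · rw [← exp_log h0] at h4 ⊢
            rw [← exp_nsmul, exp_le_exp, nsmul_eq_mul] at h4
            rw [exp_le_exp]
            have := hp.two_le
            by_contra! hlt
            push_cast at h4
            nlinarith
        obtain ⟨q', hq'⟩ := ihj (by omega) (f - g j ^ p * algebraMap k[X] L Polynomial.X ^ j)
          (hf.sub ((hgint.pow p).mul (isIntegral_algebraMap.pow j))) (fun σ => by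
            rw [map_sub]
            refine (v.map_sub _ _).trans (max_le (hb σ) ?_)
            rw [map_mul, map_mul, map_pow σ (algebraMap k[X] L Polynomial.X), hpoly, map_pow v (algebraMap k[X] L Polynomial.X)]
            exact (h3 σ).trans (hb σ))
          (by rw [hfg, Finset.sum_range_succ, add_sub_cancel_right])
        refine ⟨q' + q ^ p * Polynomial.X ^ j, ?_⟩
        rw [map_add, ← hq', map_mul, map_pow, map_pow, ← hq, sub_add_cancel]
  have hB (f : L) (hf : IsIntegral k[X] f) : ∃ q : k[X], f = algebraMap k[X] L q := by
    refine hmain (Finset.univ.sup fun σ : L ≃ₐ[RatFunc k] L => (log (v (σ f))).toNat) f hf fun σ => ?_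
    rcases eq_or_ne (v (σ f)) 0 with h | h
    · rw [h]; exact zero_le
    · rw [← exp_log h, exp_le_exp]
      refine (Int.self_le_toNat _).trans ?_
      exact_mod_cast Finset.le_sup (f := fun σ : L ≃ₐ[RatFunc k] L => (log (v (σ f))).toNat)
        (Finset.mem_univ σ)
  have := IsIntegralClosure.isFractionRing_of_finite_extension k[X] (RatFunc k) L (integralClosure k[X] L)
  ext f
  obtain ⟨a, b, -, rfl⟩ := IsFractionRing.div_surjective (A := integralClosure k[X] L) f
  obtain ⟨q, hq⟩ := hB a a.2
  obtain ⟨r, hr⟩ := hB b b.2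
  change σ ((a : L) / (b : L)) = (a : L) / (b : L)
  rw [hq, hr, map_div₀, hpoly, hpoly]

end TameTrivial

section AdditiveRoots

open scoped Polynomial

lemma ZMod.exists_cast_eq_of_pow_eq {p : ℕ} [Fact p.Prime] {M : Type*} [Field M] [CharP M p] {z : M}
    (hz : z ^ p = z) : ∃ c : ZMod p, ZMod.castHom (dvd_refl p) M c = z := by
  classical
  have hp : p.Prime := Fact.out
  have hne : (Polynomial.X ^ p - Polynomial.X : M[X]) ≠ 0 :=
    FiniteField.X_pow_card_sub_X_ne_zero M hp.one_lt
  have hsub : Finset.univ.image (ZMod.castHom (dvd_refl p) M) ⊆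
      (Polynomial.X ^ p - Polynomial.X : M[X]).roots.toFinset := by
    intro y hy
    obtain ⟨c, -, rfl⟩ := Finset.mem_image.mp hy
    rw [Multiset.mem_toFinset, Polynomial.mem_roots hne, Polynomial.IsRoot.def, Polynomial.eval_sub,
      Polynomial.eval_pow, Polynomial.eval_X, ← map_pow, ZMod.pow_card, sub_self]
  have hcard : (Polynomial.X ^ p - Polynomial.X : M[X]).roots.toFinset.card ≤
      (Finset.univ.image (ZMod.castHom (dvd_refl p) M)).card := by
    rw [Finset.card_image_of_injective _ (ZMod.castHom (dvd_refl p) M).injective, Finset.card_univ,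
      ZMod.card]
    exact (Multiset.toFinset_card_le _).trans ((Polynomial.card_roots' _).trans
      (FiniteField.X_pow_card_sub_X_natDegree_eq M hp.one_lt).le)
  have hmem : z ∈ (Polynomial.X ^ p - Polynomial.X : M[X]).roots.toFinset := by
    rw [Multiset.mem_toFinset, Polynomial.mem_roots hne]
    simp [hz]
  rw [← Finset.eq_of_subset_of_card_le hsub hcard] at hmem
  obtain ⟨c, -, hc⟩ := Finset.mem_image.mp hmem
  exact ⟨c, hc⟩

lemma ZMod.exists_cast_mul_eq_of_pow_eq {p : ℕ} [Fact p.Prime] {M : Type*} [Field M] [CharP M p]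
    {x y : M} (hx : x ≠ 0) (h : x ^ (p - 1) = y ^ (p - 1)) :
    ∃ c : ZMod p, c ≠ 0 ∧ y = ZMod.castHom (dvd_refl p) M c * x := by
  have hp : p.Prime := Fact.out
  have hy : y ≠ 0 := by
    rintro rfl
    rw [zero_pow (by have := hp.two_le; omega)] at h
    exact pow_ne_zero _ hx h
  have hz : (y / x) ^ p = y / x := by
    obtain ⟨q, hq⟩ : ∃ q, p = q + 1 := ⟨p - 1, by have := hp.pos; omega⟩
    rw [hq, Nat.add_sub_cancel] at h
    rw [hq, pow_succ, div_pow, h, div_self (pow_ne_zero _ hy), one_mul]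
  obtain ⟨c, hc⟩ := exists_cast_eq_of_pow_eq hz
  refine ⟨c, ?_, by rw [hc, div_mul_cancel₀ _ hx]⟩
  rintro rfl
  rw [map_zero, eq_comm, div_eq_zero_iff] at hc
  tauto

lemma ZMod.castHom_pow_card {p : ℕ} [Fact p.Prime] {M : Type*} [Field M] [CharP M p] (c : ZMod p) :
    ZMod.castHom (dvd_refl p) M c ^ p = ZMod.castHom (dvd_refl p) M c := by
  rw [← map_pow, ZMod.pow_card]

/-- The roots of the additive polynomial `U ^ p ^ 2 - T * U ^ p + U`. -/
def additiveRoots (p : ℕ) [Fact p.Prime] {M : Type*} [Field M] [CharP M p] (T : M) :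
    AddSubgroup M where
  carrier := {u | (u ^ p) ^ p - T * u ^ p + u = 0}
  zero_mem' := by
    have hp : p.Prime := Fact.out
    simp [hp.ne_zero]
  add_mem' {a b} ha hb := by
    rw [Set.mem_ofPred_eq] at *
    rw [add_pow_char, add_pow_char]
    linear_combination ha + hb
  neg_mem' {a} ha := by
    rw [Set.mem_ofPred_eq] at *
    have hneg (b : M) : (-b) ^ p = -b ^ p := map_neg (frobenius M p) b
    rw [hneg, hneg]
    linear_combination -ha

/-- The Moore determinant `x * y ^ p - x ^ p * y`. -/
def mooreDet (p : ℕ) {M : Type*} [Field M] (x y : M) : M := x * y ^ p - x ^ p * y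

/-- Cramer's rule for Moore determinants. -/
lemma mooreDet_mul {p : ℕ} {M : Type*} [Field M] (x y u : M) :
    mooreDet p x y * u = mooreDet p u y * x + mooreDet p x u * y := by
  simp only [mooreDet]
  ring

lemma mooreDet_self {p : ℕ} {M : Type*} [Field M] (x : M) : mooreDet p x x = 0 := by
  simp only [mooreDet]
  ring

lemma map_mooreDet {p : ℕ} {M : Type*} [Field M] {F : Type*} [FunLike F M M] [RingHomClass F M M] (σ : F) (x y : M) :
    σ (mooreDet p x y) = mooreDet p (σ x) (σ y) := by
  simp only [mooreDet, map_sub, map_mul, map_pow]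

lemma map_castHom {p : ℕ} {M : Type*} [Field M] [CharP M p] {F : Type*} [FunLike F M M] [RingHomClass F M M] (σ : F) (c : ZMod p) :
    σ (ZMod.castHom (dvd_refl p) M c) = ZMod.castHom (dvd_refl p) M c :=
  RingHom.congr_fun (Subsingleton.elim ((σ : M →+* M).comp (ZMod.castHom (dvd_refl p) M))
    (ZMod.castHom (dvd_refl p) M)) c

variable {p : ℕ} [Fact p.Prime] {M : Type*} [Field M] [CharP M p] {T x y : M}

lemma mem_additiveRoots {u : M} : u ∈ additiveRoots p T ↔ (u ^ p) ^ p - T * u ^ p + u = 0 := Iff.rfl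

lemma castHom_mul_mem_additiveRoots (c : ZMod p) (hx : x ∈ additiveRoots p T) :
    ZMod.castHom (dvd_refl p) M c * x ∈ additiveRoots p T := by
  rw [mem_additiveRoots] at *
  rw [mul_pow, ZMod.castHom_pow_card, mul_pow, ZMod.castHom_pow_card]
  linear_combination ZMod.castHom (dvd_refl p) M c * hx

lemma exists_castHom_eq_mooreDet (hx : x ∈ additiveRoots p T) (hy : y ∈ additiveRoots p T) :
    ∃ c : ZMod p, ZMod.castHom (dvd_refl p) M c = mooreDet p x y := by
  refine ZMod.exists_cast_eq_of_pow_eq ?_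
  rw [mem_additiveRoots] at *
  rw [mooreDet, sub_pow_char, mul_pow, mul_pow]
  linear_combination x ^ p * hy - y ^ p * hx

lemma mooreDet_add_right (x y u : M) : mooreDet p x (y + u) = mooreDet p x y + mooreDet p x u := by
  simp only [mooreDet, add_pow_char]
  ring

lemma mooreDet_castHom_mul_right (c : ZMod p) (x y : M) :
    mooreDet p x (ZMod.castHom (dvd_refl p) M c * y) = ZMod.castHom (dvd_refl p) M c * mooreDet p x y := by
  simp only [mooreDet, mul_pow, ZMod.castHom_pow_card]
  ring

lemma mooreDet_castHom_mul_left (c : ZMod p) (x y : M) :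
    mooreDet p (ZMod.castHom (dvd_refl p) M c * x) y = ZMod.castHom (dvd_refl p) M c * mooreDet p x y := by
  simp only [mooreDet, mul_pow, ZMod.castHom_pow_card]
  ring

/-- Roots with Moore determinant `0` are proportional. -/
lemma exists_eq_castHom_mul_of_mooreDet_eq_zero (hx : x ≠ 0) (h : mooreDet p x y = 0) :
    ∃ c : ZMod p, y = ZMod.castHom (dvd_refl p) M c * x := by
  have hp : p.Prime := Fact.out
  have hz : (y / x) ^ p = y / x := by
    rw [div_pow, div_eq_div_iff (pow_ne_zero _ hx) hx]
    rw [mooreDet] at h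
    linear_combination h
  obtain ⟨c, hc⟩ := ZMod.exists_cast_eq_of_pow_eq hz
  exact ⟨c, by rw [hc, div_mul_cancel₀ _ hx]⟩

lemma pow_pred_mul_eq (hx : x ≠ 0) (h : x ∈ additiveRoots p T) :
    x ^ (p - 1) * (T - (x ^ (p - 1)) ^ p) = 1 := by
  obtain ⟨q, hq⟩ : ∃ q, p = q + 1 := ⟨p - 1, by have := (Fact.out : p.Prime).pos; omega⟩
  rw [mem_additiveRoots] at h
  rw [← mul_left_inj' hx]
  have h1 : x ^ p = x ^ (p - 1) * x := by rw [hq, Nat.add_sub_cancel, pow_succ]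
  have h2 : (x ^ p) ^ p = (x ^ (p - 1)) ^ p * (x ^ (p - 1) * x) := by rw [← h1, h1, mul_pow, ← h1]
  rw [h2, h1] at h
  linear_combination -h

lemma pow_pred_sub_identity {W d : M} (h : W * (T - W ^ p) = 1) (hd : d ≠ 0)
    (h' : (W + d) * (T - (W + d) ^ p) = 1) : d * (d ^ (p - 2) * W ^ 2 + d ^ (p - 1) * W) = 1 := by
  obtain ⟨q, hq⟩ : ∃ q, p = q + 2 := ⟨p - 2, by have := (Fact.out : p.Prime).two_le; omega⟩
  rw [add_pow_char] at h'
  have h3 : T - W ^ p - d ^ (p - 1) * W - d ^ p = 0 := by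
    rw [← mul_right_inj' hd, mul_zero]
    have : d * d ^ (p - 1) = d ^ p := by
      rw [← pow_succ', Nat.sub_add_cancel (Fact.out : p.Prime).one_le]
    linear_combination h' - h + this * (- W)
  subst hq
  simp only [Nat.add_sub_cancel, show q + 2 - 1 = q + 1 from rfl, pow_succ] at *
  linear_combination h - W * h3

end AdditiveRoots

section MooreSplitting

open scoped Polynomial

/-- The additive polynomial `X ^ p ^ 2 - T * X ^ p + X`. -/
noncomputable def additivePoly (p : ℕ) {K : Type*} [Field K] (T : K) : K[X] :=
  (Polynomial.X ^ p) ^ p - Polynomial.C T * Polynomial.X ^ p + Polynomial.X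

section

variable {p : ℕ} [Fact p.Prime] {K : Type*} [Field K] (T : K)

lemma natDegree_additivePoly : (additivePoly p T).natDegree = p * p := by
  have hp : p.Prime := Fact.out
  have h1 : p < p * p := by nlinarith [hp.two_le]
  rw [additivePoly, sub_add, ← pow_mul, Polynomial.natDegree_sub_eq_left_of_natDegree_lt,
    Polynomial.natDegree_X_pow]
  rw [Polynomial.natDegree_X_pow]
  refine (Polynomial.natDegree_sub_le _ _).trans_lt (max_lt ?_ ?_)
  · exact (Polynomial.natDegree_C_mul_X_pow_le _ _).trans_lt h1
  · rw [Polynomial.natDegree_X]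
    exact hp.one_lt.trans h1

lemma additivePoly_ne_zero : additivePoly p T ≠ 0 := by
  have hp : p.Prime := Fact.out
  intro h
  have := natDegree_additivePoly (p := p) T
  rw [h, Polynomial.natDegree_zero] at this
  exact (Nat.mul_pos hp.pos hp.pos).ne this

lemma separable_additivePoly [CharP K p] : (additivePoly p T).Separable := by
  have : Polynomial.derivative (additivePoly p T) = 1 := by
    simp [additivePoly, ← pow_mul, Polynomial.derivative_X_pow]
  rw [Polynomial.Separable, this]
  exact isCoprime_one_right

variable {M : Type*} [Field M] [CharP M p] [Algebra K M]

lemma mem_rootSet_additivePoly {u : M} :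
    u ∈ (additivePoly p T).rootSet M ↔ u ∈ additiveRoots p (algebraMap K M T) := by
  rw [Polynomial.mem_rootSet, mem_additiveRoots, and_iff_right (additivePoly_ne_zero T)]
  simp [additivePoly]

end

lemma exists_mooreDet_eq_one (p : ℕ) [Fact p.Prime] {K : Type} [Field K] [CharP K p] (T : K) :
    ∃ (M : Type) (_ : Field M) (_ : CharP M p) (_ : Algebra K M), FiniteDimensional K M ∧ IsGalois K M ∧
      (∀ σ : M ≃ₐ[K] M, (∀ u ∈ additiveRoots p (algebraMap K M T), σ u = u) → σ = 1) ∧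
      ∃ x ∈ additiveRoots p (algebraMap K M T), ∃ y ∈ additiveRoots p (algebraMap K M T),
        mooreDet p x y = 1 := by
  classical
  have hp : p.Prime := Fact.out
  set M := (additivePoly p T).SplittingField
  have hM : CharP M p := charP_of_injective_algebraMap (algebraMap K M).injective p
  have hcard : Fintype.card ((additivePoly p T).rootSet M) = p * p := by
    rw [Polynomial.card_rootSet_eq_natDegree (separable_additivePoly T)
      (Polynomial.SplittingField.splits _), natDegree_additivePoly]
  refine ⟨M, inferInstance, hM, inferInstance, inferInstance,
    IsGalois.of_separable_splitting_field (separable_additivePoly T), ?_, ?_⟩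
  · intro σ hσ
    have : (σ : M →ₐ[K] M) = AlgHom.id K M := by
      refine AlgHom.ext_of_adjoin_eq_top (Polynomial.SplittingField.adjoin_rootSet _) ?_
      intro u hu
      exact hσ u ((mem_rootSet_additivePoly T).mp hu)
    ext u
    exact DFunLike.congr_fun this u
  · have key : ∀ s : Finset M, s.card < p * p →
        ∃ u ∈ additiveRoots p (algebraMap K M T), u ∉ s := by
      intro s hs
      by_contra! h
      have : ((additivePoly p T).rootSet M).toFinset ⊆ s := by
        intro u hu
        rw [Set.mem_toFinset, mem_rootSet_additivePoly] at hu
        exact h u hu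
      have := Finset.card_le_card this
      rw [Set.toFinset_card] at this
      omega
    have h1 : p < p * p := by nlinarith [hp.two_le]
    obtain ⟨x, hx, hx0⟩ := key {0} (by rw [Finset.card_singleton]; nlinarith [hp.two_le])
    rw [Finset.mem_singleton] at hx0
    obtain ⟨y, hy, hy0⟩ := key (Finset.univ.image fun c : ZMod p => ZMod.castHom (dvd_refl p) M c * x)
      ((Finset.card_image_le.trans (by rw [Finset.card_univ, ZMod.card])).trans_lt h1)
    have hd : mooreDet p x y ≠ 0 := by
      intro h
      obtain ⟨c, hc⟩ := exists_eq_castHom_mul_of_mooreDet_eq_zero hx0 h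
      exact hy0 (Finset.mem_image.mpr ⟨c, Finset.mem_univ _, hc.symm⟩)
    obtain ⟨c, hc⟩ := exists_castHom_eq_mooreDet hx hy
    refine ⟨x, hx, ZMod.castHom (dvd_refl p) M c⁻¹ * y, castHom_mul_mem_additiveRoots _ hy, ?_⟩
    rw [mooreDet_castHom_mul_right, ← hc, ← map_mul, inv_mul_cancel₀, map_one]
    rintro rfl
    exact hd (by rw [← hc, map_zero])

end MooreSplitting

section MooreRepresentation

open scoped Polynomial MatrixGroups

variable {p : ℕ} [Fact p.Prime] {K M : Type*} [Field K] [Field M] [CharP M p] [Algebra K M] {T : K}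
  {x y : M}

lemma exists_eq_add_of_mem_additiveRoots {S : M} (hx : x ∈ additiveRoots p S) (hy : y ∈ additiveRoots p S)
    (hxy : mooreDet p x y = 1) {u : M} (hu : u ∈ additiveRoots p S) :
    ∃ a b : ZMod p, u = ZMod.castHom (dvd_refl p) M a * x + ZMod.castHom (dvd_refl p) M b * y := by
  obtain ⟨a, ha⟩ := exists_castHom_eq_mooreDet hu hy
  obtain ⟨b, hb⟩ := exists_castHom_eq_mooreDet hx hu
  exact ⟨a, b, by rw [ha, hb, ← mooreDet_mul, hxy, one_mul]⟩

lemma mooreDet_add_left (x y u : M) : mooreDet p (x + y) u = mooreDet p x u + mooreDet p y u := by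
  simp only [mooreDet, add_pow_char]
  ring

lemma castHom_add_inj (hxy : mooreDet p x y = 1) {a b c d : ZMod p}
    (h : ZMod.castHom (dvd_refl p) M a * x + ZMod.castHom (dvd_refl p) M b * y =
      ZMod.castHom (dvd_refl p) M c * x + ZMod.castHom (dvd_refl p) M d * y) : a = c ∧ b = d := by
  have h1 := congrArg (fun u => mooreDet p u y) h
  have h2 := congrArg (mooreDet p x) h
  simp only [mooreDet_add_left, mooreDet_add_right, mooreDet_castHom_mul_left,
    mooreDet_castHom_mul_right, hxy, mooreDet_self, mul_zero, add_zero, zero_add, mul_one] at h1 h2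
  exact ⟨(ZMod.castHom (dvd_refl p) M).injective h1, (ZMod.castHom (dvd_refl p) M).injective h2⟩

lemma map_mem_additiveRoots (σ : M ≃ₐ[K] M) {u : M} (hu : u ∈ additiveRoots p (algebraMap K M T)) :
    σ u ∈ additiveRoots p (algebraMap K M T) := by
  rw [mem_additiveRoots] at *
  have := congrArg σ hu
  simpa using this

/-- `σ` acts on the basis `x`, `y` of the additive roots through the matrix `A`. -/
def ActsByMatrix (x y : M) (σ : M ≃ₐ[K] M) (A : SL(2, ZMod p)) : Prop :=
  σ x = ZMod.castHom (dvd_refl p) M (A 0 0) * x + ZMod.castHom (dvd_refl p) M (A 1 0) * y ∧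
  σ y = ZMod.castHom (dvd_refl p) M (A 0 1) * x + ZMod.castHom (dvd_refl p) M (A 1 1) * y

lemma exists_actsByMatrix (hx : x ∈ additiveRoots p (algebraMap K M T))
    (hy : y ∈ additiveRoots p (algebraMap K M T)) (hxy : mooreDet p x y = 1) (σ : M ≃ₐ[K] M) :
    ∃ A : SL(2, ZMod p), ActsByMatrix x y σ A := by
  obtain ⟨a, c, hac⟩ := exists_eq_add_of_mem_additiveRoots hx hy hxy (map_mem_additiveRoots σ hx)
  obtain ⟨b, d, hbd⟩ := exists_eq_add_of_mem_additiveRoots hx hy hxy (map_mem_additiveRoots σ hy)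
  have hyx : mooreDet p y x = -1 := by rw [← hxy, mooreDet, mooreDet]; ring
  have hdet : a * d - b * c = 1 := by
    apply (ZMod.castHom (dvd_refl p) M).injective
    have h1 : mooreDet p (σ x) (σ y) = 1 := by rw [← map_mooreDet, hxy, map_one]
    rw [hac, hbd] at h1
    simp only [mooreDet_add_left, mooreDet_add_right, mooreDet_castHom_mul_left,
      mooreDet_castHom_mul_right, hxy, hyx, mooreDet_self] at h1
    rw [map_sub, map_mul, map_mul, map_one]
    linear_combination h1
  exact ⟨⟨!![a, b; c, d], by rw [Matrix.det_fin_two_of, hdet]⟩, hac, hbd⟩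

lemma ActsByMatrix.mul {σ τ : M ≃ₐ[K] M} {A B : SL(2, ZMod p)} (hA : ActsByMatrix x y σ A)
    (hB : ActsByMatrix x y τ B) : ActsByMatrix x y (σ * τ) (A * B) := by
  constructor
  · rw [AlgEquiv.mul_apply, hB.1, map_add, map_mul, map_mul, map_castHom, map_castHom, hA.1, hA.2]
    simp only [Matrix.SpecialLinearGroup.coe_mul, Matrix.mul_apply, Fin.sum_univ_two, map_add, map_mul]
    ring
  · rw [AlgEquiv.mul_apply, hB.2, map_add, map_mul, map_mul, map_castHom, map_castHom, hA.1, hA.2]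
    simp only [Matrix.SpecialLinearGroup.coe_mul, Matrix.mul_apply, Fin.sum_univ_two, map_add, map_mul]
    ring

lemma ActsByMatrix.unique (hxy : mooreDet p x y = 1) {σ : M ≃ₐ[K] M} {A B : SL(2, ZMod p)}
    (hA : ActsByMatrix x y σ A) (hB : ActsByMatrix x y σ B) : A = B := by
  obtain ⟨h1, h2⟩ := castHom_add_inj hxy (hA.1.symm.trans hB.1)
  obtain ⟨h3, h4⟩ := castHom_add_inj hxy (hA.2.symm.trans hB.2)
  ext i j
  fin_cases i <;> fin_cases j <;> assumption

lemma exists_monoidHom_actsByMatrix (hx : x ∈ additiveRoots p (algebraMap K M T))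
    (hy : y ∈ additiveRoots p (algebraMap K M T)) (hxy : mooreDet p x y = 1) :
    ∃ ρ : (M ≃ₐ[K] M) →* SL(2, ZMod p), ∀ σ, ActsByMatrix x y σ (ρ σ) := by
  choose f hf using exists_actsByMatrix (K := K) hx hy hxy
  exact ⟨MonoidHom.mk' f fun σ τ => (hf (σ * τ)).unique hxy ((hf σ).mul (hf τ)), hf⟩

lemma ActsByMatrix.apply_eq_self {σ : M ≃ₐ[K] M} {S : M} (hx : x ∈ additiveRoots p S)
    (hy : y ∈ additiveRoots p S) (hxy : mooreDet p x y = 1)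
    (h : ActsByMatrix x y σ (1 : SL(2, ZMod p))) {u : M} (hu : u ∈ additiveRoots p S) : σ u = u := by
  obtain ⟨a, b, rfl⟩ := exists_eq_add_of_mem_additiveRoots hx hy hxy hu
  rw [map_add, map_mul, map_mul, map_castHom, map_castHom, h.1, h.2]
  simp

end MooreRepresentation

section SL2Generation

open scoped MatrixGroups

variable {p : ℕ} [Fact p.Prime]

lemma SL2.closure_upper_lower (H : Subgroup SL(2, ZMod p)) (hu : ∀ b, SL2.upper b ∈ H)
    (hl : ∀ c, SL2.lower c ∈ H) : H = ⊤ := by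
  have key : ∀ A : SL(2, ZMod p), A 1 0 ≠ 0 → A ∈ H := by
    intro A hc
    have hdet := A.det_coe
    rw [Matrix.det_fin_two] at hdet
    have : A = SL2.upper ((A 0 0 - 1) / A 1 0) * SL2.lower (A 1 0) * SL2.upper ((A 1 1 - 1) / A 1 0) := by
      ext i j
      simp only [Matrix.SpecialLinearGroup.coe_mul, SL2.coe_upper, SL2.coe_lower]
      fin_cases i <;> fin_cases j <;> simp [Matrix.mul_apply, Fin.sum_univ_two] <;> field_simp <;> first | ring1 | linear_combination hdet | linear_combination -hdet
    rw [this]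
    exact H.mul_mem (H.mul_mem (hu _) (hl _)) (hu _)
  rw [eq_top_iff]
  intro A _
  by_cases hc : A 1 0 = 0
  · have hdet := A.det_coe
    rw [Matrix.det_fin_two, hc, mul_zero, sub_zero] at hdet
    have h1 : (SL2.lower 1 * A : SL(2, ZMod p)) 1 0 ≠ 0 := by
      simp only [Matrix.SpecialLinearGroup.coe_mul, SL2.coe_lower]
      simp only [Matrix.mul_apply, Fin.sum_univ_two, hc]
      simp
      exact left_ne_zero_of_mul_eq_one hdet
    exact (H.mul_mem_cancel_left (hl 1)).mp (key _ h1)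
  · exact key A hc

lemma SL2.eq_top_of_upper_lower (H : Subgroup SL(2, ZMod p)) {a b : ZMod p} (ha : a ≠ 0) (hb : b ≠ 0)
    (hu : SL2.upper a ∈ H) (hl : SL2.lower b ∈ H) : H = ⊤ := by
  refine SL2.closure_upper_lower H (fun c => ?_) (fun c => ?_)
  · have := H.pow_mem hu (c / a).val
    rwa [SL2.upper_pow, ZMod.natCast_zmod_val, div_mul_cancel₀ _ ha] at this
  · have := H.pow_mem hl (c / b).val
    rwa [SL2.lower_pow, ZMod.natCast_zmod_val, div_mul_cancel₀ _ hb] at this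

end SL2Generation

section MooreSurjective

open scoped Polynomial MatrixGroups

variable {p : ℕ} [Fact p.Prime] {K M : Type*} [Field K] [Field M] [CharP M p] [Algebra K M] {T : K}
  {x y : M}

lemma exists_fixed_of_pow_eq_one (hx : x ∈ additiveRoots p (algebraMap K M T))
    (hy : y ∈ additiveRoots p (algebraMap K M T)) (hxy : mooreDet p x y = 1) {σ : M ≃ₐ[K] M}
    (hσ : σ ^ p = 1) : ∃ u ∈ additiveRoots p (algebraMap K M T), u ≠ 0 ∧ σ u = u := by
  obtain ⟨ρ, hρ⟩ := exists_monoidHom_actsByMatrix (K := K) hx hy hxy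
  have hp : p.Prime := Fact.out
  have h1 : ((ρ σ : SL(2, ZMod p)) : Matrix (Fin 2) (Fin 2) (ZMod p)) ^ p = 1 := by
    rw [← Matrix.SpecialLinearGroup.coe_pow, ← map_pow, hσ, map_one, Matrix.SpecialLinearGroup.coe_one]
  have h2 : ((ρ σ : Matrix (Fin 2) (Fin 2) (ZMod p)) - 1) ^ p = 0 := by
    rw [sub_pow_expChar_of_commute _ (Commute.one_right _), h1, one_pow, sub_self]
  have h3 : ((ρ σ : Matrix (Fin 2) (Fin 2) (ZMod p)) - 1).det = 0 := by
    have h4 := congrArg Matrix.det h2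
    rw [Matrix.det_pow, Matrix.det_zero] at h4
    exact eq_zero_of_pow_eq_zero h4
  obtain ⟨v, hv, hv0⟩ := Matrix.exists_mulVec_eq_zero_iff.mpr h3
  rw [Matrix.sub_mulVec, Matrix.one_mulVec, sub_eq_zero] at hv0
  have e0 := congrFun hv0 0
  have e1 := congrFun hv0 1
  simp only [Matrix.mulVec, dotProduct, Fin.sum_univ_two] at e0 e1
  refine ⟨ZMod.castHom (dvd_refl p) M (v 0) * x + ZMod.castHom (dvd_refl p) M (v 1) * y,
    add_mem (castHom_mul_mem_additiveRoots _ hx) (castHom_mul_mem_additiveRoots _ hy), ?_, ?_⟩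
  · intro h
    have h0 : ZMod.castHom (dvd_refl p) M (v 0) * x + ZMod.castHom (dvd_refl p) M (v 1) * y =
      ZMod.castHom (dvd_refl p) M 0 * x + ZMod.castHom (dvd_refl p) M 0 * y := by rw [h]; simp
    obtain ⟨ha, hb⟩ := castHom_add_inj hxy h0
    refine hv ?_
    ext i
    fin_cases i <;> assumption
  · rw [map_add, map_mul, map_mul, map_castHom, map_castHom, (hρ σ).1, (hρ σ).2]
    replace e0 := congrArg (ZMod.castHom (dvd_refl p) M) e0
    replace e1 := congrArg (ZMod.castHom (dvd_refl p) M) e1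
    rw [map_add, map_mul, map_mul] at e0 e1
    linear_combination x * e0 + y * e1

/-- The representation on the additive roots is onto `SL₂` if its order is divisible by `p` and it
is irreducible. -/
theorem exists_bijective_actsByMatrix [FiniteDimensional K M]
    (hf : ∀ σ : M ≃ₐ[K] M, (∀ u ∈ additiveRoots p (algebraMap K M T), σ u = u) → σ = 1)
    (hx : x ∈ additiveRoots p (algebraMap K M T))
    (hy : y ∈ additiveRoots p (algebraMap K M T)) (hxy : mooreDet p x y = 1)
    (hp : p ∣ Nat.card (M ≃ₐ[K] M))
    (hirr : ∀ u ∈ additiveRoots p (algebraMap K M T), u ≠ 0 →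
      ∃ g : M ≃ₐ[K] M, mooreDet p u (g u) ≠ 0) :
    ∃ x ∈ additiveRoots p (algebraMap K M T), ∃ y ∈ additiveRoots p (algebraMap K M T),
      mooreDet p x y = 1 ∧ ∃ ρ : (M ≃ₐ[K] M) →* SL(2, ZMod p), (∀ σ, ActsByMatrix x y σ (ρ σ)) ∧
        Function.Bijective ρ := by
  obtain ⟨h, hh⟩ := exists_prime_orderOf_dvd_card' p hp
  obtain ⟨x, hx, hx0, hhx⟩ := exists_fixed_of_pow_eq_one hx hy hxy (hh ▸ pow_orderOf_eq_one h)
  obtain ⟨g, hg⟩ := hirr x hx hx0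
  obtain ⟨c, hc⟩ := exists_castHom_eq_mooreDet hx (map_mem_additiveRoots g hx)
  have hc0 : c ≠ 0 := by
    rintro rfl
    exact hg (by rw [← hc, map_zero])
  obtain ⟨y, hy_def⟩ : ∃ y, y = ZMod.castHom (dvd_refl p) M c⁻¹ * g x := ⟨_, rfl⟩
  have hy : y ∈ additiveRoots p (algebraMap K M T) :=
    hy_def ▸ castHom_mul_mem_additiveRoots _ (map_mem_additiveRoots g hx)
  have hxy : mooreDet p x y = 1 := by
    rw [hy_def, mooreDet_castHom_mul_right, ← hc, ← map_mul, inv_mul_cancel₀ hc0, map_one]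
  obtain ⟨ρ, hρ⟩ := exists_monoidHom_actsByMatrix (K := K) hx hy hxy
  have hinj : Function.Injective ρ := by
    rw [injective_iff_map_eq_one]
    intro σ hσ
    have := hρ σ
    rw [hσ] at this
    exact hf σ fun u hu => this.apply_eq_self hx hy hxy hu
  refine ⟨x, hx, y, hy, hxy, ρ, hρ, hinj, ?_⟩
  rw [← MonoidHom.range_eq_top]
  have hh1 : h ≠ 1 := by
    rintro rfl
    rw [orderOf_one] at hh
    exact (Fact.out : p.Prime).ne_one hh.symm
  have hu : ρ h = SL2.upper (ρ h 0 1) := by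
    have h1 := (hρ h).1
    rw [hhx] at h1
    have h2 : ZMod.castHom (dvd_refl p) M 1 * x + ZMod.castHom (dvd_refl p) M 0 * y =
      ZMod.castHom (dvd_refl p) M (ρ h 0 0) * x + ZMod.castHom (dvd_refl p) M (ρ h 1 0) * y := by
      rw [← h1]; simp
    obtain ⟨ha, hb⟩ := castHom_add_inj hxy h2
    have hdet := (ρ h).det_coe
    rw [Matrix.det_fin_two, ← ha, ← hb, one_mul, mul_zero, sub_zero] at hdet
    ext i j
    fin_cases i <;> fin_cases j
    · exact ha.symm
    · rfl
    · exact hb.symm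
    · exact hdet
  have hl : ρ (g * h * g⁻¹) = SL2.lower (ρ (g * h * g⁻¹) 1 0) := by
    have h1 := (hρ (g * h * g⁻¹)).2
    have hy1 : (g * h * g⁻¹) y = y := by
      rw [hy_def, map_mul, map_castHom, AlgEquiv.mul_apply, AlgEquiv.mul_apply,
        ← AlgEquiv.mul_apply g⁻¹ g, inv_mul_cancel, AlgEquiv.one_apply, hhx]
    rw [hy1] at h1
    have h2 : ZMod.castHom (dvd_refl p) M 0 * x + ZMod.castHom (dvd_refl p) M 1 * y =
      ZMod.castHom (dvd_refl p) M (ρ (g * h * g⁻¹) 0 1) * x +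
        ZMod.castHom (dvd_refl p) M (ρ (g * h * g⁻¹) 1 1) * y := by
      rw [← h1]; simp
    obtain ⟨ha, hb⟩ := castHom_add_inj hxy h2
    have hdet := (ρ (g * h * g⁻¹)).det_coe
    rw [Matrix.det_fin_two, ← ha, ← hb, zero_mul, mul_one, sub_zero] at hdet
    ext i j
    fin_cases i <;> fin_cases j
    · exact hdet
    · exact ha.symm
    · rfl
    · exact hb.symm
  refine SL2.eq_top_of_upper_lower _ (a := ρ h 0 1) (b := ρ (g * h * g⁻¹) 1 0) ?_ ?_ ?_ ?_
  · intro h0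
    rw [h0, SL2.upper_zero] at hu
    exact hh1 (hinj (hu.trans (map_one ρ).symm))
  · intro h0
    rw [h0, SL2.lower_zero] at hl
    have := hinj (hl.trans (map_one ρ).symm)
    rw [mul_inv_eq_one, mul_eq_left] at this
    exact hh1 this
  · exact ⟨h, hu⟩
  · exact ⟨_, hl⟩

end MooreSurjective

section MooreInfinity

open WithZero
open scoped Polynomial Pointwise

lemma ZMod.prod_X_sub_C (p : ℕ) [Fact p.Prime] :
    ∏ c : ZMod p, (Polynomial.X - Polynomial.C c) = (Polynomial.X ^ p - Polynomial.X : (ZMod p)[X]) := by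
  have h1 : 1 < p := (Fact.out : p.Prime).one_lt
  have hr := FiniteField.roots_X_pow_card_sub_X (ZMod p)
  rw [ZMod.card] at hr
  have hd := FiniteField.X_pow_card_sub_X_natDegree_eq (ZMod p) h1
  have hm : (Polynomial.X ^ p - Polynomial.X : (ZMod p)[X]).Monic :=
    Polynomial.monic_X_pow_sub (by rw [Polynomial.degree_X]; exact_mod_cast h1)
  have := Polynomial.prod_multiset_X_sub_C_of_monic_of_roots_card_eq hm
    (by rw [hr, hd]; simp)
  rw [hr] at this
  exact this

variable {p : ℕ} [Fact p.Prime] {M : Type*} [Field M] [CharP M p]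

lemma prod_sub_castHom_mul (x y : M) :
    x * ∏ c : ZMod p, (y - ZMod.castHom (dvd_refl p) M c * x) = mooreDet p x y := by
  have hp : p.Prime := Fact.out
  obtain ⟨q, hq⟩ : ∃ q, p = q + 1 := ⟨p - 1, by have := hp.pos; omega⟩
  by_cases hx : x = 0
  · simp [hx, mooreDet, hp.ne_zero]
  · have h := congrArg (Polynomial.eval₂ (ZMod.castHom (dvd_refl p) M) (y / x)) (ZMod.prod_X_sub_C p)
    rw [Polynomial.eval₂_finsetProd] at h
    simp only [Polynomial.eval₂_sub, Polynomial.eval₂_X, Polynomial.eval₂_C, Polynomial.eval₂_pow] at h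
    have h2 : ∏ c : ZMod p, (y - ZMod.castHom (dvd_refl p) M c * x) =
        x ^ p * ∏ c : ZMod p, (y / x - ZMod.castHom (dvd_refl p) M c) := by
      have hxp : x ^ p = ∏ _c : ZMod p, x := by
        rw [Finset.prod_const, Finset.card_univ, ZMod.card]
      rw [hxp, ← Finset.prod_mul_distrib]
      refine Finset.prod_congr rfl fun c _ => ?_
      field_simp
    rw [h2, h, mooreDet, div_pow]
    field_simp

/-- Among the additive roots there is a nonzero one which is integral at `O`. -/
lemma exists_mem_additiveRoots_mem {S x y : M} (O : ValuationSubring M) (hx : x ∈ additiveRoots p S)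
    (hy : y ∈ additiveRoots p S) (hxy : mooreDet p x y = 1) :
    ∃ u ∈ additiveRoots p S, u ≠ 0 ∧ u ∈ O := by
  have hx0 : x ≠ 0 := by
    rintro rfl
    simp [mooreDet, (Fact.out : p.Prime).ne_zero] at hxy
  by_contra! h
  have hc (c : ZMod p) : y - ZMod.castHom (dvd_refl p) M c * x ∉ O := by
    refine h _ (sub_mem hy (castHom_mul_mem_additiveRoots c hx)) fun h0 => ?_
    rw [sub_eq_zero] at h0
    rw [h0, mooreDet_castHom_mul_right, mooreDet_self, mul_zero] at hxy
    exact zero_ne_one hxy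
  have h1 := congrArg O.valuation ((prod_sub_castHom_mul x y).trans hxy)
  rw [map_mul, map_prod, map_one] at h1
  have h2 : 1 < O.valuation x := by
    rw [← not_le, O.valuation_le_one_iff]
    exact h x hx hx0
  have h3 : 1 ≤ ∏ c : ZMod p, O.valuation (y - ZMod.castHom (dvd_refl p) M c * x) := by
    refine Finset.one_le_prod'' fun c => ?_
    rw [← not_lt]
    exact fun hlt => hc c ((O.valuation_le_one_iff _).mp hlt.le)
  exact (h2.trans_le (le_mul_of_one_le_right' h3)).ne h1.symm

variable {k L : Type} [Field k] [IsAlgClosed k] [Field L] [Algebra (RatFunc k) L]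
  {O : ValuationSubring L} {n : ℕ} {W : L}

lemma algebraMap_X_notMem (hO : O.comap (algebraMap (RatFunc k) L) = inftyPlace k) :
    (algebraMap (RatFunc k) L RatFunc.X)⁻¹ ∈ O.nonunits := by
  rw [← map_inv₀, ValuationSubring.algebraMap_mem_nonunits_iff hO]
  exact (isRationalPlace_inftyPlace k).uniformizer_mem

lemma mul_X_pow_eq_and_mem_nonunits (hO : O.comap (algebraMap (RatFunc k) L) = inftyPlace k)
    (hn : n ≠ 0)
    (hW : W * (algebraMap (RatFunc k) L RatFunc.X ^ n - W ^ p) = 1) (hWO : W ∈ O) :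
    W * algebraMap (RatFunc k) L RatFunc.X ^ n = 1 + W ^ (p + 1) ∧ W ∈ O.nonunits := by
  have hX := algebraMap_X_notMem hO
  have hX0 : algebraMap (RatFunc k) L RatFunc.X ≠ 0 := by simp [RatFunc.X_ne_zero]
  have h1 : W * algebraMap (RatFunc k) L RatFunc.X ^ n = 1 + W ^ (p + 1) := by
    linear_combination hW
  refine ⟨h1, ?_⟩
  have h2 : W = (1 + W ^ (p + 1)) * ((algebraMap (RatFunc k) L RatFunc.X)⁻¹ ^ n) := by
    rw [← h1, inv_pow, mul_inv_cancel_right₀ (pow_ne_zero _ hX0)]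
  rw [h2]
  refine ValuationSubring.mul_mem_nonunits (add_mem (one_mem _) (pow_mem hWO _)) ?_
  obtain ⟨q, rfl⟩ := Nat.exists_eq_succ_of_ne_zero hn
  rw [pow_succ]
  exact ValuationSubring.mul_mem_nonunits (pow_mem (ValuationSubring.nonunits_mem hX) _) hX

lemma dvd_card_stabilizer_of_notMem [IsGalois (RatFunc k) L] [FiniteDimensional (RatFunc k) L]
    (hO : O.comap (algebraMap (RatFunc k) L) = inftyPlace k) (hn : ¬ p ∣ n)
    (hW : W * (algebraMap (RatFunc k) L RatFunc.X ^ n - W ^ p) = 1) (hWO : W ∉ O) :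
    p ∣ Nat.card (MulAction.stabilizer (L ≃ₐ[RatFunc k] L) O) := by
  have hp : p.Prime := Fact.out
  obtain ⟨v, hv, -, ht⟩ := (isRationalPlace_inftyPlace k).exists_valuation hO
  have hmem (f : L) : f ∈ O ↔ v f ≤ 1 := by rw [← hv]; rfl
  rw [hmem, not_le] at hWO
  set e := Nat.card (MulAction.stabilizer (L ≃ₐ[RatFunc k] L) O)
  rw [map_inv₀, map_inv₀, inv_eq_iff_eq_inv, ← exp_neg, neg_neg] at ht
  have hlt : v (algebraMap (RatFunc k) L RatFunc.X ^ n - W ^ p) < v (W ^ p) := by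
    have h1 := congrArg v hW
    rw [map_mul, map_one] at h1
    have h2 : 1 < v (W ^ p) := by rw [map_pow]; exact one_lt_pow₀ hWO hp.ne_zero
    refine lt_trans ?_ h2
    by_contra! h3
    exact (hWO.trans_le (le_mul_of_one_le_right' h3)).ne h1.symm
  have h4 : v (algebraMap (RatFunc k) L RatFunc.X ^ n) = v (W ^ p) := by
    have := Valuation.map_add_eq_of_lt_right v hlt
    rwa [sub_add_cancel] at this
  have hW0 : v W ≠ 0 := (zero_lt_one.trans hWO).ne'
  rw [map_pow, map_pow, ht, ← exp_log hW0, ← exp_nsmul, ← exp_nsmul, exp_inj] at h4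
  have : (p : ℤ) ∣ n * e := ⟨log (v W), by simpa using h4⟩
  exact ((Nat.Prime.dvd_mul hp).mp (by exact_mod_cast this)).resolve_left hn

end MooreInfinity

section FixedFieldLifts

variable {K M : Type*} [Field K] [Field M] [Algebra K M] [FiniteDimensional K M] [IsGalois K M]

lemma IntermediateField.exists_lift_fixedField (Z : Subgroup (M ≃ₐ[K] M)) [Z.Normal]
    (σ : IntermediateField.fixedField Z ≃ₐ[K] IntermediateField.fixedField Z) :
    ∃ τ : M ≃ₐ[K] M, (∀ w : IntermediateField.fixedField Z, ((σ w : _) : M) = τ w) ∧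
      (τ ∈ Z → σ = 1) := by
  obtain ⟨τ, hτ⟩ := AlgEquiv.restrictNormalHom_surjective (F := K)
    (K₁ := IntermediateField.fixedField Z) M σ
  have h1 (w : IntermediateField.fixedField Z) : ((σ w : _) : M) = τ w := by
    rw [← hτ]
    exact AlgEquiv.restrictNormal_commutes τ (IntermediateField.fixedField Z) w
  refine ⟨τ, h1, fun hZ => ?_⟩
  ext w
  rw [h1, AlgEquiv.one_apply]
  exact w.2 ⟨τ, hZ⟩

end FixedFieldLifts

section MooreSL2

open scoped Polynomial Pointwise MatrixGroups

/-- There is a `G`-Galois cover of the line, ramified only over `∞`, such that the decomposition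
groups over `∞` have order `p * m` and a normal subgroup of order `p`. -/
def HasWildCover (k : Type) [Field k] (p m : ℕ) (G : Type) [Group G] : Prop :=
  ∃ (L : Type) (_ : Field L) (_ : Algebra (RatFunc k) L),
    FiniteDimensional (RatFunc k) L ∧ IsGalois (RatFunc k) L ∧
    Nonempty ((L ≃ₐ[RatFunc k] L) ≃* G) ∧
    (∃ O : ValuationSubring L, O.comap (algebraMap (RatFunc k) L) = inftyPlace k ∧
      ∃ N ≤ MulAction.stabilizer (L ≃ₐ[RatFunc k] L) O,
        MulAction.stabilizer (L ≃ₐ[RatFunc k] L) O ≤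
          Subgroup.normalizer (N : Set (L ≃ₐ[RatFunc k] L)) ∧
        Nat.card N = p ∧ Nat.card (MulAction.stabilizer (L ≃ₐ[RatFunc k] L) O) = p * m) ∧
    ∀ O : ValuationSubring L,
      (∀ f : k[X], algebraMap (RatFunc k) L (algebraMap k[X] (RatFunc k) f) ∈ O) →
      ∀ σ : L ≃ₐ[RatFunc k] L, σ • O = O → (∀ f ∈ O, σ f - f ∈ O.nonunits) → σ = 1

lemma ValuationSubring.mem_of_pow_mem {L : Type*} [Field L] {O : ValuationSubring L} {x : L} {n : ℕ}
    (hn : n ≠ 0) (h : x ^ n ∈ O) : x ∈ O := by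
  rw [← O.valuation_le_one_iff] at *
  rw [map_pow] at h
  exact (pow_le_one_iff hn).mp h

/-- Some additive root is not integral at infinity. -/
lemma exists_mem_additiveRoots_notMem {k M : Type} [Field k] [IsAlgClosed k] {p : ℕ} [Fact p.Prime]
    [Field M] [Algebra (RatFunc k) M] [CharP M p] {O : ValuationSubring M} {n : ℕ} (hn : n ≠ 0)
    (hO : O.comap (algebraMap (RatFunc k) M) = inftyPlace k) {x y : M}
    (hx : x ∈ additiveRoots p (algebraMap (RatFunc k) M (RatFunc.X ^ n)))
    (hy : y ∈ additiveRoots p (algebraMap (RatFunc k) M (RatFunc.X ^ n))) (hxy : mooreDet p x y = 1) :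
    ∃ u ∈ additiveRoots p (algebraMap (RatFunc k) M (RatFunc.X ^ n)), u ≠ 0 ∧ u ∉ O := by
  have hp : p.Prime := Fact.out
  by_contra! h
  have hx0 : x ≠ 0 := by
    rintro rfl
    simp [mooreDet, hp.ne_zero] at hxy
  have hy0 : y ≠ 0 := by
    rintro rfl
    simp [mooreDet, hp.ne_zero] at hxy
  have h1 := pow_pred_mul_eq hx0 hx
  rw [map_pow] at h1
  have h2 := (mul_X_pow_eq_and_mem_nonunits hO hn h1 (pow_mem (h x hx hx0) _)).2
  have h3 : mooreDet p x y ∈ O.nonunits := by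
    have : mooreDet p x y = (y ^ p - x * y ^ 1 * x ^ (p - 2)) * x := by
      obtain ⟨q, rfl⟩ : ∃ q, p = q + 2 := ⟨p - 2, by have := hp.two_le; omega⟩
      rw [mooreDet, Nat.add_sub_cancel]
      ring
    have hxO := h x hx hx0
    have hyO := h y hy hy0
    have hxn : x ∈ O.nonunits := by
      by_contra hxn
      have := pow_mem (ValuationSubring.inv_mem_of_notMem_nonunits hxn) (p - 1)
      have h4 := ValuationSubring.mul_mem_nonunits this h2
      rw [inv_pow, inv_mul_cancel₀ (pow_ne_zero _ hx0)] at h4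
      exact O.one_notMem_nonunits h4
    rw [this]
    exact ValuationSubring.mul_mem_nonunits (sub_mem (pow_mem hyO _)
      (mul_mem (mul_mem hxO (pow_mem hyO _)) (pow_mem hxO _))) hxn
  rw [hxy] at h3
  exact O.one_notMem_nonunits h3

/-- The additive polynomial `U ^ p ^ 2 - X ^ n * U ^ p + U` over `k(X)` has no Galois stable line of
roots. -/
lemma exists_mooreDet_ne_zero {k M : Type} [Field k] {p : ℕ} [Fact p.Prime]
    [Field M] [Algebra (RatFunc k) M] [IsGalois (RatFunc k) M] [CharP M p] {n : ℕ}
    [FiniteDimensional (RatFunc k) M] (hn : n ≠ 0) {u : M}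
    (hu : u ∈ additiveRoots p (algebraMap (RatFunc k) M (RatFunc.X ^ n))) (hu0 : u ≠ 0) :
    ∃ g : M ≃ₐ[RatFunc k] M, mooreDet p u (g u) ≠ 0 := by
  have hp : p.Prime := Fact.out
  by_contra! h
  have hfix (g : M ≃ₐ[RatFunc k] M) : g (u ^ (p - 1)) = u ^ (p - 1) := by
    obtain ⟨c, hc⟩ := exists_eq_castHom_mul_of_mooreDet_eq_zero hu0 (h g)
    have hc0 : c ≠ 0 := by
      rintro rfl
      rw [map_zero, zero_mul] at hc
      exact hu0 ((map_eq_zero g).mp hc)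
    rw [map_pow, hc, mul_pow, ← map_pow, ZMod.pow_card_sub_one_eq_one hc0, map_one, one_mul]
  obtain ⟨w, hw⟩ := (IsGalois.mem_range_algebraMap_iff_fixed _).mpr hfix
  have h1 := pow_pred_mul_eq hu0 hu
  rw [← hw, ← map_pow, ← map_sub, ← map_mul] at h1
  have h2 : w * (RatFunc.X ^ n - w ^ p) = 1 := (algebraMap (RatFunc k) M).injective (h1.trans (map_one _).symm)
  have hint : IsIntegral k[X] w := by
    refine ⟨Polynomial.X ^ (p + 1) - (Polynomial.C (Polynomial.X ^ n) * Polynomial.X - 1), ?_, ?_⟩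
    · refine Polynomial.monic_X_pow_sub ?_
      refine (Polynomial.degree_sub_le _ _).trans_lt (max_lt ?_ ?_)
      · refine (Polynomial.degree_C_mul_X_le _).trans_lt ?_
        exact_mod_cast hp.one_lt.trans (Nat.lt_succ_self p)
      · rw [Polynomial.degree_one]
        exact_mod_cast Nat.succ_pos p
    · simp only [Polynomial.eval₂_sub, Polynomial.eval₂_pow, Polynomial.eval₂_X, Polynomial.eval₂_mul,
        Polynomial.eval₂_C, map_pow, Polynomial.eval₂_one, RatFunc.algebraMap_X]
      linear_combination -h2
  obtain ⟨q, rfl⟩ := IsIntegrallyClosed.isIntegral_iff.mp hint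
  have h3 : q * (Polynomial.X ^ n - q ^ p) = 1 := by
    apply RatFunc.algebraMap_injective k
    rw [map_mul, map_sub, map_pow, map_pow, RatFunc.algebraMap_X, h2, map_one]
  have h4 := Polynomial.natDegree_eq_zero_of_isUnit (.of_mul_eq_one _ h3)
  have h5 := Polynomial.natDegree_eq_zero_of_isUnit (.of_mul_eq_one _ ((mul_comm _ _).trans h3))
  have h6 : (Polynomial.X ^ n : k[X]).natDegree ≤ 0 := by
    have : (Polynomial.X ^ n : k[X]) = (Polynomial.X ^ n - q ^ p) + q ^ p := by ring
    rw [this]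
    refine (Polynomial.natDegree_add_le _ _).trans (max_le h5.le ?_)
    exact (Polynomial.natDegree_pow_le.trans (by rw [h4, mul_zero]))
  rw [Polynomial.natDegree_X_pow] at h6
  omega

lemma ValuationSubring.pow_pred_notMem {L : Type*} [Field L] {O : ValuationSubring L} {x : L} {p : ℕ}
    [hp : Fact p.Prime] (hx : x ∉ O) : x ^ (p - 1) ∉ O := fun h =>
  hx (mem_of_pow_mem (by have := hp.out.two_le; omega) h)

/-- An explicit Galois extension of `k(X)` with group `SL₂(p)`. -/
theorem exists_SL2_extension (k : Type) [Field k] [IsAlgClosed k] (p : ℕ) [Fact p.Prime] [CharP k p]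
    {n : ℕ} (hn : ¬ p ∣ n) :
    ∃ (M : Type) (_ : Field M) (_ : CharP M p) (_ : Algebra (RatFunc k) M),
      FiniteDimensional (RatFunc k) M ∧ IsGalois (RatFunc k) M ∧
      ∃ x ∈ additiveRoots p (algebraMap (RatFunc k) M (RatFunc.X ^ n)),
      ∃ y ∈ additiveRoots p (algebraMap (RatFunc k) M (RatFunc.X ^ n)),
        mooreDet p x y = 1 ∧ ∃ ρ : (M ≃ₐ[RatFunc k] M) →* SL(2, ZMod p),
          (∀ σ, ActsByMatrix x y σ (ρ σ)) ∧ Function.Bijective ρ := by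
  have hn0 : n ≠ 0 := by
    rintro rfl
    exact hn (dvd_zero p)
  have : CharP (RatFunc k) p := charP_of_injective_algebraMap (algebraMap k (RatFunc k)).injective p
  obtain ⟨M, _, _, _, _, _, hf, x, hx, y, hy, hxy⟩ :=
    exists_mooreDet_eq_one p (RatFunc.X ^ n : RatFunc k)
  refine ⟨M, inferInstance, inferInstance, inferInstance, inferInstance, inferInstance, ?_⟩
  obtain ⟨O, hO⟩ := ValuationSubring.exists_comap_eq (L := M) (inftyPlace k)
  obtain ⟨u, hu, hu0, huO⟩ := exists_mem_additiveRoots_notMem hn0 hO hx hy hxy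
  have h1 := pow_pred_mul_eq hu0 hu
  rw [map_pow] at h1
  have h2 := dvd_card_stabilizer_of_notMem hO hn h1 (ValuationSubring.pow_pred_notMem huO)
  exact exists_bijective_actsByMatrix hf hx hy hxy (h2.trans (Subgroup.card_subgroup_dvd_card _))
    fun u hu hu0 => exists_mooreDet_ne_zero hn0 hu hu0

end MooreSL2

section MooreCentral

open scoped Polynomial Pointwise MatrixGroups

variable {p : ℕ} [Fact p.Prime] {K M : Type*} [Field K] [Field M] [CharP M p] [Algebra K M] {S : M}
  {x y : M} {σ : M ≃ₐ[K] M} {A : SL(2, ZMod p)}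

lemma ActsByMatrix.eq_or_eq_neg_of_mem_center (hx : x ∈ additiveRoots p S)
    (hy : y ∈ additiveRoots p S) (hxy : mooreDet p x y = 1) (h : ActsByMatrix x y σ A)
    (hA : A ∈ Subgroup.center SL(2, ZMod p)) {u : M} (hu : u ∈ additiveRoots p S) :
    σ u = u ∨ σ u = -u := by
  obtain ⟨a, b, rfl⟩ := exists_eq_add_of_mem_additiveRoots hx hy hxy hu
  rcases SL2.mem_center_iff_eq.mp hA with rfl | rfl
  · left
    rw [map_add, map_mul, map_mul, map_castHom, map_castHom, h.1, h.2]
    simp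
  · right
    rw [map_add, map_mul, map_mul, map_castHom, map_castHom, h.1, h.2]
    simp [add_comm]

lemma ActsByMatrix.mem_center (hx : x ∈ additiveRoots p S)
    (hy : y ∈ additiveRoots p S) (hxy : mooreDet p x y = 1) (h : ActsByMatrix x y σ A)
    (hσ : ∀ u ∈ additiveRoots p S, mooreDet p u (σ u) = 0) :
    A ∈ Subgroup.center SL(2, ZMod p) := by
  have hyx : mooreDet p y x = -1 := by rw [← hxy, mooreDet, mooreDet]; ring
  have e1 := hσ x hx
  have e2 := hσ y hy
  have e3 := hσ (x + y) (add_mem hx hy)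
  rw [map_add, h.1, h.2] at e3
  rw [h.1] at e1
  rw [h.2] at e2
  simp only [mooreDet_add_left, mooreDet_add_right,
      mooreDet_castHom_mul_right, hxy, hyx, mooreDet_self, mul_zero, add_zero, zero_add, mul_one,
      mul_neg, neg_eq_zero, map_eq_zero] at e1 e2 e3
  rw [e1, e2, map_zero, neg_zero, zero_add, add_zero, neg_add_eq_zero] at e3
  have e4 := (ZMod.castHom (dvd_refl p) M).injective e3
  have hdet := A.det_coe
  rw [Matrix.det_fin_two, e1, e2, e4, mul_zero, sub_zero] at hdet
  rw [SL2.mem_center_iff_eq]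
  rcases mul_self_eq_one_iff.mp hdet with h5 | h5
  · left
    ext i j
    fin_cases i <;> fin_cases j <;> simp [e1, e2, e4, h5]
  · right
    ext i j
    fin_cases i <;> fin_cases j <;> simp [e1, e2, e4, h5]

/-- An automorphism with an eigenvector of eigenvalue `±1` has central `p`-th power. -/
lemma mooreDet_pow_card_eq_zero {T : K} (hx : x ∈ additiveRoots p (algebraMap K M T))
    {c : ZMod p} (hx0 : x ≠ 0)
    (hc : c * c = 1) (hσ : σ x = ZMod.castHom (dvd_refl p) M c * x) {u : M}
    (hu : u ∈ additiveRoots p (algebraMap K M T)) : mooreDet p u ((σ ^ p) u) = 0 := by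
  obtain ⟨a, ha⟩ : ∃ a : ZMod p, σ u = ZMod.castHom (dvd_refl p) M c * u +
      ZMod.castHom (dvd_refl p) M a * x := by
    have h1 : mooreDet p (σ x) (σ u) = mooreDet p x u := by
      obtain ⟨d, hd⟩ := exists_castHom_eq_mooreDet hx hu
      rw [← map_mooreDet, ← hd, map_castHom]
    rw [hσ, mooreDet_castHom_mul_left] at h1
    have h2 : mooreDet p x (σ u + ZMod.castHom (dvd_refl p) M (-c) * u) = 0 := by
      rw [mooreDet_add_right, mooreDet_castHom_mul_right, map_neg, ← h1]
      have h3 := congrArg (ZMod.castHom (dvd_refl p) M) hc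
      rw [map_mul, map_one] at h3
      linear_combination -h3 * mooreDet p x (σ u)
    obtain ⟨a, ha⟩ := exists_eq_castHom_mul_of_mooreDet_eq_zero hx0 h2
    rw [map_neg] at ha
    exact ⟨a, by linear_combination ha⟩
  have key (j : ℕ) : (σ ^ (j + 1)) u = ZMod.castHom (dvd_refl p) M c ^ (j + 1) * u +
      (j + 1 : ℕ) * ZMod.castHom (dvd_refl p) M c ^ j * ZMod.castHom (dvd_refl p) M a * x := by
    induction j with
    | zero => simp [ha]
    | succ j ih =>
      rw [pow_succ', AlgEquiv.mul_apply, ih, map_add, map_mul, map_mul, map_mul, map_mul, map_natCast,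
        map_pow, map_pow, map_castHom, map_castHom, ha, hσ]
      push_cast
      ring
  obtain ⟨q, hq⟩ : ∃ q, p = q + 1 := ⟨p - 1, by have := (Fact.out : p.Prime).pos; omega⟩
  have h4 : (σ ^ p) u = ZMod.castHom (dvd_refl p) M c * u := by
    have := key q
    rw [← hq, ZMod.castHom_pow_card, CharP.cast_eq_zero, zero_mul, zero_mul, zero_mul, add_zero] at this
    exact this
  rw [h4, mooreDet_castHom_mul_right, mooreDet_self, mul_zero]

lemma eq_of_mul_sub_pow_eq_one {L : Type} [Field L] [CharP L p] {O : ValuationSubring L} {T W W' : L}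
    (h : W * (T - W ^ p) = 1) (h' : W' * (T - W' ^ p) = 1) (hW : W ∈ O) (hd : W' - W ∈ O.nonunits) :
    W' = W := by
  by_contra hne
  have h0 : W' - W ≠ 0 := sub_ne_zero.mpr hne
  have h1 := pow_pred_sub_identity h h0 (by rwa [add_sub_cancel])
  have hdO := ValuationSubring.nonunits_mem hd
  have h2 := ValuationSubring.mul_mem_nonunits (x := (W' - W) ^ (p - 2) * W ^ 2 + (W' - W) ^ (p - 1) * W)
    (add_mem (mul_mem (pow_mem hdO _) (pow_mem hW _)) (mul_mem (pow_mem hdO _) hW)) hd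
  rw [mul_comm, h1] at h2
  exact O.one_notMem_nonunits h2

lemma mem_of_mul_sub_pow_eq_one {L : Type*} [Field L] {O : ValuationSubring L} {T W : L}
    (h : W * (T - W ^ p) = 1) (hT : T ∈ O) : W ∈ O := by
  have hW0 := left_ne_zero_of_mul_eq_one h
  by_contra hW
  have hinv : W⁻¹ ∈ O := (O.mem_or_inv_mem W).resolve_left hW
  obtain ⟨q, hq⟩ : ∃ q, p = q + 1 := ⟨p - 1, by have := (Fact.out : p.Prime).pos; omega⟩
  have h1 : W = T * W⁻¹ ^ q - W⁻¹ ^ p := by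
    have h2 : T = W ^ p + W⁻¹ := by
      field_simp
      linear_combination h
    rw [h2, add_mul, hq, ← pow_succ', add_sub_cancel_right, pow_succ', mul_assoc, ← mul_pow,
      mul_inv_cancel₀ hW0, one_pow, mul_one]
  rw [h1] at hW
  exact hW (sub_mem (mul_mem hT (pow_mem hinv _)) (pow_mem hinv _))

end MooreCentral

section MoorePSL2

open WithZero
open scoped Polynomial Pointwise MatrixGroups

variable {p : ℕ} [Fact p.Prime] {k M L : Type} [Field k] [Field M] [CharP M p]
  [Algebra (RatFunc k) M] [Field L] [Algebra (RatFunc k) L] [Algebra L M]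
  [IsScalarTower (RatFunc k) L M] {n : ℕ}

lemma mul_sub_pow_eq_one_of_algebraMap {W : L} {u : M} {T : RatFunc k} (hu0 : u ≠ 0)
    (hu : u ∈ additiveRoots p (algebraMap (RatFunc k) M T))
    (hW : algebraMap L M W = u ^ (p - 1)) : W * (algebraMap (RatFunc k) L T - W ^ p) = 1 := by
  apply (algebraMap L M).injective
  rw [map_mul, map_sub, map_pow, map_one, hW, ← IsScalarTower.algebraMap_apply]
  exact pow_pred_mul_eq hu0 hu

variable {T : RatFunc k}

lemma algebraMap_pow_half {w : L} {u : M} (hp2 : p ≠ 2) (hw : algebraMap L M w = u ^ 2) :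
    algebraMap L M (w ^ ((p - 1) / 2)) = u ^ (p - 1) := by
  have hp : p.Prime := Fact.out
  rw [map_pow, hw, ← pow_mul, Nat.mul_div_cancel' (hp.even_sub_one hp2).two_dvd]

lemma eq_one_of_inertia [CharP L p] (hp2 : p ≠ 2)
    (hlift : ∀ σ : L ≃ₐ[RatFunc k] L, ∃ τ : M ≃ₐ[RatFunc k] M,
      ∀ w, algebraMap L M (σ w) = τ (algebraMap L M w))
    (hfix : ∀ τ : M ≃ₐ[RatFunc k] M,
      (∀ u ∈ additiveRoots p (algebraMap (RatFunc k) M T), mooreDet p u (τ u) = 0) →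
      ∀ w : L, τ (algebraMap L M w) = algebraMap L M w)
    (hsq : ∀ u ∈ additiveRoots p (algebraMap (RatFunc k) M T), ∃ w : L, algebraMap L M w = u ^ 2)
    {O : ValuationSubring L} (hT : algebraMap (RatFunc k) L T ∈ O) {σ : L ≃ₐ[RatFunc k] L}
    (hσ : ∀ f ∈ O, σ f - f ∈ O.nonunits) : σ = 1 := by
  have hp : p.Prime := Fact.out
  obtain ⟨τ, hτ⟩ := hlift σ
  ext f
  apply (algebraMap L M).injective
  rw [hτ, AlgEquiv.one_apply]
  refine hfix τ (fun u hu => ?_) f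
  by_cases hu0 : u = 0
  · simp [hu0, mooreDet]
  obtain ⟨w, hw⟩ := hsq u hu
  have hW := algebraMap_pow_half hp2 hw
  set W := w ^ ((p - 1) / 2)
  have h2 := mul_sub_pow_eq_one_of_algebraMap hu0 hu hW
  have hWO := mem_of_mul_sub_pow_eq_one h2 hT
  have h3 : σ W * (algebraMap (RatFunc k) L T - σ W ^ p) = 1 := by
    have := congrArg σ h2
    simpa using this
  have h4 := eq_of_mul_sub_pow_eq_one h2 h3 hWO (hσ W hWO)
  have h5 := hτ W
  rw [h4, hW, map_pow] at h5
  obtain ⟨c, -, hc⟩ := ZMod.exists_cast_mul_eq_of_pow_eq hu0 h5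
  rw [hc, mooreDet_castHom_mul_right, mooreDet_self, mul_zero]

lemma castHom_eq_zero_of_mem_nonunits [CharP L p] {O : ValuationSubring L} {c : ZMod p}
    (h : ZMod.castHom (dvd_refl p) L c ∈ O.nonunits) : c = 0 := by
  by_contra hc
  have h1 : ZMod.castHom (dvd_refl p) L c⁻¹ ∈ O := by
    refine ValuationSubring.mem_of_pow_mem (n := p - 1)
      (by have := (Fact.out : p.Prime).two_le; omega) ?_
    rw [← map_pow, ZMod.pow_card_sub_one_eq_one (inv_ne_zero hc), map_one]
    exact one_mem _
  have h2 := ValuationSubring.mul_mem_nonunits h1 h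
  rw [← map_mul, inv_mul_cancel₀ hc, map_one] at h2
  exact O.one_notMem_nonunits h2

variable [IsAlgClosed k] [IsGalois (RatFunc k) L] [FiniteDimensional (RatFunc k) L]

/-- An automorphism in the decomposition group at infinity fixing the residue of `u ^ 2 / σ (u ^ 2)`
for a small additive root `u` has order dividing `p`. -/
lemma pow_card_eq_one_of_div_sub_one_mem [CharP L p] (hp2 : p ≠ 2)
    (hlift : ∀ σ : L ≃ₐ[RatFunc k] L, ∃ τ : M ≃ₐ[RatFunc k] M,
      ∀ w, algebraMap L M (σ w) = τ (algebraMap L M w))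
    (hfix : ∀ τ : M ≃ₐ[RatFunc k] M,
      (∀ u ∈ additiveRoots p (algebraMap (RatFunc k) M (RatFunc.X ^ n)), mooreDet p u (τ u) = 0) →
      ∀ w : L, τ (algebraMap L M w) = algebraMap L M w)
    {O : ValuationSubring L} (hO : O.comap (algebraMap (RatFunc k) L) = inftyPlace k)
    {x : M} (hx : x ∈ additiveRoots p (algebraMap (RatFunc k) M (RatFunc.X ^ n))) (hx0 : x ≠ 0)
    {δ : L} (hδ : algebraMap L M δ = x ^ 2) (hδO : δ ∈ O)
    {σ : L ≃ₐ[RatFunc k] L} (hσ : σ • O = O) (h1 : σ δ / δ - 1 ∈ O.nonunits) : σ ^ p = 1 := by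
  have hW := algebraMap_pow_half hp2 hδ
  set W := δ ^ ((p - 1) / 2)
  have h2 := mul_sub_pow_eq_one_of_algebraMap hx0 hx hW
  have hWO : W ∈ O := pow_mem hδO _
  have h3 : σ W * (algebraMap (RatFunc k) L (RatFunc.X ^ n) - σ W ^ p) = 1 := by
    have := congrArg σ h2
    simpa using this
  have h4 := eq_of_mul_sub_pow_eq_one h2 h3 hWO
    ((isRationalPlace_inftyPlace k).sub_mem_nonunits hO hσ hWO)
  obtain ⟨τ, hτ⟩ := hlift σ
  have h5 := hτ W
  rw [h4, hW, map_pow] at h5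
  obtain ⟨c, -, hc⟩ := ZMod.exists_cast_mul_eq_of_pow_eq hx0 h5
  have hδ0 : δ ≠ 0 := by
    rintro rfl
    rw [map_zero] at hδ
    exact pow_ne_zero _ hx0 hδ.symm
  have h6 : σ δ = ZMod.castHom (dvd_refl p) L (c * c) * δ := by
    apply (algebraMap L M).injective
    rw [hτ, hδ, map_pow, hc, map_mul (algebraMap L M), hδ, map_mul, map_mul]
    have (a : ZMod p) : algebraMap L M (ZMod.castHom (dvd_refl p) L a) = ZMod.castHom (dvd_refl p) M a :=
      RingHom.congr_fun (Subsingleton.elim ((algebraMap L M).comp (ZMod.castHom (dvd_refl p) L))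
        (ZMod.castHom (dvd_refl p) M)) a
    rw [this]
    ring
  rw [h6, mul_div_cancel_right₀ _ hδ0, ← map_one (ZMod.castHom (dvd_refl p) L), ← map_sub] at h1
  have h7 := sub_eq_zero.mp (castHom_eq_zero_of_mem_nonunits h1)
  have h8 (j : ℕ) (f : L) : algebraMap L M ((σ ^ j) f) = (τ ^ j) (algebraMap L M f) := by
    induction j generalizing f with
    | zero => rfl
    | succ j ih => rw [pow_succ, pow_succ, AlgEquiv.mul_apply, AlgEquiv.mul_apply, ih, hτ]
  ext f
  apply (algebraMap L M).injective
  rw [h8, AlgEquiv.one_apply]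
  exact hfix _ (fun u hu => mooreDet_pow_card_eq_zero hx hx0 h7 hc hu) f

end MoorePSL2

section PSL2Cover

open WithZero
open scoped Polynomial Pointwise MatrixGroups

lemma IsRationalPlace.dvd_card_of_valuation_eq_one {k K L : Type} [Field k]
    [IsAlgClosed k] [Field K] [Algebra k K] [Field L] [Algebra K L]
    [IsGalois K L] [FiniteDimensional K L] {w : ValuationSubring K} {t : K}
    (hw : IsRationalPlace k w t) {O : ValuationSubring L} (hO : O.comap (algebraMap K L) = w)
    {δ : L} {m s : ℕ} (h : O.valuation (δ ^ m * algebraMap K L (t⁻¹ ^ s)) = 1)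
    (hm : m ≠ 0) (hms : m.Coprime s) :
    m ∣ Nat.card (MulAction.stabilizer (L ≃ₐ[K] L) O) := by
  obtain ⟨v, hv, -, ht⟩ := hw.exists_valuation hO
  set e := Nat.card (MulAction.stabilizer (L ≃ₐ[K] L) O)
  have h1 : v (δ ^ m * algebraMap K L (t⁻¹ ^ s)) = 1 := by
    subst hv
    exact (Valuation.isEquiv_valuation_valuationSubring v).eq_one_iff_eq_one.mpr h
  have hne : v δ ^ m ≠ 0 := by
    intro h0
    rw [map_mul, map_pow, h0, zero_mul] at h1
    exact zero_ne_one h1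
  have ht0 : v (algebraMap K L t) ≠ 0 := by rw [ht]; exact exp_ne_zero
  have hδ : v δ ≠ 0 := fun h0 => hne (by rw [h0, zero_pow hm])
  rw [map_mul, map_pow, map_pow, map_pow, map_inv₀, map_inv₀, ht, ← exp_log hδ, ← exp_neg, ← exp_nsmul, ← exp_nsmul,
    ← exp_add, ← exp_zero, exp_inj] at h1
  have h2 : (m : ℤ) ∣ s * e := ⟨- log (v δ), by simp at h1; linarith⟩
  exact hms.dvd_of_dvd_mul_left (by exact_mod_cast h2)

/-- `p`-subgroups in a group of order not divisible by `p ^ 2`. -/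
lemma SquareNormalizing.card_dvd_of_pow_eq_one {p : ℕ} [Fact p.Prime] {G : Type*} [Group G] [Finite G]
    (hG : SquareNormalizing p G) {N : Subgroup G} (hN : ∀ g ∈ N, g ^ p = 1) : Nat.card N ∣ p := by
  have h1 : IsPGroup p N := fun g => ⟨1, by
    ext
    rw [pow_one, Subgroup.coe_pow, hN g g.2, Subgroup.coe_one]⟩
  obtain ⟨j, hj⟩ := IsPGroup.iff_card.mp h1
  rw [hj]
  have h2 : j < 2 := by
    by_contra! h
    exact hG.not_sq_dvd (((pow_dvd_pow p h).trans (dvd_of_eq hj.symm)).trans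
      (Subgroup.card_subgroup_dvd_card N))
  calc p ^ j ∣ p ^ 1 := pow_dvd_pow p (by omega)
    _ = p := pow_one p

theorem hasWildCover_PSL₂ (k : Type) [Field k] [IsAlgClosed k] {p : ℕ} [Fact p.Prime] [CharP k p]
    (hp2 : p ≠ 2) {m : ℕ} (hm : m ∣ (p - 1) / 2) : HasWildCover k p m (PSL₂ (ZMod p)) := by
  have hp : p.Prime := Fact.out
  have hp3 : 2 < p := lt_of_le_of_ne hp.two_le hp2.symm
  obtain ⟨n, hn⟩ := hm
  have hpos : 0 < (p - 1) / 2 := Nat.div_pos (by omega) two_pos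
  have hm0 : m ≠ 0 := by
    rintro rfl
    omega
  have hn0 : n ≠ 0 := by
    rintro rfl
    omega
  have hmp : m < p := by
    have := Nat.le_mul_of_pos_right m (Nat.pos_of_ne_zero hn0)
    omega
  have hnp : ¬ p ∣ n := by
    intro h
    have := Nat.le_of_dvd (Nat.pos_of_ne_zero hn0) h
    have := Nat.le_mul_of_pos_left n (Nat.pos_of_ne_zero hm0)
    omega
  obtain ⟨M, _, _, _, _, _, x, hx, y, hy, hxy, ρ, hρ, hbij⟩ := exists_SL2_extension k p hnp
  set Z : Subgroup (M ≃ₐ[RatFunc k] M) := (Subgroup.center SL(2, ZMod p)).comap ρ with hZ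
  set L := IntermediateField.fixedField Z
  have hfix : ∀ τ : M ≃ₐ[RatFunc k] M,
      (∀ u ∈ additiveRoots p (algebraMap (RatFunc k) M (RatFunc.X ^ n)), mooreDet p u (τ u) = 0) →
      ∀ w : L, τ (algebraMap L M w) = algebraMap L M w := by
    intro τ hτ w
    exact w.2 ⟨τ, (hρ τ).mem_center hx hy hxy hτ⟩
  have hlift : ∀ σ : L ≃ₐ[RatFunc k] L, ∃ τ : M ≃ₐ[RatFunc k] M,
      ∀ w, algebraMap L M (σ w) = τ (algebraMap L M w) := by
    intro σ
    obtain ⟨τ, hτ, -⟩ := IntermediateField.exists_lift_fixedField Z σ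
    exact ⟨τ, hτ⟩
  have hsq : ∀ u ∈ additiveRoots p (algebraMap (RatFunc k) M (RatFunc.X ^ n)),
      ∃ w : L, algebraMap L M w = u ^ 2 := by
    intro u hu
    refine ⟨⟨u ^ 2, ?_⟩, rfl⟩
    rintro ⟨τ, hτ⟩
    change τ (u ^ 2) = u ^ 2
    rcases (hρ τ).eq_or_eq_neg_of_mem_center hx hy hxy hτ hu with h | h <;> rw [map_pow, h]
    rw [neg_sq]
  have hcharL : CharP L p := (algebraMap L M).charP (algebraMap L M).injective p
  have e : (L ≃ₐ[RatFunc k] L) ≃* PSL₂ (ZMod p) :=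
    (IsGalois.normalAutEquivQuotient Z).symm.trans
      (QuotientGroup.congr Z _ (MulEquiv.ofBijective ρ hbij)
        (Subgroup.map_comap_eq_self_of_surjective hbij.2 _))
  have hSN : SquareNormalizing p (L ≃ₐ[RatFunc k] L) := (squareNormalizing_PSL₂ hp hp2).of_mulEquiv e
  refine ⟨L, inferInstance, inferInstance, inferInstance, inferInstance, ⟨e⟩, ?_, ?_⟩
  · obtain ⟨O', hO'⟩ := ValuationSubring.exists_comap_eq (L := M) (inftyPlace k)
    set O := O'.comap (algebraMap L M) with hOdef
    have hO : O.comap (algebraMap (RatFunc k) L) = inftyPlace k := by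
      rw [hOdef, ValuationSubring.comap_comap, ← IsScalarTower.algebraMap_eq, hO']
    refine ⟨O, hO, ?_⟩
    obtain ⟨x₀, hx₀, hx₀0, hx₀O⟩ := exists_mem_additiveRoots_mem O' hx hy hxy
    obtain ⟨u, hu, hu0, huO⟩ := exists_mem_additiveRoots_notMem hn0 hO' hx hy hxy
    obtain ⟨δ, hδ⟩ := hsq x₀ hx₀
    obtain ⟨w, hw⟩ := hsq u hu
    have hδO : δ ∈ O := by
      change algebraMap L M δ ∈ O'
      rw [hδ]
      exact pow_mem hx₀O 2
    have hwO : w ^ ((p - 1) / 2) ∉ O := by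
      change algebraMap L M (w ^ ((p - 1) / 2)) ∉ O'
      rw [algebraMap_pow_half hp2 hw]
      exact ValuationSubring.pow_pred_notMem huO
    have hz : O.valuation (δ ^ m * algebraMap (RatFunc k) L (((RatFunc.X : RatFunc k)⁻¹)⁻¹ ^ 1)) = 1 := by
      have h1 := mul_sub_pow_eq_one_of_algebraMap hx₀0 hx₀ (algebraMap_pow_half hp2 hδ)
      rw [map_pow] at h1
      obtain ⟨h2, h3⟩ := mul_X_pow_eq_and_mem_nonunits hO hn0 h1 (pow_mem hδO _)
      rw [hn, pow_mul] at h2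
      have h4 : O.valuation (1 + ((δ ^ m) ^ n) ^ (p + 1)) = 1 := by
        refine (Valuation.map_add_eq_of_lt_left _ ?_).trans (map_one _)
        rw [map_one, ← ValuationSubring.mem_nonunits_iff, ← pow_mul δ, ← hn, pow_succ]
        exact ValuationSubring.mul_mem_nonunits (pow_mem (ValuationSubring.nonunits_mem h3) _) h3
      rw [← h2, ← mul_pow, map_pow] at h4
      rw [inv_inv, pow_one]
      exact (pow_eq_one_iff.mp h4).resolve_right hn0
    refine (isRationalPlace_inftyPlace k).exists_wild_subgroup hO hm0 hp.ne_zero hz ?_ ?_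
    · intro N hN
      refine hSN.card_dvd_of_pow_eq_one fun σ hσ => ?_
      exact pow_card_eq_one_of_div_sub_one_mem hp2 hlift hfix hO hx₀ hx₀0 hδ hδO (hN σ hσ).1 (hN σ hσ).2
    · refine Nat.Coprime.mul_dvd_of_dvd_of_dvd ?_ ?_ ?_
      · exact (Nat.Prime.coprime_iff_not_dvd hp).mpr fun h =>
          absurd (Nat.le_of_dvd (Nat.pos_of_ne_zero hm0) h) (not_le.mpr hmp)
      · have h1 := mul_sub_pow_eq_one_of_algebraMap hu0 hu (algebraMap_pow_half hp2 hw)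
        rw [map_pow] at h1
        exact dvd_card_stabilizer_of_notMem hO hnp h1 hwO
      · exact (isRationalPlace_inftyPlace k).dvd_card_of_valuation_eq_one hO hz hm0
          (Nat.coprime_one_right m)
  · intro O hO σ _ hσ
    refine eq_one_of_inertia hp2 hlift hfix hsq (T := RatFunc.X ^ n) ?_ hσ
    have := hO (Polynomial.X ^ n)
    rwa [map_pow, RatFunc.algebraMap_X] at this

end PSL2Cover

section AlternatingPolynomial

open Polynomial

/-- The roots in `L` of `u ^ (p - 2) * (u + 1) ^ 2 = T`. -/
def alternatingRoots (p : ℕ) {L : Type*} [Field L] (T : L) : Set L :=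
  {u | u ^ (p - 2) * (u + 1) ^ 2 = T}

lemma exists_ringHom_of_splits {K L M : Type*} [Field K] [Field L] [Field M] [Algebra K L]
    (f : K[X]) [f.IsSplittingField K L] (i : K →+* M) (h : (f.map i).Splits) :
    ∃ ψ : L →+* M, ∀ x, ψ (algebraMap K L x) = i x := by
  let := i.toAlgebra
  exact ⟨(IsSplittingField.lift L f h).toRingHom, fun x => (IsSplittingField.lift L f h).commutes x⟩

variable {K : Type} [Field K] {p : ℕ} [Fact p.Prime] [CharP K p]

lemma natCast_sub_two : ((p - 2 : ℕ) : K) = -2 := by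
  have := (Fact.out : p.Prime).two_le
  rw [Nat.cast_sub this, CharP.cast_eq_zero K p]
  simp

lemma two_ne_zero_of_charP (hp2 : p ≠ 2) : (2 : K) ≠ 0 := by
  intro h
  have : ((2 : ℕ) : K) = 0 := by exact_mod_cast h
  rw [CharP.cast_eq_zero_iff K p] at this
  exact hp2 ((Nat.prime_dvd_prime_iff_eq Fact.out Nat.prime_two).mp this)

lemma derivative_alternating (hp2 : p ≠ 2) (T : K) :
    derivative ((X : K[X]) ^ (p - 2) * (X + 1) ^ 2 - C T) = -2 * X ^ (p - 3) * (X + 1) := by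
  have hp3 : 3 ≤ p := lt_of_le_of_ne (Fact.out : p.Prime).two_le hp2.symm
  have h2 : ((p - 2 : ℕ) : K[X]) = -2 := by
    rw [← map_natCast C, natCast_sub_two, C_neg]
    rfl
  have h3 : p - 2 = (p - 3) + 1 := by omega
  simp only [derivative_sub, derivative_mul, derivative_pow, derivative_add,
    derivative_X, derivative_one, derivative_C]
  rw [map_natCast, h2, show p - 2 - 1 = p - 3 by omega, h3, map_natCast, Nat.cast_ofNat]
  ring

lemma separable_alternating (hp2 : p ≠ 2) {T : K} (hT : T ≠ 0) :
    ((X : K[X]) ^ (p - 2) * (X + 1) ^ 2 - C T).Separable := by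
  have hp3 : 3 ≤ p := lt_of_le_of_ne (Fact.out : p.Prime).two_le hp2.symm
  refine ⟨-C T⁻¹, -C (T⁻¹ * 2⁻¹) * X * (X + 1), ?_⟩
  rw [derivative_alternating hp2]
  have h2 : (C (2⁻¹ : K)) * 2 = 1 := by
    rw [show (2 : K[X]) = C 2 from rfl, ← C_mul, inv_mul_cancel₀ (two_ne_zero_of_charP hp2), C_1]
  have h3 : p - 2 = (p - 3) + 1 := by omega
  have h4 : C T⁻¹ * C T = 1 := by rw [← C_mul, inv_mul_cancel₀ hT, C_1]
  rw [h3, C_mul]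
  linear_combination h4 + C T⁻¹ * X ^ (p - 3 + 1) * (X + 1) ^ 2 * h2

lemma natDegree_alternating (hp2 : p ≠ 2) (T : K) :
    ((X : K[X]) ^ (p - 2) * (X + 1) ^ 2 - C T).natDegree = p := by
  have hp3 : 3 ≤ p := lt_of_le_of_ne (Fact.out : p.Prime).two_le hp2.symm
  rw [show (X + 1 : K[X]) = X + C 1 from rfl, natDegree_sub_C,
    Monic.natDegree_mul (monic_X_pow _) ((monic_X_add_C (1 : K)).pow 2),
    natDegree_X_pow, natDegree_pow, natDegree_X_add_C]
  omega

lemma mem_rootSet_alternating (hp2 : p ≠ 2) {L : Type*} [Field L] [Algebra K L] {T : K} :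
    ((X : K[X]) ^ (p - 2) * (X + 1) ^ 2 - C T).rootSet L = alternatingRoots p (algebraMap K L T) := by
  ext u
  have h0 : (X : K[X]) ^ (p - 2) * (X + 1) ^ 2 - C T ≠ 0 := by
    apply ne_zero_of_natDegree_gt (n := 0)
    rw [natDegree_alternating hp2]
    exact (Fact.out : p.Prime).pos
  rw [mem_rootSet_of_ne h0]
  simp [alternatingRoots, sub_eq_zero]

/-- The splitting field of `u ^ (p - 2) * (u + 1) ^ 2 = T`, with its semilinear automorphisms. -/
lemma exists_alternating_extension (hp2 : p ≠ 2) {T : K} (hT : T ≠ 0) :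
    ∃ (L : Type) (_ : Field L) (_ : Algebra K L), FiniteDimensional K L ∧ IsGalois K L ∧
      Nat.card (alternatingRoots p (algebraMap K L T)) = p ∧
      Algebra.adjoin K (alternatingRoots p (algebraMap K L T)) = ⊤ ∧
      ∀ φ : K ≃+* K, φ T = T →
        ∃ ψ : L ≃+* L, ∀ x, ψ (algebraMap K L x) = algebraMap K L (φ x) := by
  set F : K[X] := X ^ (p - 2) * (X + 1) ^ 2 - C T with hF
  have hsplit := SplittingField.splits F
  have hroot := mem_rootSet_alternating (K := K) (L := F.SplittingField) hp2 (T := T)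
  have hcard : Nat.card (alternatingRoots p (algebraMap K F.SplittingField T)) = p := by
    rw [← hroot, Nat.card_eq_fintype_card, card_rootSet_eq_natDegree (separable_alternating hp2 hT) hsplit,
      natDegree_alternating hp2]
  have hadj : Algebra.adjoin K (alternatingRoots p (algebraMap K F.SplittingField T)) = ⊤ := by
    rw [← hroot]
    exact SplittingField.adjoin_rootSet F
  refine ⟨F.SplittingField, inferInstance, inferInstance, inferInstance,
    IsGalois.of_separable_splitting_field (separable_alternating hp2 hT), hcard, hadj, ?_⟩
  intro φ hφ
  have hmap : F.map (φ : K →+* K) = F := by simp [hF, hφ]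
  obtain ⟨ψ, hψ⟩ := exists_ringHom_of_splits (L := F.SplittingField) F
    ((algebraMap K F.SplittingField).comp (φ : K →+* K)) (by rwa [← Polynomial.map_map, hmap])
  have hfin : Finite (alternatingRoots p (algebraMap K F.SplittingField T)) :=
    Nat.finite_of_card_ne_zero (by rw [hcard]; exact (Fact.out : p.Prime).ne_zero)
  have hψR : ∀ u ∈ alternatingRoots p (algebraMap K F.SplittingField T),
      ψ u ∈ alternatingRoots p (algebraMap K F.SplittingField T) := by
    intro u hu
    have h1 := congrArg ψ (show u ^ (p - 2) * (u + 1) ^ 2 = _ from hu)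
    rw [hψ] at h1
    simpa [alternatingRoots, hφ] using h1
  refine ⟨RingEquiv.ofBijective ψ ⟨ψ.injective, fun y => ?_⟩, hψ⟩
  have hy : y ∈ Algebra.adjoin K (alternatingRoots p (algebraMap K F.SplittingField T)) := by
    rw [hadj]
    trivial
  induction hy using Algebra.adjoin_induction with
  | mem u hu =>
    have := Finite.surjective_of_injective (f := fun u : alternatingRoots p
      (algebraMap K F.SplittingField T) => (⟨ψ u, hψR u u.2⟩ : alternatingRoots p _))
      (fun a b h => Subtype.ext (ψ.injective (congrArg Subtype.val h)))
    obtain ⟨v, hv⟩ := this ⟨u, hu⟩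
    exact ⟨v, congrArg Subtype.val hv⟩
  | algebraMap x => exact ⟨algebraMap K _ (φ.symm x), by rw [hψ]; simp⟩
  | add a b _ _ ha hb =>
    obtain ⟨a', rfl⟩ := ha
    obtain ⟨b', rfl⟩ := hb
    exact ⟨a' + b', map_add _ _ _⟩
  | mul a b _ _ ha hb =>
    obtain ⟨a', rfl⟩ := ha
    obtain ⟨b', rfl⟩ := hb
    exact ⟨a' * b', map_mul _ _ _⟩

end AlternatingPolynomial

section AlternatingInfinity

open WithZero
open scoped Polynomial Pointwise

section Generic

variable {p : ℕ} [Fact p.Prime] {L : Type*} [Field L] {T u v : L}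

lemma ne_zero_of_mem_alternatingRoots (hp5 : 5 ≤ p) (hT : T ≠ 0) (hu : u ∈ alternatingRoots p T) :
    u ≠ 0 := by
  rintro rfl
  apply hT
  rw [← show _ = T from hu, zero_pow (by omega), zero_mul]

lemma inv_pow_mul_of_mem_alternatingRoots (hp5 : 5 ≤ p) (hT : T ≠ 0)
    (hu : u ∈ alternatingRoots p T) : u⁻¹ ^ p * T = (1 + u⁻¹) ^ 2 := by
  have hu0 := ne_zero_of_mem_alternatingRoots hp5 hT hu
  obtain ⟨q, rfl⟩ : ∃ q, p = q + 2 := ⟨p - 2, by omega⟩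
  rw [← show _ = T from hu, Nat.add_sub_cancel, inv_pow, pow_add]
  field_simp

lemma inv_sub_inv_pow_mul_of_mem_alternatingRoots [CharP L p] (hp5 : 5 ≤ p) (hT : T ≠ 0)
    (hu : u ∈ alternatingRoots p T) (hv : v ∈ alternatingRoots p T) (huv : u ≠ v) :
    (u⁻¹ - v⁻¹) ^ (p - 1) * T = 2 + u⁻¹ + v⁻¹ := by
  have h1 := inv_pow_mul_of_mem_alternatingRoots hp5 hT hu
  have h2 := inv_pow_mul_of_mem_alternatingRoots hp5 hT hv
  have h3 : u⁻¹ - v⁻¹ ≠ 0 := sub_ne_zero.mpr (inv_injective.ne huv)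
  apply mul_left_cancel₀ h3
  rw [← mul_assoc, mul_pow_sub_one (Fact.out : p.Prime).ne_zero, sub_pow_char]
  linear_combination h1 - h2

end Generic

variable {p : ℕ} [Fact p.Prime] {k L : Type} [Field k] [CharP k p] [IsAlgClosed k] [Field L]
  [Algebra (RatFunc k) L] [IsGalois (RatFunc k) L] [FiniteDimensional (RatFunc k) L] {n : ℕ}
  {O : ValuationSubring L} {a b u v : L}

lemma algebraMap_X_pow_ne_zero (n : ℕ) : algebraMap (RatFunc k) L (RatFunc.X ^ n) ≠ 0 := by
  rw [map_pow]
  exact pow_ne_zero _ ((map_ne_zero _).mpr RatFunc.X_ne_zero)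

lemma inv_mem_nonunits_of_mem_alternatingRoots (hn : n ≠ 0)
    (hO : O.comap (algebraMap (RatFunc k) L) = inftyPlace k)
    (hu : u ∈ alternatingRoots p (algebraMap (RatFunc k) L (RatFunc.X ^ n))) :
    u⁻¹ ∈ O.nonunits := by
  by_contra h
  have h1 := ValuationSubring.inv_mem_of_notMem_nonunits h
  rw [inv_inv] at h1
  have h2 : algebraMap (RatFunc k) L (RatFunc.X ^ n) ∈ O := by
    rw [← show _ = algebraMap (RatFunc k) L (RatFunc.X ^ n) from hu]
    exact mul_mem (pow_mem h1 _) (pow_mem (add_mem h1 (one_mem _)) _)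
  rw [map_pow] at h2
  have h3 := ValuationSubring.mul_mem_nonunits (ValuationSubring.mem_of_pow_mem hn h2)
    (algebraMap_X_notMem hO)
  rw [mul_inv_cancel₀ ((map_ne_zero _).mpr RatFunc.X_ne_zero)] at h3
  exact O.one_notMem_nonunits h3

lemma valuation_natCast_add (hO : O.comap (algebraMap (RatFunc k) L) = inftyPlace k) {j : ℕ}
    (hj : (j : k) ≠ 0) {ε : L} (hε : ε ∈ O.nonunits) : O.valuation (j + ε) = 1 := by
  have h1 : O.valuation (j : L) = 1 := by
    have h2 := (isRationalPlace_inftyPlace k).algebraMap_algebraMap_mem hO (j : k)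
    have h3 := (isRationalPlace_inftyPlace k).algebraMap_notMem_nonunits hO hj
    rw [map_natCast, map_natCast] at h2 h3
    rw [ValuationSubring.mem_nonunits_iff, not_lt] at h3
    exact le_antisymm ((O.valuation_le_one_iff _).mpr h2) h3
  rw [Valuation.map_add_eq_of_lt_left, h1]
  rw [h1]
  exact hε

lemma valuation_inv_sub_inv_pow_mul [CharP L p] (hp5 : 5 ≤ p) (hn : n ≠ 0)
    (hO : O.comap (algebraMap (RatFunc k) L) = inftyPlace k)
    (hu : u ∈ alternatingRoots p (algebraMap (RatFunc k) L (RatFunc.X ^ n)))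
    (hv : v ∈ alternatingRoots p (algebraMap (RatFunc k) L (RatFunc.X ^ n))) (huv : u ≠ v) :
    O.valuation ((u⁻¹ - v⁻¹) ^ (p - 1) * algebraMap (RatFunc k) L (RatFunc.X ^ n)) = 1 := by
  rw [inv_sub_inv_pow_mul_of_mem_alternatingRoots hp5 (algebraMap_X_pow_ne_zero n) hu hv huv,
    add_assoc]
  have h2 : ((2 : ℕ) : k) ≠ 0 := by
    rw [Nat.cast_ofNat]
    exact two_ne_zero_of_charP (p := p) (by omega)
  exact_mod_cast valuation_natCast_add hO h2 (add_mem (inv_mem_nonunits_of_mem_alternatingRoots hn hO hu)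
    (inv_mem_nonunits_of_mem_alternatingRoots hn hO hv))

lemma valuation_inv_sub_inv_div [CharP L p] (hp5 : 5 ≤ p) (hn : n ≠ 0)
    (hO : O.comap (algebraMap (RatFunc k) L) = inftyPlace k)
    (ha : a ∈ alternatingRoots p (algebraMap (RatFunc k) L (RatFunc.X ^ n)))
    (hb : b ∈ alternatingRoots p (algebraMap (RatFunc k) L (RatFunc.X ^ n))) (hab : a ≠ b)
    (hu : u ∈ alternatingRoots p (algebraMap (RatFunc k) L (RatFunc.X ^ n)))
    (hv : v ∈ alternatingRoots p (algebraMap (RatFunc k) L (RatFunc.X ^ n))) (huv : u ≠ v) :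
    O.valuation ((a⁻¹ - b⁻¹) / (u⁻¹ - v⁻¹)) = 1 := by
  have h1 := valuation_inv_sub_inv_pow_mul hp5 hn hO ha hb hab
  have h2 := valuation_inv_sub_inv_pow_mul hp5 hn hO hu hv huv
  refine (pow_eq_one_iff.mp ?_).resolve_right (show p - 1 ≠ 0 by omega)
  rw [← map_pow, div_pow, ← mul_div_mul_right _ _ (algebraMap_X_pow_ne_zero (k := k) (L := L) n),
    map_div₀, h1, h2, div_one]

/-- A tame-trivial element of the decomposition group at infinity fixing a root is trivial. -/
lemma apply_eq_of_div_sub_one_mem [CharP L p] (hp5 : 5 ≤ p) (hn : n ≠ 0)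
    (hO : O.comap (algebraMap (RatFunc k) L) = inftyPlace k)
    (hu : u ∈ alternatingRoots p (algebraMap (RatFunc k) L (RatFunc.X ^ n)))
    (hv : v ∈ alternatingRoots p (algebraMap (RatFunc k) L (RatFunc.X ^ n))) (huv : u ≠ v)
    {σ : L ≃ₐ[RatFunc k] L} (hσ : σ • O = O)
    (h1 : σ (u⁻¹ - v⁻¹) / (u⁻¹ - v⁻¹) - 1 ∈ O.nonunits)
    (ha : a ∈ alternatingRoots p (algebraMap (RatFunc k) L (RatFunc.X ^ n))) (hσa : σ a = a)
    (hb : b ∈ alternatingRoots p (algebraMap (RatFunc k) L (RatFunc.X ^ n))) : σ b = b := by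
  by_contra hne
  have hab : a ≠ b := by
    rintro rfl
    exact hne hσa
  have hσb : σ b ∈ alternatingRoots p (algebraMap (RatFunc k) L (RatFunc.X ^ n)) := by
    have := congrArg σ (show b ^ (p - 2) * (b + 1) ^ 2 = _ from hb)
    simpa [alternatingRoots] using this
  have hδ : u⁻¹ - v⁻¹ ≠ 0 := sub_ne_zero.mpr (inv_injective.ne huv)
  have h2 := valuation_inv_sub_inv_div hp5 hn hO ha hb hab hu hv huv
  have h3 := valuation_inv_sub_inv_div hp5 hn hO hb hσb (Ne.symm hne) hu hv huv
  have hw := (O.valuation_le_one_iff _).mp h2.le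
  have hη := (isRationalPlace_inftyPlace k).sub_mem_nonunits hO hσ hw
  set w := (a⁻¹ - b⁻¹) / (u⁻¹ - v⁻¹) with hwd
  set δ := u⁻¹ - v⁻¹
  have h4 : a⁻¹ - b⁻¹ = w * δ := by rw [hwd, div_mul_cancel₀ _ hδ]
  have h5 : a⁻¹ - (σ b)⁻¹ = σ w * σ δ := by
    rw [← map_mul, ← h4, map_sub, map_inv₀, map_inv₀, hσa]
  have h6 : (b⁻¹ - (σ b)⁻¹) / δ = σ w * (σ δ / δ - 1) + (σ w - w) := by
    have : b⁻¹ - (σ b)⁻¹ = σ w * σ δ - w * δ := by rw [← h4, ← h5]; ring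
    rw [this]
    field_simp
    ring
  have h7 : (b⁻¹ - (σ b)⁻¹) / δ ∈ O.nonunits := by
    rw [h6]
    refine add_mem (ValuationSubring.mul_mem_nonunits ?_ h1) hη
    rw [← sub_add_cancel (σ w) w]
    exact add_mem (ValuationSubring.nonunits_mem hη) hw
  rw [ValuationSubring.mem_nonunits_iff, h3] at h7
  exact lt_irrefl _ h7

end AlternatingInfinity

section AlternatingAction

open WithZero
open scoped Polynomial Pointwise

/-- The roots of `u ^ (p - 2) * (u + 1) ^ 2 = T` with the Galois action. -/
def alternatingRootsAction (p : ℕ) {K : Type*} (L : Type*) [Field K] [Field L] [Algebra K L] (T : K) :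
    SubMulAction (L ≃ₐ[K] L) L where
  carrier := alternatingRoots p (algebraMap K L T)
  smul_mem' σ u hu := by
    have := congrArg σ (show u ^ (p - 2) * (u + 1) ^ 2 = _ from hu)
    simpa [alternatingRoots] using this

lemma AlgEquiv.eq_one_of_adjoin_eq_top {K L : Type*} [Field K] [Field L] [Algebra K L] {R : Set L}
    (hR : Algebra.adjoin K R = ⊤) {σ : L ≃ₐ[K] L} (h : ∀ u ∈ R, σ u = u) : σ = 1 := by
  have h1 := AlgHom.ext_of_adjoin_eq_top (φ₁ := (σ : L →ₐ[K] L)) (φ₂ := AlgHom.id K L) hR h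
  ext x
  exact DFunLike.congr_fun h1 x

variable {p : ℕ} [Fact p.Prime] {k L : Type} [Field k] [CharP k p] [IsAlgClosed k] [Field L]
  [Algebra (RatFunc k) L] [IsGalois (RatFunc k) L] [FiniteDimensional (RatFunc k) L] {n : ℕ}
  {O : ValuationSubring L} {a b u v : L}

lemma exists_wild_subgroup_alternating [CharP L p] (hp5 : 5 ≤ p) {m r : ℕ} (hmr : (p - 1) / 2 = m * r)
    (hn : n = 2 * (p - 2) * r)
    (hcard : Nat.card (alternatingRoots p (algebraMap (RatFunc k) L (RatFunc.X ^ n))) = p)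
    (hadj : Algebra.adjoin (RatFunc k)
      (alternatingRoots p (algebraMap (RatFunc k) L (RatFunc.X ^ n))) = ⊤)
    (hO : O.comap (algebraMap (RatFunc k) L) = inftyPlace k) :
    ∃ N ≤ MulAction.stabilizer (L ≃ₐ[RatFunc k] L) O,
      MulAction.stabilizer (L ≃ₐ[RatFunc k] L) O ≤ Subgroup.normalizer (N : Set (L ≃ₐ[RatFunc k] L)) ∧
      Nat.card N = p ∧ Nat.card (MulAction.stabilizer (L ≃ₐ[RatFunc k] L) O) = p * m := by
  have hp : p.Prime := Fact.out
  have hodd : 2 * ((p - 1) / 2) = p - 1 := Nat.mul_div_cancel' (hp.even_sub_one (by omega)).two_dvd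
  have hm0 : m ≠ 0 := by
    rintro rfl
    omega
  have hr0 : r ≠ 0 := by
    rintro rfl
    omega
  have hn0 : n ≠ 0 := by
    rw [hn]
    exact mul_ne_zero (mul_ne_zero two_ne_zero (by omega)) hr0
  have hmp : m < p := by
    have := Nat.le_mul_of_pos_right m (Nat.pos_of_ne_zero hr0)
    omega
  have hpn : ¬ p ∣ n := by
    rw [hn, hp.dvd_mul, hp.dvd_mul]
    rintro ((h | h) | h)
    · have := Nat.le_of_dvd two_pos h
      omega
    · have := Nat.le_of_dvd (by omega) h
      omega
    · have := Nat.le_of_dvd (Nat.pos_of_ne_zero hr0) h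
      have := Nat.le_mul_of_pos_left r (Nat.pos_of_ne_zero hm0)
      omega
  have hfin : Finite (alternatingRoots p (algebraMap (RatFunc k) L (RatFunc.X ^ n))) :=
    Nat.finite_of_card_ne_zero (by rw [hcard]; exact hp.ne_zero)
  have hnt : Nontrivial (alternatingRoots p (algebraMap (RatFunc k) L (RatFunc.X ^ n))) :=
    Finite.one_lt_card_iff_nontrivial.mp (by rw [hcard]; exact hp.one_lt)
  obtain ⟨⟨u, hu⟩, ⟨v, hv⟩, huv⟩ := exists_pair_ne (alternatingRoots p (algebraMap (RatFunc k) L (RatFunc.X ^ n)))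
  have huv : u ≠ v := fun h => huv (Subtype.ext h)
  have hz : O.valuation ((u⁻¹ - v⁻¹) ^ m *
      algebraMap (RatFunc k) L (((RatFunc.X : RatFunc k)⁻¹)⁻¹ ^ (p - 2))) = 1 := by
    have h1 := valuation_inv_sub_inv_pow_mul hp5 hn0 hO hu hv huv
    rw [← hodd, hmr, hn, show 2 * (m * r) = m * (2 * r) by ring,
      show 2 * (p - 2) * r = (p - 2) * (2 * r) by ring, pow_mul, pow_mul RatFunc.X, map_pow, ← mul_pow,
      map_pow] at h1
    rw [inv_inv]
    exact (pow_eq_one_iff.mp h1).resolve_right (mul_ne_zero two_ne_zero hr0)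
  refine (isRationalPlace_inftyPlace k).exists_wild_subgroup hO hm0 hp.ne_zero hz ?_ ?_
  · intro N hN
    have hfree : ∀ b : alternatingRootsAction p L ((RatFunc.X : RatFunc k) ^ n),
        MulAction.stabilizer N b = ⊥ := by
      intro b
      rw [eq_bot_iff]
      intro σ hσ
      have h1 : σ.1 b.1 = b.1 := congrArg Subtype.val hσ
      obtain ⟨h2, h3⟩ := hN σ.1 σ.2
      exact Subtype.ext (AlgEquiv.eq_one_of_adjoin_eq_top hadj fun c hc =>
        apply_eq_of_div_sub_one_mem hp5 hn0 hO hu hv huv h2 h3 b.2 h1 hc)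
    have h1 := Nat.card_congr (MulAction.selfEquivOrbitsQuotientProd hfree)
    rw [Nat.card_prod] at h1
    rw [← hcard]
    exact Dvd.intro_left _ h1.symm
  · refine Nat.Coprime.mul_dvd_of_dvd_of_dvd ?_ ?_ ?_
    · exact (Nat.Prime.coprime_iff_not_dvd hp).mpr fun h =>
        absurd (Nat.le_of_dvd (Nat.pos_of_ne_zero hm0) h) (not_le.mpr hmp)
    · refine (isRationalPlace_inftyPlace k).dvd_card_of_valuation_eq_one hO (δ := u⁻¹) (s := n) ?_
        hp.ne_zero ((Nat.Prime.coprime_iff_not_dvd hp).mpr hpn)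
      rw [inv_inv, inv_pow_mul_of_mem_alternatingRoots hp5 (algebraMap_X_pow_ne_zero n) hu, map_pow]
      have h1 := valuation_natCast_add hO (j := 1) (by simp)
        (inv_mem_nonunits_of_mem_alternatingRoots hn0 hO hu)
      rw [Nat.cast_one] at h1
      rw [h1, one_pow]
    · refine (isRationalPlace_inftyPlace k).dvd_card_of_valuation_eq_one hO hz hm0 ?_
      have h1 : m ∣ p - 1 := by
        rw [← hodd, hmr, ← mul_assoc, mul_comm 2, mul_assoc]
        exact dvd_mul_right _ _
      refine Nat.Coprime.coprime_dvd_left h1 ?_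
      rw [show p - 1 = (p - 2) + 1 by omega]
      simp

end AlternatingAction

section AlternatingFinite

open scoped Polynomial Pointwise

variable {p : ℕ} [Fact p.Prime] {L : Type} [Field L] [CharP L p] {O : ValuationSubring L}

lemma natCast_notMem_nonunits {e : ℕ} (he : e ≠ 0) (hep : e < p) : (e : L) ∉ O.nonunits := by
  intro h
  have h1 : (e : L) = ZMod.castHom (dvd_refl p) L (e : ZMod p) := by rw [map_natCast]
  rw [h1] at h
  have h2 := castHom_eq_zero_of_mem_nonunits h
  rw [CharP.cast_eq_zero_iff (ZMod p) p] at h2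
  exact absurd (Nat.le_of_dvd (Nat.pos_of_ne_zero he) h2) (not_le.mpr hep)

open Polynomial in
/-- Roots of `y ^ e * (c + b * y) ^ f = d` with `e + f = p`, `c = ±1` and `d` a unit are determined by
their residues. -/
lemma eq_of_pow_mul_pow_eq {e f : ℕ} (hef : e + f = p) (he : e ≠ 0) (hf : f ≠ 0) {b c y z : L}
    (hb : b ∈ O) (hc : c ^ 2 = 1) (hy : y ∈ O) (hz : z ∈ O)
    (h : z ^ e * (c + b * z) ^ f = y ^ e * (c + b * y) ^ f) (hzy : z - y ∈ O.nonunits)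
    (hd : y ^ e * (c + b * y) ^ f ∉ O.nonunits) : z = y := by
  by_contra hne
  have hcO : c ∈ O := ValuationSubring.mem_of_pow_mem two_ne_zero (hc ▸ one_mem _)
  obtain ⟨e, rfl⟩ := Nat.exists_eq_succ_of_ne_zero he
  obtain ⟨f, rfl⟩ := Nat.exists_eq_succ_of_ne_zero hf
  set g : O[X] := X ^ (e + 1) * (C ⟨c, hcO⟩ + C ⟨b, hb⟩ * X) ^ (f + 1) with hg
  have hpO : ((e : O) + 1) + ((f : O) + 1) = 0 := by
    apply Subtype.ext
    have : (((e + 1) + (f + 1) : ℕ) : L) = 0 := by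
      rw [← CharP.cast_eq_zero L p, ← hef]
    push_cast at this
    simpa using this
  have hder : (derivative g).eval ⟨y, hy⟩ =
      ((e + 1 : ℕ) : O) * ⟨c, hcO⟩ * (⟨y, hy⟩ ^ e * (⟨c, hcO⟩ + ⟨b, hb⟩ * ⟨y, hy⟩) ^ f) := by
    simp only [hg, derivative_mul, derivative_pow, derivative_add, derivative_X,
      derivative_C, eval_mul, eval_add, eval_pow, eval_X, eval_C, eval_natCast, eval_one, eval_zero,
      Nat.add_sub_cancel, map_natCast]
    push_cast
    linear_combination ((⟨b, hb⟩ : O) * ⟨y, hy⟩ ^ (e + 1) * (⟨c, hcO⟩ + ⟨b, hb⟩ * ⟨y, hy⟩) ^ f) * hpO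
  obtain ⟨q, hq⟩ := binomExpansion g (⟨y, hy⟩ : O) (⟨z, hz⟩ - ⟨y, hy⟩)
  have hgz : g.eval ⟨z, hz⟩ = g.eval ⟨y, hy⟩ := by
    apply Subtype.ext
    simpa [hg] using h
  rw [add_sub_cancel, hgz, hder] at hq
  have hq := congrArg Subtype.val hq
  simp only [AddMemClass.coe_add, MulMemClass.coe_mul, SubmonoidClass.coe_pow,
    AddSubgroupClass.coe_sub] at hq
  have h1 : ((e + 1 : ℕ) : L) * c * (y ^ e * (c + b * y) ^ f) = - q * (z - y) := by
    apply mul_right_cancel₀ (sub_ne_zero.mpr hne)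
    have : (((e + 1 : ℕ) : O) : L) = ((e + 1 : ℕ) : L) := by norm_cast
    rw [this] at hq
    linear_combination - hq
  have h2 : ((e + 1 : ℕ) : L) * (c * (y ^ e * (c + b * y) ^ f)) ∈ O.nonunits := by
    rw [← mul_assoc, h1]
    exact ValuationSubring.mul_mem_nonunits (neg_mem q.2) hzy
  have hw : c + b * y ∈ O := add_mem hcO (mul_mem hb hy)
  rcases ValuationSubring.mem_or_mem_of_mul_mem_nonunits h2 with h3 | h3
  · exact natCast_notMem_nonunits (p := p) (Nat.succ_ne_zero e) (by omega) h3
  · apply hd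
    have h4 := ValuationSubring.mul_mem_nonunits (mul_mem hcO (mul_mem hy hw)) h3
    have h5 : y ^ (e + 1) * (c + b * y) ^ (f + 1) =
      c * (y * (c + b * y)) * (c * (y ^ e * (c + b * y) ^ f)) := by
      linear_combination - (y ^ (e + 1) * (c + b * y) ^ (f + 1)) * hc
    rw [h5]
    exact h4

variable {u a b : L} {σ : L ≃+* L}

lemma notMem_nonunits_of_add_one_mem (h : u + 1 ∈ O.nonunits) : u ∉ O.nonunits := fun hu =>
  O.one_notMem_nonunits (by simpa using sub_mem h hu)

/-- The normalized root at a place where `u` vanishes. -/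
lemma div_mem_of_mem_nonunits (hp5 : 5 ≤ p) (hu : u ∈ O.nonunits) (hb0 : b ≠ 0)
    (h : u ^ (p - 2) * (u + 1) ^ 2 = b ^ (p - 2)) :
    u / b ∈ O ∧ (u / b) ^ (p - 2) * (1 + b * (u / b)) ^ 2 = 1 := by
  have h0 : (u / b) ^ (p - 2) * (1 + b * (u / b)) ^ 2 = 1 := by
    rw [mul_div_cancel₀ _ hb0, div_pow, add_comm 1 u, div_mul_eq_mul_div, h,
      div_self (pow_ne_zero _ hb0)]
  refine ⟨ValuationSubring.mem_of_pow_mem (n := p - 2) (by omega) ?_, h0⟩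
  rw [mul_div_cancel₀ _ hb0] at h0
  have h1 : (1 + u)⁻¹ ∈ O := by
    refine ValuationSubring.inv_mem_of_notMem_nonunits fun h2 => O.one_notMem_nonunits ?_
    simpa using sub_mem h2 hu
  rw [eq_inv_of_mul_eq_one_left h0, ← inv_pow]
  exact pow_mem h1 2

/-- The normalized root at a place where `u + 1` vanishes. -/
lemma div_mem_of_add_one_mem_nonunits (hu : u + 1 ∈ O.nonunits) (ha0 : a ≠ 0)
    (h : u ^ (p - 2) * (u + 1) ^ 2 = a ^ 2) :
    (u + 1) / a ∈ O ∧ ((u + 1) / a) ^ 2 * (-1 + a * ((u + 1) / a)) ^ (p - 2) = 1 := by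
  have h0 : ((u + 1) / a) ^ 2 * (-1 + a * ((u + 1) / a)) ^ (p - 2) = 1 := by
    rw [mul_div_cancel₀ _ ha0, div_pow, show -1 + (u + 1) = u by ring, div_mul_eq_mul_div, mul_comm, h,
      div_self (pow_ne_zero _ ha0)]
  refine ⟨ValuationSubring.mem_of_pow_mem two_ne_zero ?_, h0⟩
  rw [mul_div_cancel₀ _ ha0, show -1 + (u + 1) = u by ring] at h0
  rw [eq_inv_of_mul_eq_one_left h0, ← inv_pow]
  exact pow_mem (ValuationSubring.inv_mem_of_notMem_nonunits (notMem_nonunits_of_add_one_mem hu)) _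

lemma apply_eq_of_mem_nonunits (hp5 : 5 ≤ p) (hσ : ∀ f ∈ O, σ f - f ∈ O.nonunits) (hb : b ∈ O)
    (hu : u ∈ O.nonunits) (hb0 : b ≠ 0) (h : u ^ (p - 2) * (u + 1) ^ 2 = b ^ (p - 2))
    (hσb : σ b = b) : σ u = u := by
  obtain ⟨h1, h2⟩ := div_mem_of_mem_nonunits hp5 hu hb0 h
  have h3 := congrArg σ h2
  simp only [map_mul, map_pow, map_add, map_one, hσb] at h3
  have h4 : σ (u / b) ∈ O := by
    rw [← sub_add_cancel (σ (u / b)) (u / b)]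
    exact add_mem (ValuationSubring.nonunits_mem (hσ _ h1)) h1
  have h5 := eq_of_pow_mul_pow_eq (p := p) (by omega) (by omega) two_ne_zero hb (one_pow 2) h1 h4
    (h3.trans h2.symm) (hσ _ h1) (by rw [h2]; exact O.one_notMem_nonunits)
  rw [map_div₀, hσb] at h5
  exact (div_left_inj' hb0).mp h5

lemma eq_of_div_sub_div_mem_nonunits (hp5 : 5 ≤ p) {v : L} (ha : a ∈ O) (ha0 : a ≠ 0)
    (hu : u + 1 ∈ O.nonunits) (hv : v + 1 ∈ O.nonunits)
    (hua : u ^ (p - 2) * (u + 1) ^ 2 = a ^ 2) (hva : v ^ (p - 2) * (v + 1) ^ 2 = a ^ 2)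
    (h : (v + 1) / a - (u + 1) / a ∈ O.nonunits) : v = u := by
  obtain ⟨h1, h2⟩ := div_mem_of_add_one_mem_nonunits hu ha0 hua
  obtain ⟨h3, h4⟩ := div_mem_of_add_one_mem_nonunits hv ha0 hva
  have h5 := eq_of_pow_mul_pow_eq (p := p) (by omega) two_ne_zero (by omega) ha (by norm_num) h1 h3
    (h4.trans h2.symm) h (by rw [h2]; exact O.one_notMem_nonunits)
  exact add_right_cancel ((div_left_inj' ha0).mp h5)

lemma apply_eq_of_add_one_mem_nonunits (hp5 : 5 ≤ p) (hσ : ∀ f ∈ O, σ f - f ∈ O.nonunits) (ha : a ∈ O)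
    (hu : u + 1 ∈ O.nonunits) (ha0 : a ≠ 0) (h : u ^ (p - 2) * (u + 1) ^ 2 = a ^ 2)
    (hσa : σ a = a) : σ u = u := by
  obtain ⟨h1, -⟩ := div_mem_of_add_one_mem_nonunits hu ha0 h
  have huO : u + 1 ∈ O := ValuationSubring.nonunits_mem hu
  refine eq_of_div_sub_div_mem_nonunits hp5 ha ha0 hu ?_ h ?_ ?_
  · have := add_mem (hσ _ huO) hu
    rwa [sub_add_cancel, map_add, map_one] at this
  · have := congrArg σ h
    simpa [hσa] using this
  · have := hσ _ h1
    simpa [hσa] using this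

lemma apply_eq_of_pow_mul_notMem (hp5 : 5 ≤ p) (hσ : ∀ f ∈ O, σ f - f ∈ O.nonunits) (hu : u ∈ O)
    (h : u ^ (p - 2) * (u + 1) ^ 2 ∉ O.nonunits)
    (hσu : σ u ^ (p - 2) * (σ u + 1) ^ 2 = u ^ (p - 2) * (u + 1) ^ 2) : σ u = u := by
  have huO : σ u ∈ O := by
    rw [← sub_add_cancel (σ u) u]
    exact add_mem (ValuationSubring.nonunits_mem (hσ _ hu)) hu
  refine eq_of_pow_mul_pow_eq (p := p) (e := p - 2) (f := 2) (b := 1) (c := 1) (by omega) (by omega)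
    two_ne_zero (one_mem _) (one_pow 2) hu huO ?_ (hσ _ hu) ?_
  · simpa [add_comm] using hσu
  · simpa [add_comm] using h

lemma mem_of_pow_mul_pow_mem (hp5 : 5 ≤ p) (h : u ^ (p - 2) * (u + 1) ^ 2 ∈ O) : u ∈ O := by
  by_contra hu
  have h1 : u⁻¹ ∈ O.nonunits := by
    by_contra h2
    exact hu (by simpa using ValuationSubring.inv_mem_of_notMem_nonunits h2)
  have hu0 : u ≠ 0 := by
    rintro rfl
    exact hu (zero_mem _)
  have h2 : u⁻¹ ^ p * (u ^ (p - 2) * (u + 1) ^ 2) = (1 + u⁻¹) ^ 2 :=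
    inv_pow_mul_of_mem_alternatingRoots hp5 (mul_ne_zero (pow_ne_zero _ hu0)
      (pow_ne_zero 2 fun h0 => hu (by rw [eq_neg_of_add_eq_zero_left h0]; exact neg_mem (one_mem _)))) rfl
  have h3 : (1 + u⁻¹) ^ 2 ∈ O.nonunits := by
    rw [← h2, mul_comm]
    refine ValuationSubring.mul_mem_nonunits h ?_
    rw [← pow_sub_one_mul (Fact.out : p.Prime).ne_zero]
    exact ValuationSubring.mul_mem_nonunits (pow_mem (ValuationSubring.nonunits_mem h1) _) h1
  rw [sq] at h3
  have h4 : 1 + u⁻¹ ∈ O.nonunits := (ValuationSubring.mem_or_mem_of_mul_mem_nonunits h3).elim id id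
  exact O.one_notMem_nonunits (by simpa using sub_mem h4 h1)

end AlternatingFinite

section AlternatingInertia

open scoped Polynomial Pointwise

variable {p : ℕ} [Fact p.Prime] {k L : Type} [Field k] [Field L] [CharP L p]
  [Algebra (RatFunc k) L] {n r : ℕ} {O : ValuationSubring L} {u v : L}

lemma pow_eq_sq_of_eq_mul {z : L} (hn : n = 2 * (p - 2) * r) : z ^ n = (z ^ ((p - 2) * r)) ^ 2 := by
  rw [hn, ← pow_mul]
  congr 1
  ring

lemma pow_eq_pow_of_eq_mul {z : L} (hn : n = 2 * (p - 2) * r) : z ^ n = (z ^ (2 * r)) ^ (p - 2) := by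
  rw [hn, ← pow_mul]
  congr 1
  ring

lemma eq_one_of_inertia_alternating (hp5 : 5 ≤ p) (hn : n = 2 * (p - 2) * r)
    (hadj : Algebra.adjoin (RatFunc k)
      (alternatingRoots p (algebraMap (RatFunc k) L (RatFunc.X ^ n))) = ⊤)
    (hX : algebraMap (RatFunc k) L RatFunc.X ∈ O) {σ : L ≃ₐ[RatFunc k] L}
    (hσ : ∀ f ∈ O, σ f - f ∈ O.nonunits) : σ = 1 := by
  refine AlgEquiv.eq_one_of_adjoin_eq_top hadj fun u hu => ?_
  set z := algebraMap (RatFunc k) L RatFunc.X with hz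
  have hz0 : z ≠ 0 := (map_ne_zero _).mpr RatFunc.X_ne_zero
  have hσz : σ z = z := σ.commutes _
  have hu : u ^ (p - 2) * (u + 1) ^ 2 = z ^ n := by
    rw [hz, ← map_pow]
    exact hu
  have huO : u ∈ O := mem_of_pow_mul_pow_mem hp5 (hu ▸ pow_mem hX n)
  by_cases h : u ^ (p - 2) * (u + 1) ^ 2 ∈ O.nonunits
  · have h1 : u ∈ O.nonunits ∨ u + 1 ∈ O.nonunits := by
      by_contra! h2
      have h3 := mul_mem (pow_mem (ValuationSubring.inv_mem_of_notMem_nonunits h2.1) (p - 2))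
        (pow_mem (ValuationSubring.inv_mem_of_notMem_nonunits h2.2) 2)
      have h4 := ValuationSubring.mul_mem_nonunits h3 h
      rw [inv_pow, inv_pow, ← mul_inv, inv_mul_cancel₀ (by rw [hu]; exact pow_ne_zero _ hz0)] at h4
      exact O.one_notMem_nonunits h4
    rcases h1 with h1 | h1
    · exact apply_eq_of_mem_nonunits (σ := (σ : L ≃+* L)) hp5 hσ (pow_mem hX (2 * r)) h1
        (pow_ne_zero _ hz0) (hu.trans (pow_eq_pow_of_eq_mul hn)) (by simp [hσz])
    · exact apply_eq_of_add_one_mem_nonunits (σ := (σ : L ≃+* L)) hp5 hσ (pow_mem hX ((p - 2) * r)) h1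
        (pow_ne_zero _ hz0) (hu.trans (pow_eq_sq_of_eq_mul hn)) (by simp [hσz])
  · refine apply_eq_of_pow_mul_notMem (σ := (σ : L ≃+* L)) hp5 hσ huO h ?_
    rw [hu]
    have := congrArg σ hu
    simpa [hσz] using this

/-- A semilinear automorphism in the inertia group of a place over zero negating `a`
interchanges at most two roots. -/
lemma semilinear_apply (hp5 : 5 ≤ p) {σ : L ≃+* L} (hσ : ∀ f ∈ O, σ f - f ∈ O.nonunits) {a b : L}
    (haO : a ∈ O) (ha0 : a ≠ 0) (hbO : b ∈ O) (hb0 : b ≠ 0) (hab : a ^ 2 = b ^ (p - 2))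
    (hσa : σ a = -a) (hσb : σ b = b) (hu : u ∈ alternatingRoots p (a ^ 2)) (hu1 : u + 1 ∈ O.nonunits) :
    σ u ≠ u ∧ ∀ v ∈ alternatingRoots p (a ^ 2), v ∈ O.nonunits ∨ v + 1 ∈ O.nonunits →
      v = u ∨ v = σ u ∨ σ v = v := by
  have hu : u ^ (p - 2) * (u + 1) ^ 2 = a ^ 2 := hu
  obtain ⟨h1, h2⟩ := div_mem_of_add_one_mem_nonunits hu1 ha0 hu
  set y := (u + 1) / a with hy
  have h3 : (σ u + 1) / a = - σ y := by
    rw [hy, map_div₀, hσa, map_add, map_one, div_neg, neg_neg]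
  have hy2 : ∀ v, v + 1 ∈ O.nonunits → v ^ (p - 2) * (v + 1) ^ 2 = a ^ 2 →
      ((v + 1) / a) ^ 2 + 1 ∈ O.nonunits := by
    intro v hv1 hv
    obtain ⟨h4, h5⟩ := div_mem_of_add_one_mem_nonunits hv1 ha0 hv
    rw [mul_div_cancel₀ _ ha0, show -1 + (v + 1) = v by ring] at h5
    have h6 : v ∈ O := by
      rw [← add_sub_cancel_right v 1]
      exact sub_mem (ValuationSubring.nonunits_mem hv1) (one_mem _)
    have h7 : v ^ (p - 2) + 1 ∈ O.nonunits := by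
      have hodd : Odd (p - 2) := by
        have := (Fact.out : p.Prime).odd_of_ne_two (by omega)
        exact Nat.Odd.sub_even (by omega) this even_two
      obtain ⟨c, hc⟩ := hodd.add_dvd_pow_add_pow (⟨v, h6⟩ : O) 1
      have hc := congrArg Subtype.val hc
      simp only [one_pow] at hc
      have hc : v ^ (p - 2) + 1 = (v + 1) * c := hc
      rw [hc, mul_comm]
      exact ValuationSubring.mul_mem_nonunits c.2 hv1
    have h8 : ((v + 1) / a) ^ 2 + 1 = ((v + 1) / a) ^ 2 * (v ^ (p - 2) + 1) := by
      rw [mul_add, h5]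
      ring
    rw [h8]
    exact ValuationSubring.mul_mem_nonunits (pow_mem h4 2) h7
  have hyu := hy2 u hu1 hu
  rw [← hy] at hyu
  have hσy := hσ y h1
  have hu1O := ValuationSubring.nonunits_mem hu1
  have hσu1 : σ u + 1 ∈ O.nonunits := by
    have := add_mem (hσ _ hu1O) hu1
    rwa [sub_add_cancel, map_add, map_one] at this
  refine ⟨fun h => ?_, fun v hv hv1 => ?_⟩
  · rw [h] at h3
    have h4 : (2 : ℕ) * y ∈ O.nonunits := by
      have h5 : y = - σ y := hy.trans h3
      have h6 := neg_mem hσy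
      have h7 : -(σ y - y) = (2 : ℕ) * y := by
        push_cast
        linear_combination -h5
      rwa [h7] at h6
    rcases ValuationSubring.mem_or_mem_of_mul_mem_nonunits h4 with h5 | h5
    · exact natCast_notMem_nonunits (p := p) two_ne_zero (by omega) h5
    · refine O.one_notMem_nonunits ?_
      have := sub_mem hyu (ValuationSubring.mul_mem_nonunits h1 h5)
      rwa [← sq, add_sub_cancel_left] at this
  · have hv : v ^ (p - 2) * (v + 1) ^ 2 = a ^ 2 := hv
    rcases hv1 with hv1 | hv1
    · exact .inr (.inr (apply_eq_of_mem_nonunits hp5 hσ hbO hv1 hb0 (hv.trans hab) hσb))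
    · have hyv := hy2 v hv1 hv
      have h4 : ((v + 1) / a - y) * ((v + 1) / a + y) ∈ O.nonunits := by
        have := sub_mem hyv hyu
        convert this using 1
        ring
      rcases ValuationSubring.mem_or_mem_of_mul_mem_nonunits h4 with h5 | h5
      · exact .inl (eq_of_div_sub_div_mem_nonunits hp5 haO ha0 hu1 hv1 hu hv h5)
      · refine .inr (.inl (eq_of_div_sub_div_mem_nonunits hp5 haO ha0 hσu1 hv1 ?_ hv ?_))
        · have := congrArg σ hu
          simpa [hσa] using this
        · rw [h3]
          have := add_mem h5 hσy
          convert this using 1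
          ring

end AlternatingInertia

section Semilinear

open scoped Polynomial Pointwise

lemma map_mem_zeroPlace {k : Type} [Field k] {φ : RatFunc k ≃+* RatFunc k} {g : k[X] ≃+* k[X]}
    (hφ : ∀ f, φ (algebraMap k[X] (RatFunc k) f) = algebraMap k[X] (RatFunc k) (g f))
    (hg : ∀ f, (g f).eval 0 = f.eval 0) {x : RatFunc k} (hx : x ∈ zeroPlace k) :
    φ x ∈ zeroPlace k := by
  obtain ⟨b, ⟨d, hd⟩, h⟩ := (Polynomial.idealX k).exists_primeCompl_mul_eq_of_integer x hx
  have hd' : d.eval 0 ≠ 0 := by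
    rw [← Polynomial.coeff_zero_eq_eval_zero, Ne, ← Polynomial.X_dvd_iff,
      ← Ideal.mem_span_singleton]
    exact hd
  have h1 : algebraMap k[X] (RatFunc k) (g d) ∉ (zeroPlace k).nonunits := by
    rwa [algebraMap_mem_nonunits_zeroPlace_iff, hg]
  have h2 : algebraMap k[X] (RatFunc k) (g b) ∈ zeroPlace k :=
    IsDedekindDomain.HeightOneSpectrum.valuation_le_one _ _
  have h3 : x * algebraMap k[X] (RatFunc k) d = algebraMap _ _ b := h
  have h4 : φ x * algebraMap k[X] (RatFunc k) (g d) = algebraMap _ _ (g b) := by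
    rw [← hφ, ← hφ, ← h3, map_mul]
  have h5 : algebraMap k[X] (RatFunc k) (g d) ≠ 0 := fun h =>
    h1 (h ▸ (zeroPlace k).nonunits.zero_mem)
  rw [(eq_mul_inv_iff_mul_eq₀ h5).mpr h4]
  exact mul_mem h2 (ValuationSubring.inv_mem_of_notMem_nonunits h1)

/-- The automorphism `X ↦ ζ * X` of `k(X)`. -/
lemma exists_scaling (k : Type) [Field k] {ζ : k} (hζ : ζ ≠ 0) :
    ∃ φ : RatFunc k ≃+* RatFunc k, (∀ c : k, φ (algebraMap k (RatFunc k) c) = algebraMap k (RatFunc k) c) ∧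
      φ RatFunc.X = algebraMap k (RatFunc k) ζ * RatFunc.X ∧
      (zeroPlace k).comap (φ : RatFunc k →+* RatFunc k) = zeroPlace k := by
  let := invertibleOfNonzero hζ
  set g := Polynomial.algEquivCMulXAddC ζ 0
  set φ : RatFunc k ≃+* RatFunc k :=
    IsFractionRing.ringEquivOfRingEquiv (A := k[X]) (B := k[X]) (g : k[X] ≃+* k[X])
  have hφ : ∀ f, φ (algebraMap k[X] (RatFunc k) f) = algebraMap k[X] (RatFunc k) (g f) :=
    fun f => IsFractionRing.ringEquivOfRingEquiv_algebraMap (g : k[X] ≃+* k[X]) f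
  have hg : ∀ f, (g f).eval 0 = f.eval 0 := by
    intro f
    have : g f = f.comp (Polynomial.C ζ * Polynomial.X + Polynomial.C 0) := rfl
    rw [this]
    simp
  have hφ' : ∀ f, φ.symm (algebraMap k[X] (RatFunc k) f) = algebraMap k[X] (RatFunc k) (g.symm f) := by
    intro f
    rw [RingEquiv.symm_apply_eq, hφ, AlgEquiv.apply_symm_apply]
  have hg' : ∀ f, (g.symm f).eval 0 = f.eval 0 := by
    intro f
    rw [← hg, AlgEquiv.apply_symm_apply]
  refine ⟨φ, fun c => ?_, ?_, ?_⟩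
  · rw [IsScalarTower.algebraMap_apply k k[X] (RatFunc k), hφ, AlgEquiv.commutes]
  · have h1 : g Polynomial.X = Polynomial.C ζ * Polynomial.X := by
      have : g Polynomial.X = Polynomial.X.comp (Polynomial.C ζ * Polynomial.X + Polynomial.C 0) := rfl
      rw [this]
      simp
    rw [← RatFunc.algebraMap_X, hφ, h1, map_mul, IsScalarTower.algebraMap_apply k k[X] (RatFunc k)]
    rfl
  · ext x
    refine ⟨fun h => ?_, fun h => map_mem_zeroPlace (g := (g : k[X] ≃+* k[X])) hφ hg h⟩
    have := map_mem_zeroPlace (φ := φ.symm) (g := (g.symm : k[X] ≃+* k[X])) hφ' hg' h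
    simpa using this

/-- A semilinear automorphism can be adjusted to lie in the inertia group of a given place. -/
lemma IsRationalPlace.exists_semilinear {k K L : Type} [Field k] [IsAlgClosed k] [Field K]
    [Algebra k K] [Field L] [Algebra K L] [IsGalois K L] [FiniteDimensional K L]
    {w : ValuationSubring K} {t : K} (hw : IsRationalPlace k w t) {O : ValuationSubring L}
    (hO : O.comap (algebraMap K L) = w) {φ : K ≃+* K}
    (hφk : ∀ c : k, φ (algebraMap k K c) = algebraMap k K c)
    (hφw : w.comap (φ : K →+* K) = w) {ψ : L ≃+* L}
    (hψ : ∀ x, ψ (algebraMap K L x) = algebraMap K L (φ x)) :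
    ∃ τ : L ≃ₐ[K] L, ∀ f ∈ O, ψ (τ f) - f ∈ O.nonunits := by
  have hO' : (O.comap (ψ : L →+* L)).comap (algebraMap K L) = w := by
    have h1 : (ψ : L →+* L).comp (algebraMap K L) = (algebraMap K L).comp (φ : K →+* K) :=
      RingHom.ext hψ
    rw [ValuationSubring.comap_comap, h1, ← ValuationSubring.comap_comap, hO, hφw]
  obtain ⟨τ, hτ⟩ := hw.exists_smul_eq hO hO'
  have h1 : ∀ f, ψ (τ f) ∈ O ↔ f ∈ O := by
    intro f
    have h2 : τ f ∈ O.comap (ψ : L →+* L) ↔ f ∈ O := by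
      rw [← hτ, ValuationSubring.mem_smul_iff, AlgEquiv.symm_apply_apply]
    exact h2
  refine ⟨τ, fun f hf => ?_⟩
  obtain ⟨a, ha⟩ := hw.exists_sub_mem_nonunits hO hf
  have h2 : ψ (τ (f - algebraMap K L (algebraMap k K a))) ∈ O.nonunits := by
    rw [ValuationSubring.mem_nonunits_iff_or] at ha ⊢
    rw [← map_inv₀ ψ, ← map_inv₀ τ, h1, map_eq_zero_iff _ ψ.injective, map_eq_zero_iff _ τ.injective]
    exact ha
  rw [map_sub, map_sub, AlgEquiv.commutes, hψ, hφk] at h2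
  have h3 := sub_mem h2 ha
  rwa [sub_sub_sub_cancel_right] at h3

end Semilinear

section AlternatingGroupTheory

open Equiv

lemma alternatingGroup_le_of_swap_normalizes {p : ℕ} [hp : Fact p.Prime] (hp5 : 5 ≤ p)
    {H : Subgroup (Perm (Fin p))} (hH : p ∣ Nat.card H) {s : Perm (Fin p)} (hs : s.IsSwap)
    (hsH : s ∈ Subgroup.normalizer (H : Set (Perm (Fin p)))) : alternatingGroup (Fin p) ≤ H := by
  classical
  have h1 : Subgroup.normalizer (H : Set (Perm (Fin p))) = ⊤ := by
    refine Perm.subgroup_eq_top_of_swap_mem (by rw [Fintype.card_fin]; exact hp.out) ?_ hsH hs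
    rw [Fintype.card_fin, ← Nat.card_eq_fintype_card]
    exact hH.trans (Subgroup.card_dvd_of_le Subgroup.le_normalizer)
  have hN : H.Normal := Subgroup.normalizer_eq_top_iff.mp h1
  obtain ⟨g, hg⟩ := exists_prime_orderOf_dvd_card' p hH
  have hg' : orderOf (g : Perm (Fin p)) = p := (Subgroup.orderOf_coe g).trans hg
  have hsg : (g : Perm (Fin p)) ∈ alternatingGroup (Fin p) := by
    rw [Perm.mem_alternatingGroup]
    rcases Int.units_eq_one_or (Perm.sign (g : Perm (Fin p))) with h | h
    · exact h
    · have h2 := congrArg Perm.sign (pow_orderOf_eq_one (g : Perm (Fin p)))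
      rw [map_pow, h, hg', map_one, (hp.out.odd_of_ne_two (by omega)).neg_one_pow] at h2
      exact absurd h2 (by decide)
  have := alternatingGroup.isSimpleGroup (α := Fin p) (by simpa using hp5)
  rcases (hN.subgroupOf (alternatingGroup (Fin p))).eq_bot_or_eq_top with h | h
  · have h3 : (⟨g, hsg⟩ : alternatingGroup (Fin p)) ∈ H.subgroupOf (alternatingGroup (Fin p)) := g.2
    rw [h, Subgroup.mem_bot, Subtype.ext_iff] at h3
    have h3 : (g : Perm (Fin p)) = 1 := h3
    rw [h3, orderOf_one] at hg'
    exact absurd hg'.symm hp.out.ne_one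
  · exact Subgroup.subgroupOf_eq_top.mp h

end AlternatingGroupTheory

section AlternatingRootsFin

open Polynomial

variable {p : ℕ} [Fact p.Prime] {L : Type} [Field L] {T : L} {u : Fin p → L}

lemma prod_X_sub_C_alternating [CharP L p] (hp2 : p ≠ 2) (hu : Function.Injective u)
    (huT : ∀ i, u i ∈ alternatingRoots p T) :
    ∏ i, (X - C (u i)) = (X : L[X]) ^ (p - 2) * (X + 1) ^ 2 - C T := by
  have hp : p.Prime := Fact.out
  set F : L[X] := X ^ (p - 2) * (X + 1) ^ 2 - C T with hF
  have hdeg : F.natDegree = p := natDegree_alternating hp2 T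
  have hmonic : F.Monic := by
    refine Monic.sub_of_left ((monic_X_pow _).mul ((monic_X_add_C (1 : L)).pow 2)) ?_
    refine degree_C_le.trans_lt ?_
    rw [← natDegree_pos_iff_degree_pos]
    rw [hF, natDegree_sub_C] at hdeg
    exact hp.pos.trans_eq hdeg.symm
  refine (eq_of_monic_of_dvd_of_natDegree_le (monic_prod_X_sub_C _ _) hmonic ?_ ?_).symm
  · refine Finset.prod_dvd_of_coprime ?_ ?_
    · intro i _ j _ hij
      exact isCoprime_X_sub_C_of_isUnit_sub (sub_ne_zero.mpr (hu.ne hij)).isUnit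
    · intro i _
      rw [dvd_iff_isRoot]
      have := huT i
      simp only [alternatingRoots, Set.mem_ofPred_eq] at this
      simp [hF, this]
  · rw [hdeg, natDegree_prod_of_monic _ _ fun i _ => monic_X_sub_C _]
    simp

lemma prod_alternatingRoots [CharP L p] (hp2 : p ≠ 2) (hu : Function.Injective u)
    (huT : ∀ i, u i ∈ alternatingRoots p T) : ∏ i, u i = T := by
  have hp3 : 3 ≤ p := lt_of_le_of_ne (Fact.out : p.Prime).two_le hp2.symm
  have h := congrArg (eval 0) (prod_X_sub_C_alternating hp2 hu huT)
  have hodd : Odd p := (Fact.out : p.Prime).odd_of_ne_two hp2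
  rw [eval_prod] at h
  simpa [Finset.prod_neg, hodd.neg_one_pow, show p - 2 ≠ 0 by omega] using h

lemma prod_alternatingRoots_add_one [CharP L p] (hp2 : p ≠ 2) (hu : Function.Injective u)
    (huT : ∀ i, u i ∈ alternatingRoots p T) : ∏ i, (u i + 1) = T := by
  have h := congrArg (eval (-1)) (prod_X_sub_C_alternating hp2 hu huT)
  have hodd : Odd p := (Fact.out : p.Prime).odd_of_ne_two hp2
  have h1 : ∀ i, -1 - u i = -(u i + 1) := fun i => by ring
  rw [eval_prod] at h
  simp only [eval_sub, eval_X, eval_C, h1, Finset.prod_neg] at h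
  simpa [hodd.neg_one_pow] using h

lemma prod_sub_alternatingRoots [CharP L p] (hp2 : p ≠ 2) (hu : Function.Injective u)
    (huT : ∀ i, u i ∈ alternatingRoots p T) (i : Fin p) :
    ∏ j ∈ {i}ᶜ, (u i - u j) = -2 * u i ^ (p - 3) * (u i + 1) := by
  have h := congrArg (fun f => eval (u i) (derivative f)) (prod_X_sub_C_alternating hp2 hu huT)
  simp only [derivative_alternating hp2] at h
  rw [derivative_prod_finset, eval_finsetSum, Finset.sum_eq_single i] at h
  · simp only [eval_mul, eval_prod, derivative_X_sub_C, eval_one, mul_one, eval_sub, eval_X,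
      eval_C, eval_pow, eval_add, eval_neg, eval_ofNat] at h
    rw [← h]
    exact Finset.prod_congr (by ext; simp) fun _ _ => rfl
  · intro j _ hj
    rw [eval_mul, eval_prod, Finset.prod_eq_zero (i := i), zero_mul]
    · simpa using hj.symm
    · simp
  · simp

lemma exists_prod_sub_sq_eq [CharP L p] (hp5 : 5 ≤ p) (hu : Function.Injective u)
    (huT : ∀ i, u i ∈ alternatingRoots p T) :
    ∃ c : ℤ, (∏ i, ∏ j ∈ Finset.Ioi i, (u j - u i)) ^ 2 = c * T ^ (p - 2) := by
  have hp2 : p ≠ 2 := by omega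
  refine ⟨(∏ i : Fin p, ∏ j ∈ Finset.Ioi i, (-1)) * (-2) ^ p, ?_⟩
  have h1 := Finset.prod_prod_Ioi_mul_eq_prod_prod_off_diag fun j i : Fin p => u i - u j
  simp_rw [prod_sub_alternatingRoots hp2 hu huT] at h1
  rw [Finset.prod_mul_distrib, Finset.prod_mul_distrib, Finset.prod_pow,
    prod_alternatingRoots hp2 hu huT, prod_alternatingRoots_add_one hp2 hu huT,
    Finset.prod_const, Finset.card_univ, Fintype.card_fin, mul_assoc, ← pow_succ,
    show p - 3 + 1 = p - 2 by omega] at h1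
  push_cast
  rw [mul_assoc, ← h1, sq, ← Finset.prod_mul_distrib, ← Finset.prod_mul_distrib]
  refine Finset.prod_congr rfl fun i _ => ?_
  rw [← Finset.prod_mul_distrib, ← Finset.prod_mul_distrib]
  exact Finset.prod_congr rfl fun j _ => by ring

end AlternatingRootsFin

section AlternatingGaloisGroup

open Equiv

variable {K L : Type} [Field K] [Field L] [Algebra K L]

lemma exists_permHom {ι : Type*} {u : ι → L} (hu : Function.Injective u)
    (h : ∀ (σ : L ≃ₐ[K] L) i, ∃ j, u j = σ (u i)) :
    ∃ ρ : (L ≃ₐ[K] L) →* Perm ι, ∀ σ i, u (ρ σ i) = σ (u i) := by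
  choose f hf using h
  let g : (L ≃ₐ[K] L) →* Function.End ι :=
    { toFun := f
      map_one' := funext fun i => hu (hf 1 i)
      map_mul' := fun σ τ => funext fun i => hu <| by
        change u (f (σ * τ) i) = u (f σ (f τ i))
        rw [hf, hf, hf]
        rfl }
  exact ⟨g.toHomPerm, hf⟩

lemma sign_eq_one_of_discriminant {n : ℕ} {u : Fin n → L} (hu : Function.Injective u)
    (h2 : (2 : L) ≠ 0) {d : K}
    (hd : (∏ i, ∏ j ∈ Finset.Ioi i, (u j - u i)) ^ 2 = algebraMap K L d ^ 2) {σ : L ≃ₐ[K] L}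
    {s : Perm (Fin n)} (hs : ∀ i, u (s i) = σ (u i)) : Perm.sign s = 1 := by
  set δ := ∏ i, ∏ j ∈ Finset.Ioi i, (u j - u i) with hδ
  have h0 : δ ≠ 0 := by
    refine Finset.prod_ne_zero_iff.mpr fun i _ => Finset.prod_ne_zero_iff.mpr fun j hj => ?_
    exact sub_ne_zero.mpr (hu.ne (Finset.mem_Ioi.mp hj).ne')
  have h1 : σ δ = δ := by
    rcases sq_eq_sq_iff_eq_or_eq_neg.mp hd with h | h <;> simp [h]
  have h3 : σ δ = Perm.sign s * δ := by
    have h4 := Matrix.det_permute s (Matrix.vandermonde u)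
    have h5 : (Matrix.vandermonde u).submatrix s id = Matrix.vandermonde fun i => σ (u i) := by
      ext i j
      simp [Matrix.vandermonde_apply, hs]
    rw [h5, Matrix.det_vandermonde, Matrix.det_vandermonde, ← hδ] at h4
    rw [← h4, hδ]
    simp
  rcases Int.units_eq_one_or (Perm.sign s) with h | h
  · exact h
  · rw [h1, h] at h3
    have : 2 * δ = 0 := by
      push_cast at h3
      linear_combination h3
    exact absurd this (mul_ne_zero h2 h0)

lemma swap_eq_of_forall {α : Type*} [DecidableEq α] {s : Perm α} {a b : α} (ha : s a = b)
    (h : ∀ c, c = a ∨ c = b ∨ s c = c) (hab : a ≠ b) : s.IsSwap := by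
  have hb : s b = a := by
    obtain ⟨c, hc⟩ := s.surjective a
    rcases h c with rfl | rfl | h
    · exact absurd (hc.symm.trans ha) hab
    · exact hc
    · rw [h] at hc
      rw [hc, ha] at h
      exact absurd h.symm hab
  refine ⟨a, b, hab, Equiv.ext fun c => ?_⟩
  by_cases hca : c = a
  · rw [hca, swap_apply_left, ha]
  by_cases hcb : c = b
  · rw [hcb, swap_apply_right, hb]
  rw [swap_apply_of_ne_of_ne hca hcb]
  exact ((h c).resolve_left hca).resolve_left hcb

/-- A field automorphism of `L` that preserves `K` normalizes the Galois group. -/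
lemma mem_normalizer_range_of_semilinear {ι : Type*} [Finite ι] {u : ι → L}
    (hu : Function.Injective u)
    {ρ : (L ≃ₐ[K] L) →* Perm ι} (hρ : ∀ σ i, u (ρ σ i) = σ (u i)) {σ : L ≃+* L}
    {φ : K ≃+* K} (hσ : ∀ x, σ (algebraMap K L x) = algebraMap K L (φ x)) {s : Perm ι}
    (hs : ∀ i, u (s i) = σ (u i)) : s ∈ Subgroup.normalizer (ρ.range : Set (Perm ι)) := by
  have hconj : ∀ τ : L ≃ₐ[K] L, ∃ τ' : L ≃ₐ[K] L, ∀ x, τ' (σ x) = σ (τ x) := by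
    intro τ
    refine ⟨AlgEquiv.ofRingEquiv (f := (σ.symm.trans (τ : L ≃+* L)).trans σ) fun x => ?_, fun x => ?_⟩
    · obtain ⟨y, rfl⟩ := φ.surjective x
      have hy : σ.symm (algebraMap K L (φ y)) = algebraMap K L y := by
        rw [RingEquiv.symm_apply_eq, hσ]
      simp [hy, hσ]
    · simp
  have hconj' : ∀ τ : L ≃ₐ[K] L, s * ρ τ * s⁻¹ ∈ ρ.range := by
    intro τ
    obtain ⟨τ', hτ'⟩ := hconj τ
    refine ⟨τ', ?_⟩
    rw [eq_mul_inv_iff_mul_eq]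
    refine Equiv.ext fun i => hu ?_
    rw [Perm.mul_apply, Perm.mul_apply, hρ, hs, hs, hρ, hτ']
  refine Subgroup.mem_normalizer_fintype ?_
  rintro _ ⟨τ, rfl⟩
  exact hconj' τ

end AlternatingGaloisGroup

section AlternatingCover

open Equiv
open scoped Pointwise

lemma ValuationSubring.mem_nonunits_of_pow_mem {L : Type*} [Field L] {O : ValuationSubring L} {x : L}
    {n : ℕ} (h : x ^ n ∈ O.nonunits) : x ∈ O.nonunits := by
  rw [mem_nonunits_iff, map_pow] at h
  rw [mem_nonunits_iff]
  contrapose! h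
  exact one_le_pow₀ h

variable {p : ℕ} [Fact p.Prime] {L : Type} [Field L] [CharP L p]

lemma exists_isSwap_of_semilinear {O : ValuationSubring L} (hp5 : 5 ≤ p) {σ : L ≃+* L}
    (hσ : ∀ f ∈ O, σ f - f ∈ O.nonunits) {a b : L} (haO : a ∈ O.nonunits) (ha0 : a ≠ 0)
    (hbO : b ∈ O) (hb0 : b ≠ 0) (hab : a ^ 2 = b ^ (p - 2)) (hσa : σ a = -a) (hσb : σ b = b)
    {u : Fin p → L} (hu : Function.Injective u) (huT : ∀ i, u i ∈ alternatingRoots p (a ^ 2))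
    (hsurj : ∀ v ∈ alternatingRoots p (a ^ 2), ∃ i, u i = v) :
    ∃ s : Perm (Fin p), s.IsSwap ∧ ∀ i, u (s i) = σ (u i) := by
  have hp2 : p ≠ 2 := by omega
  have haT : a ^ 2 ∈ O.nonunits := by
    rw [sq]
    exact ValuationSubring.mul_mem_nonunits (ValuationSubring.nonunits_mem haO) haO
  have hstable : ∀ i, ∃ j, u j = σ (u i) := by
    intro i
    refine hsurj _ ?_
    have := congrArg σ (show u i ^ (p - 2) * (u i + 1) ^ 2 = a ^ 2 from huT i)
    rw [map_mul, map_pow, map_pow, map_pow, map_add, map_one, hσa, neg_sq] at this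
    exact this
  choose f hf using hstable
  have hinj : Function.Injective f := fun i j hij =>
    hu (σ.injective (by rw [← hf, ← hf, hij]))
  set s : Perm (Fin p) := Equiv.ofBijective f (Finite.injective_iff_bijective.mp hinj)
  have hs : ∀ i, u (s i) = σ (u i) := hf
  have htype : ∀ i, u i ∈ O.nonunits ∨ u i + 1 ∈ O.nonunits := by
    intro i
    have h1 : u i ^ (p - 2) * (u i + 1) ^ 2 = a ^ 2 := huT i
    have h2 : u i ∈ O := mem_of_pow_mul_pow_mem hp5 (h1 ▸ ValuationSubring.nonunits_mem haT)
    rw [← h1] at haT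
    rcases ValuationSubring.mem_or_mem_of_mul_mem_nonunits haT with h | h
    · exact Or.inl (ValuationSubring.mem_nonunits_of_pow_mem h)
    · exact Or.inr (ValuationSubring.mem_nonunits_of_pow_mem h)
  obtain ⟨i, hi⟩ : ∃ i, u i + 1 ∈ O.nonunits := by
    by_contra! h
    have h1 : ∏ i, (u i + 1) ∉ O.nonunits := by
      refine Finset.prod_induction _ (· ∉ O.nonunits) ?_ O.one_notMem_nonunits fun i _ => h i
      intro x y hx hy hxy
      rcases ValuationSubring.mem_or_mem_of_mul_mem_nonunits hxy with h | h
      · exact hx h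
      · exact hy h
    rw [prod_alternatingRoots_add_one hp2 hu huT] at h1
    exact h1 haT
  obtain ⟨h1, h2⟩ := semilinear_apply hp5 hσ (ValuationSubring.nonunits_mem haO) ha0 hbO hb0 hab
    hσa hσb (huT i) hi
  refine ⟨s, swap_eq_of_forall (a := i) rfl (fun j => ?_) fun h => h1 ?_, hs⟩
  · rcases h2 _ (huT j) (htype j) with h | h | h
    · exact Or.inl (hu h)
    · exact Or.inr (Or.inl (hu (h.trans (hs i).symm)))
    · exact Or.inr (Or.inr (hu ((hs j).trans h)))
  · rw [← hs, ← h]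

variable {k : Type} [Field k] [IsAlgClosed k] [CharP k p] [Algebra (RatFunc k) L]
  [IsGalois (RatFunc k) L] [FiniteDimensional (RatFunc k) L] {n r : ℕ}

lemma exists_semilinear_zeroPlace (hp5 : 5 ≤ p) (hr : r ≠ 0) (hn : n = 2 * (p - 2) * r)
    (hlift : ∀ φ : RatFunc k ≃+* RatFunc k, φ (RatFunc.X ^ n) = RatFunc.X ^ n →
      ∃ ψ : L ≃+* L, ∀ x, ψ (algebraMap (RatFunc k) L x) = algebraMap (RatFunc k) L (φ x))
    {O : ValuationSubring L} (hO : O.comap (algebraMap (RatFunc k) L) = zeroPlace k) :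
    ∃ (φ : RatFunc k ≃+* RatFunc k) (σ : L ≃+* L),
      φ (RatFunc.X ^ ((p - 2) * r)) = -RatFunc.X ^ ((p - 2) * r) ∧
      φ (RatFunc.X ^ (2 * r)) = RatFunc.X ^ (2 * r) ∧
      (∀ x, σ (algebraMap (RatFunc k) L x) = algebraMap (RatFunc k) L (φ x)) ∧
      ∀ f ∈ O, σ f - f ∈ O.nonunits := by
  obtain ⟨ζ, hζ⟩ := IsAlgClosed.exists_pow_nat_eq (-1 : k) (Nat.pos_of_ne_zero hr)
  have hζ0 : ζ ≠ 0 := by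
    rintro rfl
    rw [zero_pow hr] at hζ
    exact one_ne_zero (neg_eq_zero.mp hζ.symm)
  obtain ⟨φ, hφk, hφX, hφ0⟩ := exists_scaling k hζ0
  have hodd : Odd (p - 2) := Nat.Odd.sub_even (by omega)
    ((Fact.out : p.Prime).odd_of_ne_two (by omega)) even_two
  have h1 : φ (RatFunc.X ^ ((p - 2) * r)) = -RatFunc.X ^ ((p - 2) * r) := by
    rw [map_pow, hφX, mul_pow, ← map_pow, mul_comm (p - 2), pow_mul ζ, hζ, hodd.neg_one_pow]
    simp
  have h2 : φ (RatFunc.X ^ (2 * r)) = RatFunc.X ^ (2 * r) := by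
    rw [map_pow, hφX, mul_pow, ← map_pow, mul_comm 2, pow_mul ζ, hζ]
    simp
  have h3 : φ (RatFunc.X ^ n) = RatFunc.X ^ n := by
    rw [show n = 2 * r * (p - 2) by rw [hn]; ring, pow_mul, map_pow, h2]
  obtain ⟨ψ, hψ⟩ := hlift φ h3
  obtain ⟨τ, hτ⟩ := (isRationalPlace_zeroPlace k).exists_semilinear hO hφk hφ0 hψ
  refine ⟨φ, (τ : L ≃+* L).trans ψ, h1, h2, fun x => ?_, hτ⟩
  simp [hψ]

lemma nonempty_mulEquiv_alternatingGroup (hp5 : 5 ≤ p) (hr : r ≠ 0) (hn : n = 2 * (p - 2) * r)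
    (hcard : Nat.card (alternatingRoots p (algebraMap (RatFunc k) L (RatFunc.X ^ n))) = p)
    (hadj : Algebra.adjoin (RatFunc k)
      (alternatingRoots p (algebraMap (RatFunc k) L (RatFunc.X ^ n))) = ⊤)
    (hlift : ∀ φ : RatFunc k ≃+* RatFunc k, φ (RatFunc.X ^ n) = RatFunc.X ^ n →
      ∃ ψ : L ≃+* L, ∀ x, ψ (algebraMap (RatFunc k) L x) = algebraMap (RatFunc k) L (φ x))
    (hdvd : p ∣ Nat.card (L ≃ₐ[RatFunc k] L)) :
    Nonempty ((L ≃ₐ[RatFunc k] L) ≃* alternatingGroup (Fin p)) := by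
  have hp : p.Prime := Fact.out
  set z := algebraMap (RatFunc k) L RatFunc.X with hz
  have hz0 : z ≠ 0 := (map_ne_zero _).mpr RatFunc.X_ne_zero
  have hT : algebraMap (RatFunc k) L (RatFunc.X ^ n) = (z ^ ((p - 2) * r)) ^ 2 := by
    rw [map_pow, pow_eq_sq_of_eq_mul hn]
  obtain ⟨e⟩ : Nonempty (Fin p ≃ alternatingRoots p (algebraMap (RatFunc k) L (RatFunc.X ^ n))) := by
    have := Nat.finite_of_card_ne_zero (hcard ▸ hp.ne_zero)
    exact ⟨(Finite.equivFinOfCardEq hcard).symm⟩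
  set u : Fin p → L := fun i => e i with hudef
  have hu : Function.Injective u := Subtype.val_injective.comp e.injective
  have hsurj : ∀ v ∈ alternatingRoots p (algebraMap (RatFunc k) L (RatFunc.X ^ n)), ∃ i, u i = v :=
    fun v hv => ⟨e.symm ⟨v, hv⟩, by simp [hudef]⟩
  have huT : ∀ i, u i ∈ alternatingRoots p (algebraMap (RatFunc k) L (RatFunc.X ^ n)) :=
    fun i => (e i).2
  obtain ⟨ρ, hρ⟩ := exists_permHom hu fun (σ : L ≃ₐ[RatFunc k] L) i =>
    hsurj _ ((alternatingRootsAction p L (RatFunc.X ^ n : RatFunc k)).smul_mem' σ (huT i))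
  have hinj : Function.Injective ρ := by
    rw [injective_iff_map_eq_one]
    intro σ hσ
    refine AlgEquiv.eq_one_of_adjoin_eq_top hadj fun v hv => ?_
    obtain ⟨i, rfl⟩ := hsurj v hv
    rw [← hρ, hσ, Perm.one_apply]
  have hrange : ρ.range = alternatingGroup (Fin p) := by
    refine le_antisymm ?_ ?_
    · rintro _ ⟨σ, rfl⟩
      rw [Perm.mem_alternatingGroup]
      obtain ⟨c, hc⟩ := exists_prod_sub_sq_eq hp5 hu huT
      obtain ⟨d, hd⟩ := IsAlgClosed.exists_pow_nat_eq (c : k) two_pos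
      refine sign_eq_one_of_discriminant hu (two_ne_zero_of_charP (p := p) (by omega))
        (d := algebraMap k (RatFunc k) d * (RatFunc.X ^ ((p - 2) * r)) ^ (p - 2)) ?_ (hρ σ)
      rw [hc, hT, ← map_pow (algebraMap (RatFunc k) L) _ 2, mul_pow,
        ← map_pow (algebraMap k (RatFunc k)), hd, map_mul, map_intCast, map_intCast]
      simp only [map_pow, ← hz]
      ring
    · obtain ⟨O, hO⟩ := ValuationSubring.exists_comap_eq (L := L) (zeroPlace k)
      obtain ⟨φ, σ, h1, h2, h3, h4⟩ := exists_semilinear_zeroPlace hp5 hr hn hlift hO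
      have hzO : z ∈ O.nonunits :=
        (ValuationSubring.algebraMap_mem_nonunits_iff hO _).mpr
          (isRationalPlace_zeroPlace k).uniformizer_mem
      have hpow : ∀ {j : ℕ}, j ≠ 0 → z ^ j ∈ O.nonunits := by
        intro j hj
        obtain ⟨i, rfl⟩ := Nat.exists_eq_succ_of_ne_zero hj
        rw [pow_succ]
        exact ValuationSubring.mul_mem_nonunits (pow_mem (ValuationSubring.nonunits_mem hzO) _) hzO
      have ha : σ (z ^ ((p - 2) * r)) = -z ^ ((p - 2) * r) := by
        rw [hz, ← map_pow, h3, h1, map_neg]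
      have hb : σ (z ^ (2 * r)) = z ^ (2 * r) := by
        rw [hz, ← map_pow, h3, h2]
      rw [hT] at huT hsurj
      obtain ⟨s, hs, hsu⟩ := exists_isSwap_of_semilinear hp5 h4
        (hpow (mul_ne_zero (by omega) hr)) (pow_ne_zero _ hz0)
        (pow_mem (ValuationSubring.nonunits_mem hzO) (2 * r)) (pow_ne_zero _ hz0)
        ((pow_eq_sq_of_eq_mul hn).symm.trans (pow_eq_pow_of_eq_mul hn)) ha hb hu huT hsurj
      refine alternatingGroup_le_of_swap_normalizes hp5 ?_ hs
        (mem_normalizer_range_of_semilinear hu hρ h3 hsu)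
      rwa [← Nat.card_congr (ρ.ofInjective hinj).toEquiv]
  exact ⟨(ρ.ofInjective hinj).trans (MulEquiv.subgroupCongr hrange)⟩

variable (k) in
theorem hasWildCover_alternatingGroup (hp5 : 5 ≤ p) {m : ℕ} (hm : m ∣ (p - 1) / 2) :
    HasWildCover k p m (alternatingGroup (Fin p)) := by
  have hp : p.Prime := Fact.out
  obtain ⟨r, hmr⟩ := hm
  have hr : r ≠ 0 := by
    rintro rfl
    omega
  set n := 2 * (p - 2) * r with hn
  obtain ⟨L, _, _, _, _, hcard, hadj, hlift⟩ := exists_alternating_extension (p := p) (by omega)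
    (T := (RatFunc.X : RatFunc k) ^ n) (pow_ne_zero _ RatFunc.X_ne_zero)
  have hcharL : CharP L p := charP_of_injective_algebraMap (algebraMap (RatFunc k) L).injective p
  obtain ⟨O, hO⟩ := ValuationSubring.exists_comap_eq (L := L) (inftyPlace k)
  have h1 := exists_wild_subgroup_alternating hp5 hmr hn hcard hadj hO
  have hdvd : p ∣ Nat.card (L ≃ₐ[RatFunc k] L) := by
    obtain ⟨N, _, _, hN, _⟩ := h1
    exact hN ▸ N.card_subgroup_dvd_card
  refine ⟨L, inferInstance, inferInstance, inferInstance, inferInstance,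
    nonempty_mulEquiv_alternatingGroup hp5 hr hn hcard hadj hlift hdvd, ⟨O, hO, h1⟩, ?_⟩
  intro O hO σ _ hσ
  refine eq_one_of_inertia_alternating hp5 hn hadj ?_ hσ
  have := hO Polynomial.X
  rwa [RatFunc.algebraMap_X] at this

end AlternatingCover

section Inertia

open scoped Polynomial Pointwise

lemma stabilizer_eq_inertiaIn {k L : Type} [Field k] [IsAlgClosed k] [Field L]
    [Algebra (RatFunc k) L] [FiniteDimensional (RatFunc k) L] [IsGalois (RatFunc k) L]
    {O : ValuationSubring L} (hO : O.comap (algebraMap (RatFunc k) L) = inftyPlace k) :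
    MulAction.stabilizer (L ≃ₐ[RatFunc k] L) O = inertiaIn k O := by
  ext σ
  rw [mem_inertiaIn_iff, MulAction.mem_stabilizer_iff]
  exact ⟨fun h => ⟨h, fun f hf => (isRationalPlace_inftyPlace k).sub_mem_nonunits hO h hf⟩, And.left⟩

variable {k : Type} [Field k] [IsAlgClosed k] {p : ℕ} [CharP k p] {G : Type} [Group G]

lemma OccursAsInertiaAtInfty.dvd_card [Nontrivial G] (hp : p.Prime) {G₀ : Subgroup G}
    (h : OccursAsInertiaAtInfty k G G₀) : p ∣ Nat.card G₀ := by
  obtain ⟨L, _, _, _, _, _, _, _, e, O, hO, he⟩ := h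
  by_contra hdvd
  refine not_subsingleton G ⟨fun a b => e.injective ?_⟩
  rw [← stabilizer_eq_inertiaIn hO] at he
  have h1 : ¬ p ∣ Nat.card (MulAction.stabilizer (L ≃ₐ[RatFunc k] L) O) := by
    rwa [← he, ← Nat.card_congr (G₀.equivMapOfInjective e.toMonoidHom e.injective).toEquiv]
  rw [eq_one_of_not_dvd_card_stabilizer hp hO h1 (e a), eq_one_of_not_dvd_card_stabilizer hp hO h1 (e b)]

lemma HasWildCover.occursAsInertiaAtInfty [Finite G] (hG : SquareNormalizing p G) (hp : p.Prime)
    {m : ℕ} (h : HasWildCover k p m G) {N H : Subgroup G} (hN : Nat.card N = p) (hNH : N ≤ H)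
    (hH : H ≤ Subgroup.normalizer (N : Set G)) (hm : Nat.card H = p * m) :
    OccursAsInertiaAtInfty k G H := by
  obtain ⟨L, _, _, _, _, ⟨e⟩, ⟨O, hO, M, hM, hM', hMc, hSc⟩, hram⟩ := h
  let _ : Algebra k[X] L := ((algebraMap (RatFunc k) L).comp (algebraMap k[X] (RatFunc k))).toAlgebra
  have : IsScalarTower k[X] (RatFunc k) L := .of_algebraMap_eq fun _ => rfl
  have hcard : ∀ A : Subgroup G, Nat.card (A.map e.symm.toMonoidHom) = Nat.card A := fun A =>
    (Nat.card_congr (A.equivMapOfInjective e.symm.toMonoidHom e.symm.injective).toEquiv).symm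
  obtain ⟨g, hg⟩ := (hG.of_mulEquiv e).exists_conj_eq hp (N₁ := N.map e.symm.toMonoidHom)
    (H₁ := H.map e.symm.toMonoidHom) ((hcard N).trans hN) hMc (Subgroup.map_mono hNH) hM
    ((Subgroup.map_mono hH).trans (Subgroup.le_normalizer_map _)) hM' ((hcard H).trans hm) hSc
  refine ⟨L, inferInstance, inferInstance, inferInstance, inferInstance, inferInstance,
    inferInstance, etale_integralClosure hram, e.symm.trans (MulAut.conj g), O, hO, ?_⟩
  rw [← stabilizer_eq_inertiaIn hO, ← hg, Subgroup.map_map]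
  rfl

lemma Subgroup.normalClosure_eq_top_iff_ne_bot [IsSimpleGroup G] (H : Subgroup G) :
    normalClosure (H : Set G) = ⊤ ↔ H ≠ ⊥ := by
  constructor
  · rintro h rfl
    rw [normalClosure_eq_self] at h
    exact bot_ne_top h
  · intro h
    refine (normalClosure_normal (s := (H : Set G))).eq_bot_or_eq_top.resolve_left fun h1 => h ?_
    exact eq_bot_iff.mpr (h1 ▸ le_normalClosure)

theorem occursAsInertiaAtInfty_iff [Finite G] [IsSimpleGroup G] (hG : SquareNormalizing p G)
    (hp : p.Prime) (hcover : ∀ m, m ∣ (p - 1) / 2 → HasWildCover k p m G) {G₀ G₁ : Subgroup G}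
    (h₁₀ : G₁ ≤ G₀) [(G₁.subgroupOf G₀).Normal] (hp₁ : IsPGroup p G₁)
    (htame : ¬ p ∣ Nat.card (G₀ ⧸ G₁.subgroupOf G₀)) :
    OccursAsInertiaAtInfty k G G₀ ↔ Subgroup.normalClosure (G₁ : Set G) = ⊤ := by
  have hfact : Fact p.Prime := ⟨hp⟩
  have hcard : Nat.card G₀ = Nat.card G₁ * Nat.card (G₀ ⧸ G₁.subgroupOf G₀) := by
    rw [Subgroup.card_eq_card_quotient_mul_card_subgroup (G₁.subgroupOf G₀), mul_comm,
      Nat.card_congr (Subgroup.subgroupOfEquivOfLe h₁₀).toEquiv]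
  rw [Subgroup.normalClosure_eq_top_iff_ne_bot]
  constructor
  · rintro h rfl
    rw [Subgroup.card_bot, one_mul] at hcard
    exact htame (hcard ▸ h.dvd_card hp)
  · intro h
    have hN : Nat.card G₁ = p := by
      obtain ⟨n, hn⟩ := IsPGroup.iff_card.mp hp₁
      have hn2 : n < 2 := by
        by_contra! h2
        exact hG.not_sq_dvd ((pow_dvd_pow p h2).trans (hn ▸ G₁.card_subgroup_dvd_card))
      have hn0 : n ≠ 0 := by
        rintro rfl
        exact h (Subgroup.card_eq_one.mp hn)
      rw [hn, show n = 1 by omega, pow_one]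
    have hnorm : G₀ ≤ Subgroup.normalizer (G₁ : Set G) :=
      (Subgroup.normal_subgroupOf_iff_le_normalizer h₁₀).mp inferInstance
    rw [hN] at hcard
    exact (hcover _ (hG.dvd_half hp hN h₁₀ hnorm hcard)).occursAsInertiaAtInfty hG hp hN h₁₀ hnorm hcard

lemma HasWildCover.of_mulEquiv {H : Type} [Group H] {m : ℕ} (e : G ≃* H)
    (h : HasWildCover k p m H) : HasWildCover k p m G := by
  obtain ⟨L, _, _, _, _, ⟨e'⟩, h⟩ := h
  exact ⟨L, inferInstance, inferInstance, inferInstance, inferInstance, ⟨e'.trans e.symm⟩, h⟩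

end Inertia
/-- **Abhyankar's Inertia Conjecture for `A_p` and `PSL₂(p)`** (Bouw–Pries):
let `k` be an algebraically closed field of characteristic `p ≥ 5` and let `G` be
the alternating group `A_p` or the projective special linear group `PSL₂(𝔽_p)`.
Let `G₀ ≤ G` have a normal `p`-subgroup `G₁` with cyclic quotient `G₀/G₁` of
order prime to `p`.  Then `G₀` occurs as the inertia group at a point over `∞`
of some `G`-Galois cover of the projective line branched only at `∞` if and only
if the conjugates of `G₁` generate `G`. -/
theorem abhyankar_inertia_Ap_PSL2p (k : Type) [Field k] [IsAlgClosed k]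
    (p : ℕ) (hp : p.Prime) (hp5 : 5 ≤ p) [CharP k p]
    (G : Type) [Group G]
    (hG : Nonempty (G ≃* alternatingGroup (Fin p)) ∨ Nonempty (G ≃* PSL₂ (ZMod p)))
    (G₀ G₁ : Subgroup G) (h₁₀ : G₁ ≤ G₀)
    [hnorm : (G₁.subgroupOf G₀).Normal] (hp₁ : IsPGroup p G₁)
    (hcyc : IsCyclic (G₀ ⧸ G₁.subgroupOf G₀))
    (htame : ¬ p ∣ Nat.card (G₀ ⧸ G₁.subgroupOf G₀)) :
    OccursAsInertiaAtInfty k G G₀ ↔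
      Subgroup.normalClosure (G₁ : Set G) = ⊤ := by
  have hfact : Fact p.Prime := ⟨hp⟩
  have hp2 : p ≠ 2 := by omega
  rcases hG with ⟨⟨e⟩⟩ | ⟨⟨e⟩⟩
  · have : IsSimpleGroup (alternatingGroup (Fin p)) := alternatingGroup.isSimpleGroup (by simpa)
    have : Nontrivial G := e.toEquiv.nontrivial
    have : IsSimpleGroup G :=
      IsSimpleGroup.isSimpleGroup_of_surjective e.symm.toMonoidHom e.symm.surjective
    have : Finite G := Finite.of_equiv _ e.symm.toEquiv
    exact occursAsInertiaAtInfty_iff ((squareNormalizing_alternatingGroup hp hp2).of_mulEquiv e) hp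
      (fun m hm => (hasWildCover_alternatingGroup k hp5 hm).of_mulEquiv e) h₁₀ hp₁ htame
  · have : IsSimpleGroup (PSL₂ (ZMod p)) :=
      Matrix.ProjectiveSpecialLinearGroup.rank_two_simple (by rw [Nat.card_zmod]; omega)
    have : Nontrivial G := e.toEquiv.nontrivial
    have : IsSimpleGroup G :=
      IsSimpleGroup.isSimpleGroup_of_surjective e.symm.toMonoidHom e.symm.surjective
    have : Finite G := Finite.of_equiv _ e.symm.toEquiv
    exact occursAsInertiaAtInfty_iff ((squareNormalizing_PSL₂ hp hp2).of_mulEquiv e) hp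
      (fun m hm => (hasWildCover_PSL₂ k hp2 hm).of_mulEquiv e) h₁₀ hp₁ htame
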